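/- arXiv:2006.13923 — 2 statements merged into one kernel-verified Lean document; each statement's English description precedes it below -/
import Mathlib

section
/- Let r ≥ 2 be an integer and α a real number with 0 < α ≤ (r-1)²/r². Let g ∈ ℝ[z_1,…,z_n] be a multi-affine real stable polynomial, written g(z) = Σ_{A ⊆ [n]} a_A z^{A^c} where z^{A^c} = Π_{i∉A} z_i. If all roots of the diagonalization ḡ lie in the interval [0,1], a_∅ = 1, and |a_{{i}}| ≤ α for every i ∈ [n], then there exists a partition {S_1,…,S_r} of [n] (parts possibly empty) such that for every i ∈ {1,…,r}, the largest root of the diagonalization of ∂^{S_i^c} g is at most (√(1/r − α/(r−1)) + √α)². -/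
open MvPolynomial Polynomial

/-- A polynomial with real coefficients is *real stable* if it does not vanish
when all variables have positive imaginary part. -/
def RealStable {n : ℕ} (p : MvPolynomial (Fin n) ℝ) : Prop :=
  ∀ z : Fin n → ℂ, (∀ i, 0 < (z i).im) →
    MvPolynomial.eval z (MvPolynomial.map (algebraMap ℝ ℂ) p) ≠ 0

/-- A polynomial is *multi-affine* if it has degree at most 1 in each variable. -/
def MultiAffine {n : ℕ} (p : MvPolynomial (Fin n) ℝ) : Prop :=
  ∀ i, p.degreeOf i ≤ 1

/-- The diagonalization `p̄(x) = p(x,…,x)` of a multivariate polynomial. -/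
noncomputable def diagPoly {n : ℕ} (p : MvPolynomial (Fin n) ℝ) : Polynomial ℝ :=
  MvPolynomial.aeval (fun _ => Polynomial.X) p

/-- The exponent of the multi-affine monomial `∏_{i ∈ A} z_i`. -/
noncomputable def expOf {n : ℕ} (A : Finset (Fin n)) : Fin n →₀ ℕ :=
  ∑ i ∈ A, Finsupp.single i 1

/-- `∂^S p = (∏_{i ∈ S} ∂/∂z_i) p`. -/
noncomputable def pderivs {n : ℕ} (S : Finset (Fin n)) (p : MvPolynomial (Fin n) ℝ) :
    MvPolynomial (Fin n) ℝ :=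
  S.toList.foldr (fun i q => MvPolynomial.pderiv i q) p

/-- Restriction of `p` to the line `t ↦ a + t w`, as a univariate polynomial. -/
noncomputable def linePoly {n : ℕ} {A : Type*} [CommRing A] [Algebra ℝ A]
    (p : MvPolynomial (Fin n) ℝ) (a w : Fin n → A) : Polynomial A :=
  MvPolynomial.aeval (fun i => Polynomial.C (a i) + Polynomial.C (w i) * Polynomial.X) p

section Line

variable {n : ℕ} {A : Type*} [CommRing A] [Algebra ℝ A]

theorem eval_linePoly (p : MvPolynomial (Fin n) ℝ) (a w : Fin n → A) (x : A) :
    (linePoly p a w).eval x = MvPolynomial.aeval (fun i => a i + w i * x) p := by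
  induction p using MvPolynomial.induction_on with
  | C r => simp [linePoly, Polynomial.algebraMap_apply]
  | add p q hp hq => simp only [linePoly, map_add, Polynomial.eval_add] at hp hq ⊢; rw [hp, hq]
  | mul_X p i hp =>
    simp only [linePoly, map_mul, Polynomial.eval_mul] at hp ⊢; rw [hp]; simp

theorem aeval_linePoly (p : MvPolynomial (Fin n) ℝ) (a w : Fin n → ℝ) (z : A) :
    Polynomial.aeval z (linePoly p a w) =
      MvPolynomial.aeval (fun i => algebraMap ℝ A (a i) + algebraMap ℝ A (w i) * z) p := by
  induction p using MvPolynomial.induction_on with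
  | C r => simp [linePoly]
  | add p q hp hq => simp only [linePoly, map_add] at hp hq ⊢; rw [hp, hq]
  | mul_X p i hp => simp only [linePoly, map_mul] at hp ⊢; rw [hp]; simp

theorem derivative_linePoly (p : MvPolynomial (Fin n) ℝ) (a w : Fin n → A) :
    Polynomial.derivative (linePoly p a w) =
      ∑ k, Polynomial.C (w k) * linePoly (pderiv k p) a w := by
  induction p using MvPolynomial.induction_on with
  | C r => simp [linePoly, Polynomial.algebraMap_apply]
  | add p q hp hq =>
    simp only [linePoly, map_add, mul_add, Finset.sum_add_distrib] at hp hq ⊢; rw [hp, hq]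
  | mul_X p i hp =>
    have h : ∀ k, linePoly (pderiv k (p * MvPolynomial.X i)) a w =
        linePoly p a w * (if i = k then 1 else 0) + linePoly (pderiv k p) a w *
          (Polynomial.C (a i) + Polynomial.C (w i) * Polynomial.X) := by
      intro k
      simp only [linePoly, pderiv_mul, map_add, map_mul, MvPolynomial.aeval_X]
      rcases eq_or_ne i k with rfl | hik
      · simp; ring
      · simp [hik]
    simp only [h, mul_add, Finset.sum_add_distrib]
    have h2 : linePoly (p * MvPolynomial.X i) a w = linePoly p a w *
        (Polynomial.C (a i) + Polynomial.C (w i) * Polynomial.X) := by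
      simp [linePoly]
    rw [h2, Polynomial.derivative_mul, hp, Finset.sum_mul]
    have h3 : ∀ x, Polynomial.C (w x) * (linePoly p a w * if i = x then 1 else 0) =
        if i = x then Polynomial.C (w x) * linePoly p a w else 0 := by
      intro x; split_ifs <;> simp
    simp only [h3, Finset.sum_ite_eq, Finset.mem_univ, if_true]
    simp only [Polynomial.derivative_add, Polynomial.derivative_C, Polynomial.derivative_mul,
      Polynomial.derivative_X, mul_add, Finset.sum_add_distrib]
    simp only [mul_assoc]
    ring

theorem derivative_linePoly_single (p : MvPolynomial (Fin n) ℝ) (a : Fin n → A) (k : Fin n) :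
    Polynomial.derivative (linePoly p a (Pi.single k 1)) =
      linePoly (pderiv k p) a (Pi.single k 1) := by
  rw [derivative_linePoly, Finset.sum_eq_single k]
  · simp
  · intro b _ hb; simp [hb]
  · simp

theorem iterate_derivative_linePoly_single (p : MvPolynomial (Fin n) ℝ) (a : Fin n → A)
    (k : Fin n) (m : ℕ) :
    Polynomial.derivative^[m] (linePoly p a (Pi.single k 1)) =
      linePoly ((pderiv k)^[m] p) a (Pi.single k 1) := by
  induction m with
  | zero => rfl
  | succ m ih => rw [Function.iterate_succ_apply', ih, derivative_linePoly_single,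
      Function.iterate_succ_apply']

end Line

theorem pderiv_comm {n : ℕ} (i j : Fin n) (p : MvPolynomial (Fin n) ℝ) :
    pderiv i (pderiv j p) = pderiv j (pderiv i p) := by
  have h : ⁅(pderiv i : Derivation ℝ (MvPolynomial (Fin n) ℝ) (MvPolynomial (Fin n) ℝ)),
      (pderiv j : Derivation ℝ (MvPolynomial (Fin n) ℝ) (MvPolynomial (Fin n) ℝ))⁆ = 0 := by
    apply MvPolynomial.derivation_ext
    intro k
    rw [Derivation.commutator_apply]
    simp only [MvPolynomial.pderiv_X, Derivation.coe_zero, Pi.zero_apply]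
    simp [Pi.single_apply]
    split_ifs <;> simp
  have := congrArg (fun D => D p) h
  simp only [Derivation.commutator_apply, Derivation.coe_zero, Pi.zero_apply] at this
  exact sub_eq_zero.mp this

/-- Nonvanishing on the product of open upper half planes. -/
def Stable {n : ℕ} (p : MvPolynomial (Fin n) ℝ) : Prop :=
  ∀ z : Fin n → ℂ, (∀ i, 0 < (z i).im) → MvPolynomial.aeval z p ≠ 0

theorem RealStable.stable {n : ℕ} {p : MvPolynomial (Fin n) ℝ} (h : RealStable p) : Stable p := by
  intro z hz
  have := h z hz
  rwa [MvPolynomial.eval_map, ← MvPolynomial.aeval_def] at this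

theorem Stable.prod {n : ℕ} {ι : Type*} (s : Finset ι) (f : ι → MvPolynomial (Fin n) ℝ)
    (h : ∀ i ∈ s, Stable (f i)) : Stable (∏ i ∈ s, f i) := fun z hz => by
  rw [map_prod]; exact Finset.prod_ne_zero_iff.mpr fun i hi => h i hi z hz

theorem Stable.im_pderiv_mul_conj_nonpos {n : ℕ} {p : MvPolynomial (Fin n) ℝ} (hp : Stable p)
    (k : Fin n) {z : Fin n → ℂ} (hz : ∀ i, 0 < (z i).im) :
    (MvPolynomial.aeval z (pderiv k p) * star (MvPolynomial.aeval z p)).im ≤ 0 := by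
  set f := linePoly p z (Pi.single k 1) with hf
  have hev : ∀ q : MvPolynomial (Fin n) ℝ,
      (linePoly q z (Pi.single k 1)).eval 0 = MvPolynomial.aeval z q := by
    intro q; rw [eval_linePoly]; simp
  have h0 : f.eval 0 ≠ 0 := by rw [hf, hev]; exact hp z hz
  have hroot : ∀ t ∈ f.roots, t.im < 0 := by
    intro t ht
    by_contra hcon
    push Not at hcon
    have h1 := (Polynomial.mem_roots'.mp ht).2
    rw [Polynomial.IsRoot.def, hf, eval_linePoly] at h1
    refine hp _ (fun i => ?_) h1
    rcases eq_or_ne i k with rfl | hik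
    · simp; linarith [hz i]
    · simp [hik, hz i]
  have h2 := (IsAlgClosed.splits f).eval_derivative_div_eval_of_ne_zero h0
  rw [derivative_linePoly_single, hev, hf, hev, ← hf] at h2
  have h3 : ((f.roots.map fun z ↦ 1 / (0 - z)).sum).im ≤ 0 := by
    change Complex.imAddGroupHom _ ≤ 0
    rw [map_multiset_sum, Multiset.map_map]
    refine (Multiset.sum_le_card_nsmul _ 0 fun x hx => ?_).trans (by simp)
    obtain ⟨t, ht, rfl⟩ := Multiset.mem_map.mp hx
    simp only [Function.comp, Complex.coe_imAddGroupHom, one_div, Complex.inv_im, zero_sub,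
      Complex.neg_im, neg_neg]
    exact div_nonpos_of_nonpos_of_nonneg (hroot t ht).le (Complex.normSq_nonneg _)
  rw [← h2] at h3
  have h4 : MvPolynomial.aeval z (pderiv k p) * star (MvPolynomial.aeval z p) =
      (MvPolynomial.aeval z (pderiv k p) / MvPolynomial.aeval z p) *
        (Complex.normSq (MvPolynomial.aeval z p) : ℂ) := by
    have := hp z hz
    rw [← Complex.mul_conj]
    simp only [Complex.star_def]
    field_simp
  rw [h4, Complex.im_mul_ofReal]
  exact mul_nonpos_of_nonpos_of_nonneg h3 (Complex.normSq_nonneg _)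

theorem continuous_aeval_complex {n : ℕ} (p : MvPolynomial (Fin n) ℝ) :
    Continuous fun z : Fin n → ℂ => MvPolynomial.aeval z p := by
  induction p using MvPolynomial.induction_on with
  | C r => simpa using continuous_const
  | add p q hp hq => simp only [map_add]; exact hp.add hq
  | mul_X p i hp =>
    simp only [map_mul, MvPolynomial.aeval_X]; exact hp.mul (continuous_apply i)

theorem Stable.im_pderiv_mul_conj_nonpos' {n : ℕ} {p : MvPolynomial (Fin n) ℝ} (hp : Stable p)
    (k : Fin n) {z : Fin n → ℂ} (hz : ∀ i, 0 ≤ (z i).im) :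
    (MvPolynomial.aeval z (pderiv k p) * star (MvPolynomial.aeval z p)).im ≤ 0 := by
  have hc : Continuous fun e : ℝ => (MvPolynomial.aeval (fun i => z i + e * Complex.I) (pderiv k p) *
      star (MvPolynomial.aeval (fun i => z i + e * Complex.I) p)).im := by
    have h1 : Continuous fun e : ℝ => (fun i => z i + e * Complex.I : Fin n → ℂ) := by fun_prop
    exact Complex.continuous_im.comp (((continuous_aeval_complex _).comp h1).mul
      (continuous_star.comp ((continuous_aeval_complex _).comp h1)))
  have ht := (hc.tendsto 0).mono_left (nhdsWithin_le_nhds (s := Set.Ioi 0))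
  have := le_of_tendsto ht (b := 0) (by
    filter_upwards [self_mem_nhdsWithin] with e he
    apply hp.im_pderiv_mul_conj_nonpos
    intro i
    have := hz i
    simp only [Set.mem_Ioi] at he
    simp; linarith)
  simpa using this

theorem stable_pderiv {n : ℕ} {p : MvPolynomial (Fin n) ℝ} (hp : Stable p)
    {k : Fin n} (hk : pderiv k p ≠ 0) : Stable (pderiv k p) := by
  intro z hz h0
  apply hk
  have key : ∀ w : Fin n → ℂ, MvPolynomial.aeval w (pderiv k p) = 0 := by
    intro w
    set f := linePoly p z (w - z) with hf
    set h := linePoly (pderiv k p) z (w - z) with hh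
    have hf0 : f.eval 0 ≠ 0 := by rw [hf, eval_linePoly]; simpa using hp z hz
    have hh0 : h.eval 0 = 0 := by rw [hh, eval_linePoly]; simpa using h0
    have han : AnalyticAt ℂ (fun t => h.eval t / f.eval t) 0 :=
      AnalyticAt.div ((Polynomial.differentiable h).analyticAt 0)
        ((Polynomial.differentiable f).analyticAt 0) hf0
    have him : ∀ᶠ t in nhds (0 : ℂ), (h.eval t / f.eval t).im ≤ 0 := by
      have hpos : ∀ᶠ t in nhds (0 : ℂ), ∀ i, 0 < (z i + (w - z) i * t).im := by
        rw [Filter.eventually_all]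
        intro i
        have hc : Continuous fun t : ℂ => (z i + (w - z) i * t).im := by fun_prop
        apply hc.continuousAt.eventually_const_lt
        simpa using hz i
      filter_upwards [hpos] with t ht
      have h1 := hp.im_pderiv_mul_conj_nonpos k ht
      have h2 := hp _ ht
      rw [← eval_linePoly, ← eval_linePoly, ← hf, ← hh] at h1
      rw [← eval_linePoly, ← hf] at h2
      have h4 : h.eval t / f.eval t = h.eval t * star (f.eval t) *
          ((Complex.normSq (f.eval t))⁻¹ : ℝ) := by
        rw [Complex.star_def, Complex.ofReal_inv, ← Complex.mul_conj]
        have : (starRingEnd ℂ) (f.eval t) ≠ 0 := by simpa using h2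
        field_simp
      rw [h4, Complex.im_mul_ofReal]
      exact mul_nonpos_of_nonpos_of_nonneg h1 (inv_nonneg.mpr (Complex.normSq_nonneg _))
    rcases han.eventually_constant_or_nhds_le_map_nhds with hc | hm
    · have hz' : ∀ᶠ t in nhds (0 : ℂ), h.eval t = 0 := by
        have hfne : ∀ᶠ t in nhds (0 : ℂ), f.eval t ≠ 0 :=
          f.continuous.continuousAt.eventually_ne hf0
        filter_upwards [hc, hfne] with t h1 h2
        rw [hh0, zero_div, div_eq_zero_iff] at h1
        exact h1.resolve_right h2
      have : h = 0 := by
        apply Polynomial.eq_zero_of_infinite_isRoot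
        exact infinite_of_mem_nhds (0 : ℂ) hz'
      have h5 : h.eval 1 = 0 := by rw [this]; simp
      rw [hh, eval_linePoly] at h5
      simpa using h5
    · exfalso
      rw [hh0, zero_div] at hm
      have hev : ∀ᶠ y in nhds (0 : ℂ), y.im ≤ 0 := hm him
      have hcc : Filter.Tendsto (fun e : ℝ => (e : ℂ) * Complex.I) (nhdsWithin 0 (Set.Ioi 0))
          (nhds 0) := by
        have : Continuous fun e : ℝ => (e : ℂ) * Complex.I := by fun_prop
        simpa using (this.tendsto 0).mono_left (nhdsWithin_le_nhds (s := Set.Ioi 0))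
      obtain ⟨e, he1, he2⟩ := ((hcc.eventually hev).and self_mem_nhdsWithin).exists
      simp at he1 he2
      linarith
  apply MvPolynomial.funext
  intro x
  have := key (Complex.ofReal ∘ x)
  rw [map_zero]
  have h2 := MvPolynomial.aeval_algebraMap_apply ℂ x (pderiv k p)
  simp only [Complex.coe_algebraMap] at h2
  rw [this] at h2
  have h3 : MvPolynomial.aeval x (pderiv k p) = 0 := by exact_mod_cast h2.symm
  simpa [MvPolynomial.aeval_eq_eval] using h3

/-- `Im (h / f) ≤ 0` on the upper half plane, with the denominator cleared. -/
def Nevanlinna (f h : Polynomial ℝ) : Prop :=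
  ∀ z : ℂ, 0 < z.im → (Polynomial.aeval z h * star (Polynomial.aeval z f)).im ≤ 0

theorem Stable.nevanlinna_linePoly {n : ℕ} {p : MvPolynomial (Fin n) ℝ} (hp : Stable p)
    (k : Fin n) (a : Fin n → ℝ) {w : Fin n → ℝ} (hw : ∀ i, 0 ≤ w i) :
    Nevanlinna (linePoly p a w) (linePoly (pderiv k p) a w) := by
  intro z hz
  rw [aeval_linePoly, aeval_linePoly]
  apply hp.im_pderiv_mul_conj_nonpos'
  intro i
  simpa using mul_nonneg (hw i) hz.le

theorem hasDerivAt_aeval_vertical (f : Polynomial ℝ) (x : ℝ) :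
    HasDerivAt (fun e : ℝ => Polynomial.aeval ((x : ℂ) + e * Complex.I) f)
      (Complex.I * (Polynomial.derivative f).eval x) 0 := by
  have h1 : HasDerivAt (fun e : ℝ => (x : ℂ) + e * Complex.I) Complex.I 0 := by
    have := ((Complex.ofRealCLM.hasDerivAt (x := (0 : ℝ))).mul_const Complex.I).const_add (x : ℂ)
    simpa using this
  have h2 := Polynomial.hasDerivAt_aeval (𝕜 := ℂ) f ((x : ℂ) + (0 : ℝ) * Complex.I)
  have h3 := HasDerivAt.scomp (0 : ℝ) h2 h1
  have h4 : Polynomial.aeval ((x : ℂ) + (0 : ℝ) * Complex.I) (Polynomial.derivative f) =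
      (((Polynomial.derivative f).eval x : ℝ) : ℂ) := by
    have := Polynomial.aeval_algebraMap_apply ℂ x (Polynomial.derivative f)
    simpa using this
  rw [h4] at h3
  exact h3

theorem aeval_ofReal_eq (f : Polynomial ℝ) (x : ℝ) :
    Polynomial.aeval (x : ℂ) f = ((f.eval x : ℝ) : ℂ) := by
  have := Polynomial.aeval_algebraMap_apply ℂ x f
  simpa using this

theorem Nevanlinna.wronskian_le {f h : Polynomial ℝ} (H : Nevanlinna f h) (x : ℝ) :
    (Polynomial.derivative h).eval x * f.eval x ≤ h.eval x * (Polynomial.derivative f).eval x := by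
  have hd := (hasDerivAt_aeval_vertical h x).mul (hasDerivAt_aeval_vertical f x).star
  have hd2 := (Complex.imCLM.hasFDerivAt (x := _)).comp_hasDerivAt (0 : ℝ) hd
  have hneg : ∀ᶠ e in nhdsWithin (0 : ℝ) (Set.Ioi 0),
      slope (⇑Complex.imCLM ∘ ((fun e : ℝ => Polynomial.aeval ((x : ℂ) + e * Complex.I) h) *
        fun e : ℝ => star (Polynomial.aeval ((x : ℂ) + e * Complex.I) f))) 0 e ≤ 0 := by
    filter_upwards [self_mem_nhdsWithin] with e he
    simp only [Set.mem_Ioi] at he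
    rw [slope_def_field]
    apply div_nonpos_of_nonpos_of_nonneg _ (by simpa using he.le)
    have h1 := H (x + e * Complex.I) (by simpa using he)
    simp only [Function.comp, Pi.mul_apply, Complex.imCLM_apply, Complex.ofReal_zero, zero_mul,
      add_zero, aeval_ofReal_eq]
    have h2 : (((h.eval x : ℝ) : ℂ) * star ((f.eval x : ℝ) : ℂ)).im = 0 := by
      simp
    rw [h2]
    linarith
  have ht := (hasDerivAt_iff_tendsto_slope.mp hd2).mono_left
    (nhdsWithin_mono 0 (show Set.Ioi (0 : ℝ) ⊆ {0}ᶜ from fun e he => ne_of_gt he))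
  have := le_of_tendsto ht hneg
  simp [aeval_ofReal_eq] at this
  linarith

theorem Nevanlinna.antitoneOn {f h : Polynomial ℝ} (H : Nevanlinna f h) {s : Set ℝ}
    (hs : Convex ℝ s) (hf : ∀ x ∈ s, f.eval x ≠ 0) :
    AntitoneOn (fun x => h.eval x / f.eval x) s := by
  apply antitoneOn_of_deriv_nonpos hs
  · exact h.continuous.continuousOn.div f.continuous.continuousOn hf
  · intro x hx
    exact ((h.hasDerivAt x).div (f.hasDerivAt x)
      (hf x (interior_subset hx))).differentiableAt.differentiableWithinAt
  · intro x hx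
    have hd := (h.hasDerivAt x).div (f.hasDerivAt x) (hf x (interior_subset hx))
    have : deriv (fun x => h.eval x / f.eval x) x = _ := hd.deriv
    rw [this]
    apply div_nonpos_of_nonpos_of_nonneg _ (sq_nonneg _)
    linarith [H.wronskian_le x]

theorem Nevanlinna.aeval_ne_zero {f : Polynomial ℝ} (H : Nevanlinna f (Polynomial.derivative f))
    (hf : f ≠ 0) (z : ℂ) (hz : 0 < z.im) : Polynomial.aeval z f ≠ 0 := by
  intro h0
  set F := f.map (algebraMap ℝ ℂ) with hF
  have hF0 : F ≠ 0 := (Polynomial.map_ne_zero_iff (algebraMap ℝ ℂ).injective).mpr hf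
  have hroot : F.IsRoot z := by
    rw [Polynomial.IsRoot.def, hF, Polynomial.eval_map_algebraMap]; exact h0
  obtain ⟨q, hq, hqz⟩ := Polynomial.exists_eq_pow_rootMultiplicity_mul_and_not_dvd F hF0 z
  have hm : 0 < F.rootMultiplicity z := (Polynomial.rootMultiplicity_pos hF0).mpr hroot
  obtain ⟨m, hm⟩ := Nat.exists_eq_succ_of_ne_zero hm.ne'
  rw [hm] at hq
  have hqz' : q.eval z ≠ 0 := fun h => hqz (Polynomial.dvd_iff_isRoot.mpr h)
  have hkey : ∀ e : ℝ, 0 < e → e < z.im →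
      (m + 1) * Complex.normSq (q.eval (z - e * Complex.I)) +
        e * ((Polynomial.derivative q).eval (z - e * Complex.I) *
          star (q.eval (z - e * Complex.I))).im ≤ 0 := by
    intro e he hez
    have h1 := H (z - e * Complex.I) (by simpa using hez)
    rw [← Polynomial.eval_map_algebraMap, ← Polynomial.eval_map_algebraMap,
      ← Polynomial.derivative_map, ← hF, hq] at h1
    set y := z - e * Complex.I with hy
    have e1 : (Polynomial.derivative ((Polynomial.X - Polynomial.C z) ^ m.succ * q)).eval y =
        (-(e * Complex.I)) ^ m * ((m + 1) * q.eval y +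
          (-(e * Complex.I)) * (Polynomial.derivative q).eval y) := by
      simp only [Polynomial.derivative_mul, Polynomial.derivative_X_sub_C_pow, Polynomial.eval_add,
        Polynomial.eval_mul, Polynomial.eval_pow, Polynomial.eval_sub, Polynomial.eval_X,
        Polynomial.eval_C, hy]
      simp
      ring
    have e2 : ((Polynomial.X - Polynomial.C z) ^ m.succ * q).eval y =
        (-(e * Complex.I)) ^ m * (-(e * Complex.I)) * q.eval y := by
      simp [hy, pow_succ]
    rw [e1, e2] at h1
    have e3 : (-((e : ℂ) * Complex.I)) ^ m * ((m + 1) * q.eval y +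
          (-(e * Complex.I)) * (Polynomial.derivative q).eval y) *
        star ((-((e : ℂ) * Complex.I)) ^ m * (-(e * Complex.I)) * q.eval y) =
        ((Complex.normSq ((-((e : ℂ) * Complex.I)) ^ m) * e : ℝ) : ℂ) *
          (Complex.I * ((((m + 1) * Complex.normSq (q.eval y) : ℝ) : ℂ)) +
            e * ((Polynomial.derivative q).eval y * star (q.eval y))) := by
      rw [Complex.ofReal_mul, Complex.ofReal_mul, ← Complex.mul_conj, ← Complex.mul_conj]
      simp only [Complex.star_def, map_mul, map_neg, Complex.conj_I, Complex.conj_ofReal]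
      push_cast
      linear_combination (-(-((e : ℂ) * Complex.I)) ^ m *
        (starRingEnd ℂ) ((-((e : ℂ) * Complex.I)) ^ m) * e ^ 2 *
        (Polynomial.derivative q).eval y * (starRingEnd ℂ) (q.eval y)) * Complex.I_sq
    rw [e3, Complex.im_ofReal_mul] at h1
    have hpos : 0 < Complex.normSq ((-((e : ℂ) * Complex.I)) ^ m) * e := by
      apply mul_pos _ he
      rw [Complex.normSq_pos]
      apply pow_ne_zero
      simp [he.ne']
    have h2 := nonpos_of_mul_nonpos_right h1 hpos
    rw [Complex.add_im, Complex.im_ofReal_mul, mul_comm Complex.I, Complex.im_ofReal_mul] at h2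
    simpa using h2
  have hc : Continuous fun e : ℝ => (m + 1) * Complex.normSq (q.eval (z - e * Complex.I)) +
        e * ((Polynomial.derivative q).eval (z - e * Complex.I) *
          star (q.eval (z - e * Complex.I))).im := by
    have h1 : Continuous fun e : ℝ => z - e * Complex.I := by fun_prop
    have h2 := q.continuous.comp h1
    have h3 := (Polynomial.derivative q).continuous.comp h1
    exact (continuous_const.mul (Complex.continuous_normSq.comp h2)).add
      (continuous_id.mul (Complex.continuous_im.comp (h3.mul (continuous_star.comp h2))))
  have ht := (hc.tendsto 0).mono_left (nhdsWithin_le_nhds (s := Set.Ioi 0))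
  have := le_of_tendsto ht (b := 0) (by
    filter_upwards [self_mem_nhdsWithin, mem_nhdsWithin_of_mem_nhds (Iio_mem_nhds hz)] with e h1 h2
    exact hkey e h1 h2)
  simp at this
  have h5 := Complex.normSq_pos.mpr hqz'
  have : 0 < ((m : ℝ) + 1) * Complex.normSq (q.eval z) := by positivity
  linarith

theorem exists_prod_of_aeval_ne_zero (m : ℕ) : ∀ f : Polynomial ℝ, f ≠ 0 → f.natDegree = m →
    (∀ z : ℂ, 0 < z.im → Polynomial.aeval z f ≠ 0) →
    ∃ l : Fin m → ℝ, f = Polynomial.C f.leadingCoeff *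
      ∏ i, (Polynomial.X - Polynomial.C (l i)) := by
  induction m with
  | zero =>
    intro f _ hm _
    refine ⟨Fin.elim0, ?_⟩
    rw [Polynomial.eq_C_of_natDegree_eq_zero hm]
    simp
  | succ m ih =>
    intro f hf hm hr
    obtain ⟨z, hz⟩ := IsAlgClosed.exists_aeval_eq_zero ℂ f (by
      rw [Polynomial.degree_eq_natDegree hf, hm]; exact_mod_cast Nat.succ_ne_zero m)
    have hzr : z.im = 0 := by
      rcases lt_trichotomy z.im 0 with h | h | h
      · exfalso
        refine hr (star z) (by simpa using h) ?_
        have := Polynomial.aeval_conj f z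
        rw [Complex.star_def, this, hz, map_zero]
      · exact h
      · exact absurd hz (hr z h)
    have hz' : z = (z.re : ℂ) := Complex.ext (by simp) (by simpa using hzr)
    rw [hz', aeval_ofReal_eq] at hz
    have hroot : f.IsRoot z.re := by exact_mod_cast hz
    obtain ⟨q, hq⟩ := Polynomial.dvd_iff_isRoot.mpr hroot
    have hq0 : q ≠ 0 := by rintro rfl; simp at hq; exact hf hq
    have hlead : f.leadingCoeff = q.leadingCoeff := by rw [hq]; simp
    have hdeg : q.natDegree = m := by
      have : f.natDegree = 1 + q.natDegree := by
        rw [hq, Polynomial.natDegree_mul (Polynomial.X_sub_C_ne_zero _) hq0]; simp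
      omega
    obtain ⟨l, hl⟩ := ih q hq0 hdeg (fun w hw h => hr w hw (by rw [hq, map_mul, h, mul_zero]))
    refine ⟨Fin.cons z.re l, ?_⟩
    rw [Fin.prod_univ_succ]
    simp only [Fin.cons_zero, Fin.cons_succ]
    rw [hlead]
    calc f = (Polynomial.X - Polynomial.C z.re) * q := hq
      _ = (Polynomial.X - Polynomial.C z.re) * (Polynomial.C q.leadingCoeff *
          ∏ i, (Polynomial.X - Polynomial.C (l i))) := by rw [← hl]
      _ = _ := by ring

theorem Nevanlinna.local_root {f h q : Polynomial ℝ} (H : Nevanlinna f h) {x : ℝ} {m : ℕ}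
    (hf : f = (Polynomial.X - Polynomial.C x) ^ m * q) (w : ℂ) (hw : 0 < w.im) :
    h.eval x * q.eval x * (star (w ^ m)).im ≤ 0 := by
  have hc : Continuous fun e : ℝ => (Polynomial.aeval ((x : ℂ) + e * w) h *
      star (w ^ m * Polynomial.aeval ((x : ℂ) + e * w) q)).im := by
    have h1 : Continuous fun e : ℝ => (x : ℂ) + e * w := by fun_prop
    have h2 := (Polynomial.continuous_aeval h (A := ℂ)).comp h1
    have h3 := (Polynomial.continuous_aeval q (A := ℂ)).comp h1
    exact Complex.continuous_im.comp (h2.mul (continuous_star.comp (continuous_const.mul h3)))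
  have ht := (hc.tendsto 0).mono_left (nhdsWithin_le_nhds (s := Set.Ioi 0))
  have := le_of_tendsto ht (b := 0) (by
    filter_upwards [self_mem_nhdsWithin] with e he
    simp only [Set.mem_Ioi] at he
    have h1 := H (x + e * w) (by simpa using mul_pos he hw)
    rw [hf] at h1
    simp only [map_mul, map_pow, map_sub, Polynomial.aeval_X, Polynomial.aeval_C,
      Complex.coe_algebraMap, add_sub_cancel_left] at h1
    have e1 : Polynomial.aeval ((x : ℂ) + e * w) h *
        star (((e : ℂ) * w) ^ m * Polynomial.aeval ((x : ℂ) + e * w) q) =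
        ((e ^ m : ℝ) : ℂ) * (Polynomial.aeval ((x : ℂ) + e * w) h *
          star (w ^ m * Polynomial.aeval ((x : ℂ) + e * w) q)) := by
      simp only [Complex.star_def, map_mul, map_pow, Complex.conj_ofReal]
      push_cast
      ring
    rw [e1, Complex.im_ofReal_mul] at h1
    exact nonpos_of_mul_nonpos_right h1 (pow_pos he m))
  simp only [Complex.ofReal_zero, zero_mul, add_zero, aeval_ofReal_eq] at this
  have e2 : ((h.eval x : ℝ) : ℂ) * star (w ^ m * ((q.eval x : ℝ) : ℂ)) =
      ((h.eval x * q.eval x : ℝ) : ℂ) * star (w ^ m) := by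
    simp only [Complex.star_def, map_mul, Complex.conj_ofReal]
    push_cast
    ring
  rwa [e2, Complex.im_ofReal_mul] at this

theorem Nevanlinna.eval_eq_zero_of_multiple_root {f h q : Polynomial ℝ} (H : Nevanlinna f h)
    {x : ℝ} {m : ℕ} (hm : 2 ≤ m) (hf : f = (Polynomial.X - Polynomial.C x) ^ m * q)
    (hq : q.eval x ≠ 0) : h.eval x = 0 := by
  have hm0 : (m : ℂ) ≠ 0 := by exact_mod_cast (by omega : m ≠ 0)
  have hm2 : (2 : ℝ) ≤ m := by exact_mod_cast hm
  have key : ∀ c : ℝ, 0 < c → c < 2 * Real.pi →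
      h.eval x * q.eval x * (star (Complex.exp (c * Complex.I))).im ≤ 0 := by
    intro c hc0 hc1
    have := H.local_root hf (Complex.exp (((c / m : ℝ) : ℂ) * Complex.I)) (by
      rw [Complex.exp_ofReal_mul_I_im]
      apply Real.sin_pos_of_pos_of_lt_pi
      · positivity
      · rw [div_lt_iff₀ (by positivity)]
        nlinarith [Real.pi_pos])
    rw [← Complex.exp_nat_mul] at this
    have e : (m : ℂ) * (((c / m : ℝ) : ℂ) * Complex.I) = c * Complex.I := by
      push_cast; field_simp
    rwa [e] at this
  have h1 := key (Real.pi / 2) (by positivity) (by linarith [Real.pi_pos])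
  have h2 := key (Real.pi / 2 + Real.pi) (by positivity) (by linarith [Real.pi_pos])
  simp only [Complex.star_def, Complex.conj_im, Complex.exp_ofReal_mul_I_im, Real.sin_add_pi,
    Real.sin_pi_div_two] at h1 h2
  have : h.eval x * q.eval x = 0 := by linarith
  exact (mul_eq_zero.mp this).resolve_right hq

theorem Nevanlinna.of_mul_X_sub_C {f h : Polynomial ℝ} {x : ℝ}
    (H : Nevanlinna ((Polynomial.X - Polynomial.C x) * f) ((Polynomial.X - Polynomial.C x) * h)) :
    Nevanlinna f h := by
  intro z hz
  have h1 := H z hz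
  simp only [map_mul, map_sub, Polynomial.aeval_X, Polynomial.aeval_C,
      Complex.coe_algebraMap] at h1
  have hne : z - x ≠ 0 := by
    intro h0
    have := congrArg Complex.im h0
    simp at this
    linarith
  have e : (z - x) * Polynomial.aeval z h * star ((z - x) * Polynomial.aeval z f) =
      ((Complex.normSq (z - x) : ℝ) : ℂ) * (Polynomial.aeval z h * star (Polynomial.aeval z f)) := by
    rw [← Complex.mul_conj]
    simp only [Complex.star_def, map_mul]
    ring
  rw [e, Complex.im_ofReal_mul] at h1
  exact nonpos_of_mul_nonpos_right h1 (Complex.normSq_pos.mpr hne)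

theorem Nevanlinna.of_C_mul {f h : Polynomial ℝ} {c : ℝ} (hc : 0 < c)
    (H : Nevanlinna (Polynomial.C c * f) h) : Nevanlinna f h := by
  intro z hz
  have h1 := H z hz
  simp only [map_mul, Polynomial.aeval_C, Complex.coe_algebraMap] at h1
  have e : Polynomial.aeval z h * star (c * Polynomial.aeval z f) =
      (c : ℂ) * (Polynomial.aeval z h * star (Polynomial.aeval z f)) := by
    simp only [Complex.star_def, map_mul, Complex.conj_ofReal]
    ring
  rw [e, Complex.im_ofReal_mul] at h1
  exact nonpos_of_mul_nonpos_right h1 hc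

/-- Partial fractions for `h / f` with nonnegative weights. -/
theorem Nevanlinna.partial_fractions {ι : Type*} [DecidableEq ι] (l : ι → ℝ) (s : Finset ι) :
    ∀ h : Polynomial ℝ, h.natDegree ≤ s.card →
    Nevanlinna (∏ i ∈ s, (Polynomial.X - Polynomial.C (l i))) h →
    ∃ (c : ℝ) (d : ι → ℝ), (∀ i ∈ s, 0 ≤ d i) ∧
      h = Polynomial.C c * ∏ i ∈ s, (Polynomial.X - Polynomial.C (l i)) +
        ∑ i ∈ s, Polynomial.C (d i) * ∏ j ∈ s.erase i, (Polynomial.X - Polynomial.C (l j)) := by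
  induction s using Finset.strongInduction with
  | H s ih =>
  intro h hdeg H
  by_cases hex : ∃ i ∈ s, h.eval (l i) = 0
  · obtain ⟨i, hi, hz⟩ := hex
    obtain ⟨q, rfl⟩ := Polynomial.dvd_iff_isRoot.mpr hz
    rw [← Finset.mul_prod_erase s _ hi] at H
    have hq : q.natDegree ≤ (s.erase i).card := by
      rw [Finset.card_erase_of_mem hi]
      rcases eq_or_ne q 0 with rfl | hq0
      · simp
      · rw [Polynomial.natDegree_mul (Polynomial.X_sub_C_ne_zero _) hq0,
          Polynomial.natDegree_X_sub_C] at hdeg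
        omega
    obtain ⟨c, d, hd, hqe⟩ := ih _ (Finset.erase_ssubset hi) q hq H.of_mul_X_sub_C
    refine ⟨c, fun j => if j = i then 0 else d j, ?_, ?_⟩
    · intro j hj
      dsimp only
      split_ifs with hji
      · exact le_rfl
      · exact hd j (Finset.mem_erase.mpr ⟨hji, hj⟩)
    · rw [← Finset.add_sum_erase s _ hi, ← Finset.mul_prod_erase s _ hi]
      simp only [if_true, Polynomial.C_0, zero_mul, zero_add]
      conv_lhs => rw [hqe, mul_add, Finset.mul_sum]
      congr 1
      · ring
      · apply Finset.sum_congr rfl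
        intro j hj
        have hji : j ≠ i := Finset.ne_of_mem_erase hj
        rw [if_neg hji, ← Finset.mul_prod_erase (s.erase j) _
          (Finset.mem_erase.mpr ⟨hji.symm, hi⟩), Finset.erase_right_comm]
        ring
  · push Not at hex
    set P := ∏ i ∈ s, (Polynomial.X - Polynomial.C (l i)) with hP
    have hPm : P.Monic := Polynomial.monic_prod_X_sub_C l s
    have hPd : P.natDegree = s.card := Polynomial.natDegree_finsetProd_X_sub_C_eq_card s l
    have hinj : Set.InjOn l s := by
      intro i hi j hj hij
      by_contra hne
      obtain ⟨q, hq, hqz⟩ :=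
        Polynomial.exists_eq_pow_rootMultiplicity_mul_and_not_dvd P hPm.ne_zero (l i)
      have h2 : 2 ≤ P.rootMultiplicity (l i) := by
        rw [Polynomial.le_rootMultiplicity_iff hPm.ne_zero, hP, ← Finset.mul_prod_erase s _ hi,
          ← Finset.mul_prod_erase (s.erase i) _ (Finset.mem_erase.mpr ⟨Ne.symm hne, hj⟩),
          ← hij, ← mul_assoc, sq]
        exact dvd_mul_right _ _
      exact hex i hi (H.eval_eq_zero_of_multiple_root h2 hq
        (fun h0 => hqz (Polynomial.dvd_iff_isRoot.mpr h0)))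
    set c := h.coeff s.card with hc
    set Q : ι → ℝ := fun i => (∏ j ∈ s.erase i, (Polynomial.X - Polynomial.C (l j))).eval (l i)
      with hQ
    have hQe : ∀ i, Q i = ∏ j ∈ s.erase i, (l i - l j) := by
      intro i; simp [hQ, Polynomial.eval_prod]
    refine ⟨c, fun i => h.eval (l i) * (Q i)⁻¹, ?_, ?_⟩
    · intro i hi
      have h1 := H.local_root (x := l i) (m := 1)
        (q := ∏ j ∈ s.erase i, (Polynomial.X - Polynomial.C (l j)))
        (by rw [pow_one, hP, Finset.mul_prod_erase s (fun i => Polynomial.X - Polynomial.C (l i)) hi])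
        Complex.I (by simp)
      simp at h1
      have h2 : 0 ≤ h.eval (l i) * Q i := h1
      have h3 : h.eval (l i) * (Q i)⁻¹ = h.eval (l i) * Q i * ((Q i)⁻¹) ^ 2 := by
        rcases eq_or_ne (Q i) 0 with h0 | h0
        · simp [h0]
        · field_simp
      change 0 ≤ h.eval (l i) * (Q i)⁻¹
      rw [h3]
      exact mul_nonneg h2 (sq_nonneg _)
    · have hlt : (h - Polynomial.C c * P).degree < s.card := by
        rw [Polynomial.degree_lt_iff_coeff_zero]
        intro k hk
        rcases eq_or_lt_of_le hk with hk | hk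
        · rw [← hk, Polynomial.coeff_sub, Polynomial.coeff_C_mul]
          have : P.coeff s.card = 1 := by rw [← hPd]; exact hPm.coeff_natDegree
          rw [this]; simp [hc]
        · rw [Polynomial.coeff_sub, Polynomial.coeff_C_mul,
            Polynomial.coeff_eq_zero_of_natDegree_lt (by omega),
            Polynomial.coeff_eq_zero_of_natDegree_lt (by omega)]
          simp
      have hL := Lagrange.eq_interpolate hinj hlt
      rw [← sub_eq_iff_eq_add', hL, Lagrange.interpolate_apply]
      apply Finset.sum_congr rfl
      intro i hi
      have hPi : P.eval (l i) = 0 := by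
        rw [hP, ← Finset.mul_prod_erase s _ hi]; simp
      have hb : Lagrange.basis s l i = Polynomial.C (Q i)⁻¹ *
          ∏ j ∈ s.erase i, (Polynomial.X - Polynomial.C (l j)) := by
        rw [Lagrange.basis, hQe, ← Finset.prod_inv_distrib, map_prod, ← Finset.prod_mul_distrib]
        rfl
      rw [hb]
      simp [hPi, Polynomial.C_mul, mul_assoc]

theorem eval_derivative_C_mul_prod_X_sub_C {ι : Type*} (s : Finset ι) (c : ℝ) (l : ι → ℝ) {x : ℝ}
    (hx : ∀ i ∈ s, x ≠ l i) :
    (Polynomial.derivative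
      (Polynomial.C c * ∏ i ∈ s, (Polynomial.X - Polynomial.C (l i)))).eval x =
      (Polynomial.C c * ∏ i ∈ s, (Polynomial.X - Polynomial.C (l i))).eval x *
        ∑ i ∈ s, 1 / (x - l i) := by
  classical
  induction s using Finset.induction_on with
  | empty => simp
  | insert i s hi ih =>
    have h1 : x - l i ≠ 0 := sub_ne_zero.mpr (hx i (Finset.mem_insert_self i s))
    have h2 := ih fun j hj => hx j (Finset.mem_insert_of_mem hj)
    rw [Finset.prod_insert hi, Finset.sum_insert hi, mul_left_comm (Polynomial.C c)]
    generalize Polynomial.C c * ∏ i ∈ s, (Polynomial.X - Polynomial.C (l i)) = P at h2 ⊢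
    rw [Polynomial.derivative_mul, Polynomial.eval_add,
      Polynomial.eval_mul, Polynomial.eval_mul, h2]
    simp only [Polynomial.derivative_sub, Polynomial.derivative_X, Polynomial.derivative_C,
      Polynomial.eval_sub, Polynomial.eval_X, Polynomial.eval_C, Polynomial.eval_mul, sub_zero,
      Polynomial.eval_one]
    field_simp

section Above

variable {n : ℕ}

theorem eval_linePoly_real (p : MvPolynomial (Fin n) ℝ) (a w : Fin n → ℝ) (x : ℝ) :
    (linePoly p a w).eval x = MvPolynomial.eval (fun i => a i + w i * x) p := by
  rw [eval_linePoly, MvPolynomial.aeval_eq_eval]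
  

/-- The point `a` lies above the roots of `p`. -/
def Above (p : MvPolynomial (Fin n) ℝ) (a : Fin n → ℝ) : Prop :=
  ∀ u : Fin n → ℝ, (∀ i, a i ≤ u i) → 0 < MvPolynomial.eval u p

theorem Above.prod {ι : Type*} {s : Finset ι} {p : ι → MvPolynomial (Fin n) ℝ} {a : Fin n → ℝ}
    (hp : ∀ i ∈ s, Above (p i) a) : Above (∏ i ∈ s, p i) a := fun u hu => by
  rw [map_prod]; exact Finset.prod_pos fun i hi => hp i hi u hu

theorem Above.linePoly_pos {p : MvPolynomial (Fin n) ℝ} {a : Fin n → ℝ} (h : Above p a)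
    {u w : Fin n → ℝ} (hu : ∀ i, a i ≤ u i) (hw : ∀ i, 0 ≤ w i) {x : ℝ} (hx : 0 ≤ x) :
    0 < (linePoly p u w).eval x := by
  rw [eval_linePoly_real]
  exact h _ fun i => (hu i).trans (le_add_of_nonneg_right (mul_nonneg (hw i) hx))

theorem single_one_nonneg (k i : Fin n) : 0 ≤ (Pi.single k 1 : Fin n → ℝ) i := by
  by_cases h : i = k
  · subst h; simp
  · simp [Pi.single_eq_of_ne h]

theorem Stable.exists_linePoly_eq_prod {p : MvPolynomial (Fin n) ℝ} (hp : Stable p)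
    (u : Fin n → ℝ) (k : Fin n) (h0 : linePoly p u (Pi.single k 1) ≠ 0) {m : ℕ}
    (hm : (linePoly p u (Pi.single k 1)).natDegree = m) :
    ∃ l : Fin m → ℝ, linePoly p u (Pi.single k 1) =
      Polynomial.C (linePoly p u (Pi.single k 1)).leadingCoeff *
        ∏ i, (Polynomial.X - Polynomial.C (l i)) := by
  have hN := hp.nevanlinna_linePoly k u (single_one_nonneg k)
  rw [← derivative_linePoly_single] at hN
  exact exists_prod_of_aeval_ne_zero m _ h0 hm (hN.aeval_ne_zero h0)

theorem Stable.pderiv_nonneg {p : MvPolynomial (Fin n) ℝ} (hp : Stable p) {a : Fin n → ℝ}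
    (ha : Above p a) (k : Fin n) {u : Fin n → ℝ} (hu : ∀ i, a i ≤ u i) :
    0 ≤ MvPolynomial.eval u (pderiv k p) := by
  set f := linePoly p u (Pi.single k 1) with hf
  have hpos : ∀ x, 0 ≤ x → 0 < f.eval x := fun x hx =>
    ha.linePoly_pos hu (single_one_nonneg k) hx
  have h0 : f ≠ 0 := fun h => by have := hpos 0 le_rfl; simp [h] at this
  obtain ⟨m, hm⟩ : ∃ m, f.natDegree = m := ⟨_, rfl⟩
  obtain ⟨l, hl⟩ := hp.exists_linePoly_eq_prod u k h0 hm
  rw [← hf] at hl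
  have hneg : ∀ i, l i < 0 := by
    intro i
    by_contra! h
    have h1 := hpos _ h
    rw [hl, Polynomial.eval_mul, Polynomial.eval_prod,
      Finset.prod_eq_zero (Finset.mem_univ i) (by simp)] at h1
    simp at h1
  have h1 := eval_derivative_C_mul_prod_X_sub_C Finset.univ f.leadingCoeff l (x := 0)
    (fun i _ => (hneg i).ne')
  rw [← hl] at h1
  have h2 : (Polynomial.derivative f).eval 0 = MvPolynomial.eval u (pderiv k p) := by
    rw [hf, derivative_linePoly_single, eval_linePoly_real]; simp
  rw [← h2, h1]
  refine mul_nonneg (hpos 0 le_rfl).le (Finset.sum_nonneg fun i _ => ?_)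
  have := hneg i
  exact one_div_nonneg.mpr (by linarith)

theorem Above.pderiv {p : MvPolynomial (Fin n) ℝ} {a : Fin n → ℝ} (ha : Above p a)
    (hp : Stable p) {k : Fin n} (hk : pderiv k p ≠ 0) : Above (pderiv k p) a := by
  intro u hu
  refine lt_of_le_of_ne (hp.pderiv_nonneg ha k hu) fun h0 => ?_
  set f := linePoly p u (fun _ => 1) with hf
  set h := linePoly (MvPolynomial.pderiv k p) u (fun _ => 1) with hh
  have hfpos : ∀ x ∈ Set.Ici (0 : ℝ), 0 < f.eval x := fun x hx =>
    ha.linePoly_pos hu (fun _ => zero_le_one) hx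
  have hN : Nevanlinna f h := hp.nevanlinna_linePoly k u fun _ => zero_le_one
  have hanti := hN.antitoneOn (convex_Ici 0) fun x hx => (hfpos x hx).ne'
  have hhzero : ∀ x ∈ Set.Ici (0 : ℝ), h.eval x = 0 := by
    intro x hx
    have h1 := hanti (Set.self_mem_Ici) hx hx
    have h2 : h.eval 0 = 0 := by rw [hh, eval_linePoly_real]; simpa using h0.symm
    simp only [h2, zero_div] at h1
    have h3 : 0 ≤ h.eval x := by
      rw [hh, eval_linePoly_real]
      exact hp.pderiv_nonneg ha k fun i => (hu i).trans (by simpa using hx)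
    exact le_antisymm (by simpa using (div_le_iff₀ (hfpos x hx)).mp h1) h3
  have hz : h = 0 := Polynomial.eq_zero_of_infinite_isRoot h
    ((Set.Ici_infinite (0 : ℝ)).mono hhzero)
  refine stable_pderiv hp hk (fun i => (u i : ℂ) + Complex.I) (fun i => by simp) ?_
  have h4 := aeval_linePoly (MvPolynomial.pderiv k p) u (fun _ => 1) Complex.I
  rw [← hh, hz] at h4
  simpa using h4.symm

theorem Stable.pderiv_div_antitone {p : MvPolynomial (Fin n) ℝ} (hp : Stable p)
    {a u : Fin n → ℝ} (ha : Above p a) (hu : ∀ i, a i ≤ u i) (k : Fin n) :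
    MvPolynomial.eval u (MvPolynomial.pderiv k p) / MvPolynomial.eval u p ≤
      MvPolynomial.eval a (MvPolynomial.pderiv k p) / MvPolynomial.eval a p := by
  have hw : ∀ i, 0 ≤ (u - a) i := fun i => sub_nonneg.mpr (hu i)
  have h := (hp.nevanlinna_linePoly k a hw).antitoneOn (convex_Ici 0)
    (fun x hx => (ha.linePoly_pos (fun _ => le_rfl) hw hx).ne')
    (Set.self_mem_Ici) (Set.mem_Ici.mpr zero_le_one) zero_le_one
  simpa [eval_linePoly_real] using h

end Above

section MultiPderiv

variable {n : ℕ}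

instance leftCommutative_pderiv :
    LeftCommutative fun (i : Fin n) (q : MvPolynomial (Fin n) ℝ) => pderiv i q :=
  ⟨fun i j q => pderiv_comm i j q⟩

/-- The partial derivatives of `p` with respect to all variables in a multiset. -/
noncomputable def multiPderiv (M : Multiset (Fin n)) (p : MvPolynomial (Fin n) ℝ) :
    MvPolynomial (Fin n) ℝ :=
  M.foldr (fun i q => pderiv i q) p

@[simp] theorem multiPderiv_zero (p : MvPolynomial (Fin n) ℝ) : multiPderiv 0 p = p := rfl

theorem multiPderiv_cons (k : Fin n) (M : Multiset (Fin n)) (p : MvPolynomial (Fin n) ℝ) :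
    multiPderiv (k ::ₘ M) p = pderiv k (multiPderiv M p) :=
  Multiset.foldr_cons (fun i q => pderiv i q) p k M

theorem multiPderiv_add (M N : Multiset (Fin n)) (p : MvPolynomial (Fin n) ℝ) :
    multiPderiv (M + N) p = multiPderiv M (multiPderiv N p) := by
  exact Multiset.foldr_add (fun i q => pderiv i q) p M N

theorem multiPderiv_pderiv (k : Fin n) (M : Multiset (Fin n)) (p : MvPolynomial (Fin n) ℝ) :
    multiPderiv M (pderiv k p) = pderiv k (multiPderiv M p) := by
  have h : multiPderiv ({k} : Multiset (Fin n)) p = pderiv k p := multiPderiv_cons k 0 p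
  rw [← multiPderiv_cons, ← h, ← multiPderiv_add, add_comm, Multiset.singleton_add]

theorem multiPderiv_replicate (k : Fin n) (m : ℕ) (p : MvPolynomial (Fin n) ℝ) :
    multiPderiv (Multiset.replicate m k) p = (pderiv k)^[m] p := by
  induction m with
  | zero => rfl
  | succ m ih => rw [Multiset.replicate_succ, multiPderiv_cons, ih, Function.iterate_succ_apply']

theorem multiPderiv_map_add (M : Multiset (Fin n)) (p q : MvPolynomial (Fin n) ℝ) :
    multiPderiv M (p + q) = multiPderiv M p + multiPderiv M q := by
  induction M using Multiset.induction_on with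
  | empty => rfl
  | cons k M ih => simp only [multiPderiv_cons, ih, map_add]

theorem multiPderiv_map_zero (M : Multiset (Fin n)) :
    multiPderiv M (0 : MvPolynomial (Fin n) ℝ) = 0 := by
  induction M using Multiset.induction_on with
  | empty => rfl
  | cons k M ih => simp only [multiPderiv_cons, ih, map_zero]

theorem multiPderiv_C_mul (M : Multiset (Fin n)) (c : ℝ) (p : MvPolynomial (Fin n) ℝ) :
    multiPderiv M (MvPolynomial.C c * p) = MvPolynomial.C c * multiPderiv M p := by
  induction M using Multiset.induction_on with
  | empty => rfl
  | cons k M ih => simp only [multiPderiv_cons, ih, pderiv_C_mul]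

theorem multiPderiv_sum {ι : Type*} (M : Multiset (Fin n)) (s : Finset ι)
    (p : ι → MvPolynomial (Fin n) ℝ) :
    multiPderiv M (∑ i ∈ s, p i) = ∑ i ∈ s, multiPderiv M (p i) := by
  classical
  induction s using Finset.induction_on with
  | empty => simp [multiPderiv_map_zero]
  | insert i s hi ih => rw [Finset.sum_insert hi, Finset.sum_insert hi, multiPderiv_map_add, ih]

theorem multiPderiv_ne_zero_of_le {M N : Multiset (Fin n)} (h : N ≤ M)
    {p : MvPolynomial (Fin n) ℝ} (hM : multiPderiv M p ≠ 0) : multiPderiv N p ≠ 0 := by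
  obtain ⟨K, rfl⟩ := Multiset.le_iff_exists_add.mp h
  rw [add_comm, multiPderiv_add] at hM
  intro h0
  rw [h0, multiPderiv_map_zero] at hM
  exact hM rfl

theorem Stable.multiPderiv {p : MvPolynomial (Fin n) ℝ} (hp : Stable p) {M : Multiset (Fin n)}
    (hM : multiPderiv M p ≠ 0) : Stable (multiPderiv M p) := by
  induction M using Multiset.induction_on with
  | empty => exact hp
  | cons k M ih =>
    rw [multiPderiv_cons] at hM ⊢
    exact stable_pderiv (ih fun h => hM (by rw [h, map_zero])) hM

theorem Above.multiPderiv {p : MvPolynomial (Fin n) ℝ} {a : Fin n → ℝ} (ha : Above p a)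
    (hp : Stable p) {M : Multiset (Fin n)} (hM : multiPderiv M p ≠ 0) :
    Above (multiPderiv M p) a := by
  induction M using Multiset.induction_on with
  | empty => exact ha
  | cons k M ih =>
    rw [multiPderiv_cons] at hM ⊢
    have h0 : _root_.multiPderiv M p ≠ 0 := fun h => hM (by rw [h, map_zero])
    exact (ih h0).pderiv (hp.multiPderiv h0) hM

theorem pderivs_eq_multiPderiv (S : Finset (Fin n)) (p : MvPolynomial (Fin n) ℝ) :
    pderivs S p = multiPderiv S.val p := by
  rw [pderivs, multiPderiv, ← Finset.coe_toList, Multiset.coe_foldr]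

end MultiPderiv

theorem sum_sub_single_ge {ι : Type*} [Fintype ι] [DecidableEq ι] {u : ι → ℝ} (hu : ∀ i, 0 < u i)
    {φ M : ℝ} (hM : ∀ i, u i ≤ M) (hφ : ∑ i, 1 / u i ≤ φ) (hc : 2 ≤ Fintype.card ι) (i : ι) :
    ((Fintype.card ι : ℝ) - 1) ^ 2 / (φ - 1 / M) ≤ (∑ j, u j) - u i := by
  have hcs := Finset.sq_sum_div_le_sum_sq_div (Finset.univ.erase i) (fun _ => (1 : ℝ))
    (g := fun j => 1 / u j) fun j _ => one_div_pos.mpr (hu j)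
  have hcard : ((Finset.univ.erase i).card : ℝ) = (Fintype.card ι : ℝ) - 1 := by
    rw [Finset.card_erase_of_mem (Finset.mem_univ i), Finset.card_univ, Nat.cast_sub (by omega)]
    simp
  simp only [Finset.sum_const, nsmul_eq_mul, hcard, mul_one, one_pow, one_div, div_inv_eq_mul,
    one_mul] at hcs
  rw [← Finset.sum_erase_eq_sub (Finset.mem_univ i)]
  refine le_trans ?_ hcs
  have hpos : 0 < ∑ j ∈ Finset.univ.erase i, (u j)⁻¹ := by
    apply Finset.sum_pos (fun j _ => inv_pos.mpr (hu j))
    rw [← Finset.card_pos, Finset.card_erase_of_mem (Finset.mem_univ i), Finset.card_univ]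
    omega
  have hle : ∑ j ∈ Finset.univ.erase i, (u j)⁻¹ ≤ φ - 1 / M := by
    rw [Finset.sum_erase_eq_sub (Finset.mem_univ i)]
    have h1 := one_div_le_one_div_of_le (hu i) (hM i)
    simp only [one_div] at h1 hφ ⊢
    linarith
  exact div_le_div_of_nonneg_left (sq_nonneg _) hpos hle

theorem natDegree_le_of_iterate_derivative_eq_zero {f : Polynomial ℝ} {r : ℕ}
    (h : Polynomial.derivative^[r + 1] f = 0) : f.natDegree ≤ r := by
  rw [Polynomial.natDegree_le_iff_coeff_eq_zero]
  intro m hm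
  obtain ⟨d, rfl⟩ : ∃ d, m = d + (r + 1) := ⟨m - (r + 1), by omega⟩
  have h1 := Polynomial.coeff_iterate_derivative (p := f) (k := r + 1) d
  rw [h, Polynomial.coeff_zero, nsmul_eq_mul, eq_comm, mul_eq_zero] at h1
  refine h1.resolve_left ?_
  have : (d + (r + 1)).descFactorial (r + 1) ≠ 0 := by
    rw [Ne, Nat.descFactorial_eq_zero_iff_lt]; omega
  exact_mod_cast this

theorem eval_iterate_derivative_of_natDegree_le {f : Polynomial ℝ} {m : ℕ}
    (hf : f.natDegree ≤ m + 1) (y : ℝ) :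
    (Polynomial.derivative^[m] f).eval y =
      m.factorial * (f.coeff m + (m + 1) * f.coeff (m + 1) * y) := by
  have hd : (Polynomial.derivative^[m] f).natDegree ≤ 1 :=
    (Polynomial.natDegree_iterate_derivative f m).trans (by omega)
  rw [Polynomial.eval_eq_sum_range' (Nat.lt_succ_of_le hd), Finset.sum_range_succ,
    Finset.sum_range_one, Polynomial.coeff_iterate_derivative, Polynomial.coeff_iterate_derivative]
  have h1 : (0 + m).descFactorial m = m.factorial := by rw [zero_add, Nat.descFactorial_self]
  have h2 : (1 + m).descFactorial m = (m + 1) * m.factorial := by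
    have h := Nat.factorial_mul_descFactorial (Nat.le_add_left m 1)
    rw [Nat.add_sub_cancel, Nat.factorial_one, one_mul, add_comm 1 m, Nat.factorial_succ] at h
    rw [add_comm, h]
  rw [h1, h2, zero_add, add_comm 1 m]
  simp only [nsmul_eq_mul]
  push_cast
  ring

theorem eval_iterate_derivative_prod {ι : Type*} [Fintype ι] {m : ℕ}
    (hm : Fintype.card ι = m + 1) (l : ι → ℝ) (y : ℝ) :
    (Polynomial.derivative^[m] (∏ i, (Polynomial.X - Polynomial.C (l i)))).eval y =
      m.factorial * ((m + 1) * y - ∑ i, l i) := by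
  have hmon := Polynomial.monic_prod_of_monic Finset.univ
    (fun i => Polynomial.X - Polynomial.C (l i)) fun i _ => Polynomial.monic_X_sub_C (l i)
  have hdeg : (∏ i, (Polynomial.X - Polynomial.C (l i))).natDegree = m + 1 := by
    rw [Polynomial.natDegree_finsetProd_X_sub_C_eq_card, Finset.card_univ, hm]
  rw [eval_iterate_derivative_of_natDegree_le hdeg.le]
  have h1 : (∏ i, (Polynomial.X - Polynomial.C (l i))).coeff (m + 1) = 1 := by
    rw [← hdeg]; exact hmon.coeff_natDegree
  have h2 : (∏ i, (Polynomial.X - Polynomial.C (l i))).coeff m = - ∑ i, l i := by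
    have := Polynomial.prod_X_sub_C_coeff_card_pred Finset.univ l (by
      rw [Finset.card_univ, hm]; omega)
    rwa [Finset.card_univ, hm] at this
  rw [h1, h2]
  ring

theorem eval_iterate_derivative_prod_erase {ι : Type*} [Fintype ι] [DecidableEq ι] {m : ℕ}
    (hm : Fintype.card ι = m + 1) (l : ι → ℝ) (i : ι) (y : ℝ) :
    (Polynomial.derivative^[m]
      (∏ j ∈ Finset.univ.erase i, (Polynomial.X - Polynomial.C (l j)))).eval y = m.factorial := by
  have hmon := Polynomial.monic_prod_of_monic (Finset.univ.erase i)
    (fun j => Polynomial.X - Polynomial.C (l j)) fun j _ => Polynomial.monic_X_sub_C (l j)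
  have hdeg : (∏ j ∈ Finset.univ.erase i, (Polynomial.X - Polynomial.C (l j))).natDegree = m := by
    rw [Polynomial.natDegree_finsetProd_X_sub_C_eq_card,
      Finset.card_erase_of_mem (Finset.mem_univ i), Finset.card_univ, hm]
    rfl
  rw [eval_iterate_derivative_of_natDegree_le (by omega)]
  have h1 : (∏ j ∈ Finset.univ.erase i, (Polynomial.X - Polynomial.C (l j))).coeff m = 1 := by
    conv_lhs => rw [← hdeg]
    exact hmon.coeff_natDegree
  rw [h1, Polynomial.coeff_eq_zero_of_natDegree_lt (by omega)]
  ring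

section SignBelow

variable {n : ℕ} {F : MvPolynomial (Fin n) ℝ} {a : Fin n → ℝ} {k : Fin n} {r : ℕ}

theorem pderiv_iterate_eq_multiPderiv (k : Fin n) (m : ℕ) (p : MvPolynomial (Fin n) ℝ) :
    (pderiv k)^[m] p = multiPderiv (Multiset.replicate m k) p :=
  (multiPderiv_replicate k m p).symm

theorem natDegree_linePoly_le (v : Fin n → ℝ) (h : (pderiv k)^[r + 1] F = 0) :
    (linePoly F v (Pi.single k 1)).natDegree ≤ r :=
  natDegree_le_of_iterate_derivative_eq_zero (by
    rw [iterate_derivative_linePoly_single, h]; simp [linePoly])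

theorem exists_linePoly_eq_prod_neg (hF : Stable F) (ha : Above F a)
    (h1 : (pderiv k)^[r + 1] F = 0) (h2 : (pderiv k)^[r] F ≠ 0) {v : Fin n → ℝ}
    (hv : ∀ i, a i ≤ v i) :
    ∃ (c : ℝ) (l : Fin r → ℝ), 0 < c ∧ (∀ i, l i < 0) ∧ linePoly F v (Pi.single k 1) =
      Polynomial.C c * ∏ i, (Polynomial.X - Polynomial.C (l i)) := by
  set f := linePoly F v (Pi.single k 1) with hf
  have hle : f.natDegree ≤ r := natDegree_linePoly_le v h1
  have hcoeff : 0 < f.coeff r := by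
    rw [pderiv_iterate_eq_multiPderiv] at h2
    have h3 := ha.multiPderiv hF h2 v hv
    rw [multiPderiv_replicate] at h3
    have h4 := iterate_derivative_linePoly_single F v k r
    have h5 := Polynomial.coeff_iterate_derivative (p := f) (k := r) 0
    rw [hf, h4, Polynomial.coeff_zero_eq_eval_zero, eval_linePoly_real, zero_add,
      Nat.descFactorial_self, nsmul_eq_mul] at h5
    simp only [mul_zero, add_zero] at h5
    rw [h5] at h3
    exact pos_of_mul_pos_right h3 (Nat.cast_nonneg _)
  have hdeg : f.natDegree = r := le_antisymm hle (Polynomial.le_natDegree_of_ne_zero hcoeff.ne')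
  have h0 : f ≠ 0 := fun h => by simp [h] at hcoeff
  obtain ⟨l, hl⟩ := hF.exists_linePoly_eq_prod v k h0 hdeg
  rw [← hf] at hl
  refine ⟨f.leadingCoeff, l, by rwa [Polynomial.leadingCoeff, hdeg], fun i => ?_, hl⟩
  by_contra! h
  have h6 := ha.linePoly_pos hv (single_one_nonneg k) h
  rw [← hf, hl, Polynomial.eval_mul, Polynomial.eval_prod,
    Finset.prod_eq_zero (Finset.mem_univ i) (by simp)] at h6
  simp at h6

theorem exists_linePoly_pderiv_eq (hF : Stable F) (h1 : (pderiv k)^[r + 1] F = 0) {v : Fin n → ℝ}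
    {c : ℝ} {l : Fin r → ℝ} (hc : 0 < c) (hl : linePoly F v (Pi.single k 1) =
      Polynomial.C c * ∏ i, (Polynomial.X - Polynomial.C (l i))) (j : Fin n) :
    ∃ (e : ℝ) (d : Fin r → ℝ), (∀ i, 0 ≤ d i) ∧ linePoly (pderiv j F) v (Pi.single k 1) =
      Polynomial.C e * ∏ i, (Polynomial.X - Polynomial.C (l i)) +
        ∑ i, Polynomial.C (d i) *
          ∏ m ∈ Finset.univ.erase i, (Polynomial.X - Polynomial.C (l m)) := by
  have hN := hF.nevanlinna_linePoly j v (single_one_nonneg k)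
  rw [hl] at hN
  have h2 : (pderiv k)^[r + 1] (pderiv j F) = 0 := by
    rw [pderiv_iterate_eq_multiPderiv, multiPderiv_pderiv, multiPderiv_replicate, h1, map_zero]
  obtain ⟨e, d, hd, he⟩ := Nevanlinna.partial_fractions l Finset.univ _
    (by simpa using natDegree_linePoly_le v h2) (hN.of_C_mul hc)
  exact ⟨e, d, fun i => hd i (Finset.mem_univ i), he⟩

/-- `F` has sign `(-1)^r` wherever the `k`-th coordinate is negative and the others dominate
those of `a`. -/
def SignBelow (F : MvPolynomial (Fin n) ℝ) (a : Fin n → ℝ) (k : Fin n) (r : ℕ) : Prop :=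
  ∀ v : Fin n → ℝ, (∀ i, i ≠ k → a i ≤ v i) → v k < 0 → 0 < (-1) ^ r * MvPolynomial.eval v F

theorem add_single_mul_eq_update (v : Fin n → ℝ) (k : Fin n) (x : ℝ) :
    (fun i => v i + (Pi.single k 1 : Fin n → ℝ) i * x) = Function.update v k (v k + x) := by
  funext i
  by_cases h : i = k
  · subst h; simp
  · simp [h]

theorem SignBelow.of_pderiv (hF : Stable F) (ha : Above F a)
    (h1 : (pderiv k)^[r + 1] F = 0) (h2 : (pderiv k)^[r] F ≠ 0) {j : Fin n}
    (hH : SignBelow (pderiv j F) a k r) : SignBelow F a k r := by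
  intro v hv hvk
  set v0 := Function.update v k (a k) with hv0
  have hv0a : ∀ i, a i ≤ v0 i := by
    intro i
    by_cases h : i = k
    · subst h; simp [hv0]
    · simpa [hv0, h] using hv i h
  have hev : ∀ p : MvPolynomial (Fin n) ℝ, ∀ y, (linePoly p v0 (Pi.single k 1)).eval y =
      MvPolynomial.eval (Function.update v k (a k + y)) p := by
    intro p y
    rw [eval_linePoly_real, add_single_mul_eq_update]
    simp [hv0]
  obtain ⟨c, l, hc, -, hl⟩ := exists_linePoly_eq_prod_neg hF ha h1 h2 hv0a
  obtain ⟨e, d, hd, he⟩ := exists_linePoly_pderiv_eq hF h1 hc hl j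
  have hge : ∀ i, -a k ≤ l i := by
    by_contra! hex
    obtain ⟨i0, hi0⟩ := hex
    obtain ⟨m, -, hm⟩ := Finset.exists_min_image Finset.univ l ⟨i0, Finset.mem_univ i0⟩
    have hlm : l m < -a k := (hm i0 (Finset.mem_univ _)).trans_lt hi0
    have h3 := hH (Function.update v k (a k + l m))
      (fun i hi => by simpa [hi] using hv i hi) (by simp; linarith)
    rw [← hev, he, Polynomial.eval_add, Polynomial.eval_mul, Polynomial.eval_prod,
      Finset.prod_eq_zero (Finset.mem_univ m) (by simp), Polynomial.eval_finsetSum,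
      Finset.sum_eq_single m] at h3
    · have h4 : 0 ≤ (-1) ^ (r - 1) *
          (∏ i ∈ Finset.univ.erase m, (Polynomial.X - Polynomial.C (l i))).eval (l m) := by
        have h5 : (-1 : ℝ) ^ (r - 1) = ∏ _i ∈ Finset.univ.erase m, (-1 : ℝ) := by
          simp
        rw [h5, Polynomial.eval_prod, ← Finset.prod_mul_distrib]
        refine Finset.prod_nonneg fun i _ => ?_
        have := hm i (Finset.mem_univ _)
        simp; linarith
      have h6 : (-1 : ℝ) ^ r = - (-1) ^ (r - 1) := by
        have : r = (r - 1) + 1 := by have := m.pos; omega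
        conv_lhs => rw [this, pow_succ]
        ring
      simp only [h6, Polynomial.eval_mul, Polynomial.eval_C] at h3
      have := mul_nonneg (hd m) h4
      nlinarith
    · intro i _ him
      rw [Polynomial.eval_mul, Polynomial.eval_prod,
        Finset.prod_eq_zero (Finset.mem_erase.mpr ⟨him.symm, Finset.mem_univ m⟩) (by simp),
        mul_zero]
    · simp
  have h7 := hev F (v k - a k)
  rw [hl] at h7
  have h8 : Function.update v k (a k + (v k - a k)) = v := by simp
  rw [h8] at h7
  rw [← h7, Polynomial.eval_mul, Polynomial.eval_C, Polynomial.eval_prod, mul_left_comm]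
  have h9 : (-1 : ℝ) ^ r = ∏ _i : Fin r, (-1 : ℝ) := by simp
  rw [h9, ← Finset.prod_mul_distrib]
  refine mul_pos hc (Finset.prod_pos fun i _ => ?_)
  have := hge i
  simp; linarith

theorem barrier_step (hr : 2 ≤ r) (hF : Stable F) (ha : Above F a)
    (h1 : (pderiv k)^[r + 1] F = 0) (h2 : (pderiv k)^[r] F ≠ 0) (hlow : SignBelow F a k r)
    {φ : ℝ} (hφ : MvPolynomial.eval a (pderiv k F) ≤ φ * MvPolynomial.eval a F) {a' : Fin n → ℝ}
    (ha' : a' = Function.update a k (a k - ((r : ℝ) - 1) ^ 2 / (r * (φ - 1 / a k)))) :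
    Above ((pderiv k)^[r - 1] F) a' ∧ ∀ j,
      MvPolynomial.eval a' (pderiv j ((pderiv k)^[r - 1] F)) * MvPolynomial.eval a F ≤
        MvPolynomial.eval a (pderiv j F) * MvPolynomial.eval a' ((pderiv k)^[r - 1] F) := by
  set δ := ((r : ℝ) - 1) ^ 2 / (r * (φ - 1 / a k)) with hδ
  have hr0 : (0 : ℝ) < r := by exact_mod_cast (by omega : 0 < r)
  have hrδ : r * δ = ((r : ℝ) - 1) ^ 2 / (φ - 1 / a k) := by
    rw [hδ, mul_div_assoc', mul_div_mul_left _ _ hr0.ne']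
  obtain ⟨m, rfl⟩ : ∃ m, r = m + 1 := ⟨r - 1, by omega⟩
  rw [Nat.add_sub_cancel]
  have hcard : Fintype.card (Fin (m + 1)) = m + 1 := Fintype.card_fin _
  have hm0 : (0 : ℝ) < m.factorial := by exact_mod_cast m.factorial_pos
  have hroots : ∀ v : Fin n → ℝ, (∀ i, a i ≤ v i) → v k = a k → ∀ (c : ℝ) (l : Fin (m + 1) → ℝ),
      0 < c → (∀ i, l i < 0) → linePoly F v (Pi.single k 1) =
        Polynomial.C c * ∏ i, (Polynomial.X - Polynomial.C (l i)) →
      ∀ i, (m + 1 : ℕ) * δ ≤ (∑ j, -l j) - -l i := by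
    intro v hv hvk c l hc hneg hl i
    rw [hrδ]
    have hM : ∀ i, -l i ≤ a k := by
      intro i
      by_contra! h
      have h3 := hlow (Function.update v k (v k + l i))
        (fun i hi => by simpa [hi] using hv i) (by simp; linarith)
      rw [← add_single_mul_eq_update, ← eval_linePoly_real, hl, Polynomial.eval_mul,
        Polynomial.eval_prod, Finset.prod_eq_zero (Finset.mem_univ i) (by simp)] at h3
      simp at h3
    have h4 := eval_derivative_C_mul_prod_X_sub_C Finset.univ c l (x := 0)
      (fun i _ => (hneg i).ne')
    rw [← hl, derivative_linePoly_single, eval_linePoly_real, eval_linePoly_real] at h4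
    simp only [mul_zero, add_zero, zero_sub] at h4
    have h5 := hF.pderiv_div_antitone ha hv k
    rw [h4, mul_div_cancel_left₀ _ (ha v hv).ne'] at h5
    have h6 := h5.trans ((div_le_iff₀ (ha a fun _ => le_rfl)).mpr hφ)
    have h7 := sum_sub_single_ge (u := fun i => -l i) (fun i => neg_pos.mpr (hneg i)) hM h6
      (by simpa using hr) i
    simpa using h7
  have hval : ∀ (p : MvPolynomial (Fin n) ℝ) (v : Fin n → ℝ) (x : ℝ),
      MvPolynomial.eval (Function.update v k (v k + x)) ((pderiv k)^[m] p) =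
        (Polynomial.derivative^[m] (linePoly p v (Pi.single k 1))).eval x := by
    intro p v x
    rw [iterate_derivative_linePoly_single, eval_linePoly_real, add_single_mul_eq_update]
  have hFval : ∀ (v : Fin n → ℝ) (c : ℝ) (l : Fin (m + 1) → ℝ), linePoly F v (Pi.single k 1) =
      Polynomial.C c * ∏ i, (Polynomial.X - Polynomial.C (l i)) → ∀ x,
      MvPolynomial.eval (Function.update v k (v k + x)) ((pderiv k)^[m] F) =
        c * (m.factorial * ((m + 1) * x - ∑ i, l i)) := by
    intro v c l hl x
    rw [hval, hl, Polynomial.iterate_derivative_C_mul, Polynomial.eval_mul, Polynomial.eval_C,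
      eval_iterate_derivative_prod hcard]
  constructor
  · intro u hu
    have hv : ∀ i, a i ≤ Function.update u k (a k) i := by
      intro i
      by_cases h : i = k
      · subst h; simp
      · have := hu i; rw [ha'] at this; simpa [h] using this
    obtain ⟨c, l, hc, hneg, hl⟩ := exists_linePoly_eq_prod_neg hF ha h1 h2 hv
    have h3 := hroots _ hv (by simp) c l hc hneg hl 0
    have h4 := hFval _ c l hl (u k - a k)
    have h5 : Function.update (Function.update u k (a k)) k
        (Function.update u k (a k) k + (u k - a k)) = u := by simp
    rw [h5] at h4
    rw [h4]
    have h6 : a k - δ ≤ u k := by have := hu k; rw [ha'] at this; simpa using this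
    have h7 := hneg 0
    rw [Finset.sum_neg_distrib] at h3
    push_cast at h3
    refine mul_pos hc (mul_pos hm0 ?_)
    have h8 : (0 : ℝ) < m + 1 := by positivity
    nlinarith
  · intro j
    obtain ⟨c, l, hc, hneg, hl⟩ := exists_linePoly_eq_prod_neg hF ha h1 h2 (v := a) fun _ => le_rfl
    have h3 := hroots a (fun _ => le_rfl) rfl c l hc hneg hl
    obtain ⟨e, d, hd, he⟩ := exists_linePoly_pderiv_eq hF h1 hc hl j
    have ha'' : a' = Function.update a k (a k + -δ) := by rw [ha', sub_eq_add_neg]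
    have hcomm : pderiv j ((pderiv k)^[m] F) = (pderiv k)^[m] (pderiv j F) := by
      rw [pderiv_iterate_eq_multiPderiv, pderiv_iterate_eq_multiPderiv, multiPderiv_pderiv]
    have hzero : ∀ p : MvPolynomial (Fin n) ℝ, MvPolynomial.eval a p =
        (linePoly p a (Pi.single k 1)).eval 0 := by
      intro p; rw [eval_linePoly_real]; simp
    rw [hcomm, ha'', hFval a c l hl, hval, hzero F, hzero (pderiv j F), he, hl]
    have hP : (∏ i, (Polynomial.X - Polynomial.C (l i))).eval 0 = ∏ i, -l i := by
      rw [Polynomial.eval_prod]; simp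
    have hPe : ∀ i, (∏ m ∈ Finset.univ.erase i, (Polynomial.X - Polynomial.C (l m))).eval 0 * (-l i)
        = ∏ i, -l i := by
      intro i
      rw [Polynomial.eval_prod, mul_comm, ← Finset.mul_prod_erase _ _ (Finset.mem_univ i)]
      simp
    have hPpos : ∀ i, 0 < (∏ m ∈ Finset.univ.erase i,
        (Polynomial.X - Polynomial.C (l m))).eval 0 := by
      intro i
      rw [Polynomial.eval_prod]
      exact Finset.prod_pos fun m _ => by simpa using hneg m
    rw [iterate_map_add, Polynomial.iterate_derivative_C_mul,
      Polynomial.iterate_derivative_sum, Polynomial.eval_add, Polynomial.eval_mul,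
      eval_iterate_derivative_prod hcard, Polynomial.eval_finsetSum]
    simp only [Polynomial.iterate_derivative_C_mul, Polynomial.eval_mul, Polynomial.eval_C,
      eval_iterate_derivative_prod_erase hcard, Polynomial.eval_add, Polynomial.eval_finsetSum, hP]
    rw [add_mul (e * _), add_mul (e * _), Finset.sum_mul, Finset.sum_mul]
    refine add_le_add (le_of_eq (by ring)) (Finset.sum_le_sum fun i _ => ?_)
    have h4 := h3 i
    rw [Finset.sum_neg_distrib] at h4
    push_cast at h4
    rw [← hPe i]
    have h5 := mul_nonneg (mul_nonneg (mul_nonneg (hd i) hm0.le) hc.le) (hPpos i).le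
    have h6 := mul_le_mul_of_nonneg_left (by linarith : -l i ≤ (m + 1) * -δ - ∑ i, l i) h5
    calc _ = _ := by ring
      _ ≤ _ := h6
      _ = _ := by ring

end SignBelow

theorem Nevanlinna.monotoneOn {f h : Polynomial ℝ} (H : Nevanlinna f h) {s : Set ℝ}
    (hs : Convex ℝ s) (hh : ∀ x ∈ s, h.eval x ≠ 0) :
    MonotoneOn (fun x => f.eval x / h.eval x) s := by
  apply monotoneOn_of_deriv_nonneg hs
  · exact f.continuous.continuousOn.div h.continuous.continuousOn hh
  · intro x hx
    exact ((f.hasDerivAt x).div (h.hasDerivAt x)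
      (hh x (interior_subset hx))).differentiableAt.differentiableWithinAt
  · intro x hx
    have hd := (f.hasDerivAt x).div (h.hasDerivAt x) (hh x (interior_subset hx))
    have : deriv (fun x => f.eval x / h.eval x) x = _ := hd.deriv
    rw [this]
    exact div_nonneg (by linarith [H.wronskian_le x]) (sq_nonneg _)

theorem exists_pos_of_sum_pos {ι : Type*} [Fintype ι] {f : ι → Polynomial ℝ} {h : Polynomial ℝ}
    (hN : ∀ j, Nevanlinna (f j) h) {c B : ℝ} (hB : ∀ x, B ≤ x → 0 < h.eval x)
    (hsum : ∀ x, c < x → 0 < ∑ j, (f j).eval x) : ∃ j, ∀ x, c < x → 0 < (f j).eval x := by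
  have hpos : ∀ x, c < x → 0 < h.eval x := by
    by_contra! hex
    obtain ⟨x1, hx1, hx1'⟩ := hex
    have h0 : h ≠ 0 := fun h0 => by have := hB B le_rfl; simp [h0] at this
    obtain ⟨y, hy, hy0⟩ : ∃ y ∈ Set.Icc x1 (max x1 B), h.eval y = 0 :=
      intermediate_value_Icc (le_max_left _ _) h.continuous.continuousOn
        ⟨hx1', (hB _ (le_max_right _ _)).le⟩
    have hmem : ∀ z, z ∈ h.roots.toFinset.filter (c < ·) ↔ h.eval z = 0 ∧ c < z := by
      intro z
      rw [Finset.mem_filter, Multiset.mem_toFinset, Polynomial.mem_roots h0, Polynomial.IsRoot.def]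
    obtain ⟨c0, hc0, hmax⟩ := Finset.exists_max_image (h.roots.toFinset.filter (c < ·)) id
      ⟨y, (hmem y).mpr ⟨hy0, hx1.trans_le hy.1⟩⟩
    rw [hmem] at hc0
    have hgt : ∀ x ∈ Set.Ioi c0, 0 < h.eval x := by
      intro x hx
      by_contra! hle
      obtain ⟨z, hz, hz0⟩ : ∃ z ∈ Set.Icc x (max x B), h.eval z = 0 :=
        intermediate_value_Icc (le_max_left _ _) h.continuous.continuousOn
          ⟨hle, (hB _ (le_max_right _ _)).le⟩
      have hlt : c0 < z := lt_of_lt_of_le hx hz.1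
      exact absurd (hmax z ((hmem z).mpr ⟨hz0, hc0.2.trans hlt⟩)) (not_le.mpr hlt)
    refine absurd (hsum c0 hc0.2) (not_lt.mpr (Finset.sum_nonpos fun j _ => ?_))
    have hmono := (hN j).monotoneOn (convex_Ioi c0) fun x hx => (hgt x hx).ne'
    set K := (f j).eval (c0 + 1) / h.eval (c0 + 1)
    have hle : ∀ᶠ x in nhdsWithin c0 (Set.Ioi c0), (f j).eval x ≤ K * h.eval x := by
      filter_upwards [Ioo_mem_nhdsGT (lt_add_one c0)] with x hx
      exact (div_le_iff₀ (hgt x hx.1)).mp (hmono hx.1 (Set.mem_Ioi.mpr (lt_add_one c0)) hx.2.le)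
    have h1 := le_of_tendsto_of_tendsto
      ((f j).continuous.continuousAt.tendsto.mono_left nhdsWithin_le_nhds)
      ((continuous_const.mul h.continuous).continuousAt.tendsto.mono_left nhdsWithin_le_nhds) hle
    simpa [hc0.1] using h1
  by_contra! hex
  choose x hx hfx using hex
  rcases isEmpty_or_nonempty ι with hι | hι
  · have := hsum (c + 1) (lt_add_one c)
    simp at this
  obtain ⟨m, -, hm⟩ := Finset.exists_min_image Finset.univ x Finset.univ_nonempty
  refine absurd (hsum (x m) (hx m)) (not_lt.mpr (Finset.sum_nonpos fun j _ => ?_))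
  have h1 := (hN j).monotoneOn (convex_Ioi c) (fun y hy => (hpos y hy).ne') (hx m) (hx j)
    (hm j (Finset.mem_univ j))
  have h2 := h1.trans (div_nonpos_of_nonpos_of_nonneg (hfx j) (hpos _ (hx j)).le)
  by_contra! h3
  exact absurd (div_pos h3 (hpos _ (hx m))) (not_lt.mpr h2)

section Products

variable {n : ℕ} {k : Fin n}

theorem pderiv_prod_eq_zero {ι : Type*} (s : Finset ι) {H : ι → MvPolynomial (Fin n) ℝ}
    (hH : ∀ l ∈ s, pderiv k (H l) = 0) : pderiv k (∏ l ∈ s, H l) = 0 := by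
  classical
  induction s using Finset.induction_on with
  | empty => simp
  | insert i s hi ih =>
    rw [Finset.prod_insert hi, pderiv_mul, hH i (Finset.mem_insert_self i s),
      ih fun l hl => hH l (Finset.mem_insert_of_mem hl)]
    simp

theorem pderiv_iterate_mul {G : MvPolynomial (Fin n) ℝ} (hG : pderiv k (pderiv k G) = 0)
    (P : MvPolynomial (Fin n) ℝ) (m : ℕ) :
    (pderiv k)^[m + 1] (G * P) = G * (pderiv k)^[m + 1] P +
      (m + 1 : ℕ) * (pderiv k G * (pderiv k)^[m] P) := by
  induction m with
  | zero => simp [mul_comm]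
  | succ m ih =>
    rw [Function.iterate_succ_apply', ih, map_add, pderiv_mul, pderiv_mul, pderiv_mul, hG,
      ← Function.iterate_succ_apply' (pderiv k) m P,
      ← Function.iterate_succ_apply' (pderiv k) (m + 1) P]
    have : pderiv k ((m + 1 : ℕ) : MvPolynomial (Fin n) ℝ) = 0 := by
      rw [← map_natCast (MvPolynomial.C (σ := Fin n) (R := ℝ)), pderiv_C]
    rw [this]
    push_cast
    ring

theorem pderiv_iterate_prod {ι : Type*} [DecidableEq ι] {G : ι → MvPolynomial (Fin n) ℝ}
    (hG : ∀ l, pderiv k (pderiv k (G l)) = 0) (s : Finset ι) :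
    (pderiv k)^[s.card] (∏ l ∈ s, G l) = s.card.factorial * ∏ l ∈ s, pderiv k (G l) ∧
    ∀ m, s.card = m + 1 → (pderiv k)^[m] (∏ l ∈ s, G l) =
      m.factorial * ∑ j ∈ s, G j * ∏ l ∈ s.erase j, pderiv k (G l) := by
  induction s using Finset.induction_on with
  | empty => simp
  | insert i s hi ih =>
    obtain ⟨ih1, ih2⟩ := ih
    have hzero : (pderiv k)^[s.card + 1] (∏ l ∈ s, G l) = 0 := by
      rw [Function.iterate_succ_apply', ih1, pderiv_mul, pderiv_prod_eq_zero s fun l _ => hG l,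
        ← map_natCast (MvPolynomial.C (σ := Fin n) (R := ℝ)), pderiv_C]
      simp
    constructor
    · rw [Finset.card_insert_of_notMem hi, Finset.prod_insert hi, Finset.prod_insert hi,
        pderiv_iterate_mul (hG i), hzero, ih1, Nat.factorial_succ]
      push_cast
      ring
    · intro m hm
      rw [Finset.card_insert_of_notMem hi] at hm
      obtain rfl : s.card = m := by omega
      have hsum : ∑ j ∈ s, G j * ∏ l ∈ (insert i s).erase j, pderiv k (G l) =
          pderiv k (G i) * ∑ j ∈ s, G j * ∏ l ∈ s.erase j, pderiv k (G l) := by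
        rw [Finset.mul_sum]
        refine Finset.sum_congr rfl fun j hj => ?_
        have hji : j ≠ i := fun h => hi (h ▸ hj)
        rw [Finset.erase_insert_of_ne hji.symm,
          Finset.prod_insert fun h => hi (Finset.mem_of_mem_erase h)]
        ring
      rw [Finset.prod_insert hi, Finset.sum_insert hi, Finset.erase_insert hi, hsum]
      rcases hc : s.card with _ | t
      · rw [Finset.card_eq_zero] at hc
        simp [hc]
      · rw [pderiv_iterate_mul (hG i), ih2 t hc, ← hc, ih1, hc, Nat.factorial_succ]
        push_cast
        ring

theorem multiPderiv_nsmul_prod {r : ℕ} {G : Fin r → MvPolynomial (Fin n) ℝ}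
    (hG : ∀ k l, pderiv k (pderiv k (G l)) = 0) (R : Finset (Fin n)) :
    multiPderiv (r • R.val) (∏ l, G l) =
      MvPolynomial.C ((r.factorial : ℝ) ^ R.card) * ∏ l, multiPderiv R.val (G l) := by
  induction R using Finset.induction_on with
  | empty => simp
  | insert k R hk ih =>
    have hG' : ∀ l, pderiv k (pderiv k (multiPderiv R.val (G l))) = 0 := fun l => by
      rw [← multiPderiv_pderiv, ← multiPderiv_pderiv, hG, multiPderiv_map_zero]
    have h := (pderiv_iterate_prod hG' Finset.univ).1
    rw [Finset.card_univ, Fintype.card_fin] at h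
    rw [Finset.insert_val_of_notMem hk, ← Multiset.singleton_add, nsmul_add,
      Multiset.nsmul_singleton, multiPderiv_add, ih, multiPderiv_C_mul, multiPderiv_replicate, h,
      Finset.card_insert_of_notMem hk, Multiset.singleton_add]
    simp only [multiPderiv_cons, pow_succ, map_mul, map_natCast]
    ring

theorem multiPderiv_nsmul_prod_ne_zero {r : ℕ} {G : Fin r → MvPolynomial (Fin n) ℝ}
    (hG : ∀ k l, pderiv k (pderiv k (G l)) = 0) {R : Finset (Fin n)}
    (h0 : ∀ l, multiPderiv R.val (G l) ≠ 0) {M : Multiset (Fin n)} (hM : M ≤ r • R.val) :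
    multiPderiv M (∏ l, G l) ≠ 0 := by
  refine multiPderiv_ne_zero_of_le hM ?_
  rw [multiPderiv_nsmul_prod hG]
  refine mul_ne_zero ?_ (Finset.prod_ne_zero_iff.mpr fun l _ => h0 l)
  rw [Ne, MvPolynomial.C_eq_zero]
  exact pow_ne_zero _ (by exact_mod_cast r.factorial_ne_zero)

theorem exists_assignment {r : ℕ} {c B : ℝ} (hr : 1 ≤ r) (R : Finset (Fin n)) :
    ∀ G : Fin r → MvPolynomial (Fin n) ℝ, (∀ l, Stable (G l)) →
    (∀ l, Above (G l) fun _ => B) → (∀ k l, pderiv k (pderiv k (G l)) = 0) →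
    (∀ l, multiPderiv R.val (G l) ≠ 0) →
    (∀ x, c < x → 0 < MvPolynomial.eval (fun _ => x) (multiPderiv ((r - 1) • R.val) (∏ l, G l))) →
    ∃ σ : Fin n → Fin r, ∀ x, c < x →
      0 < MvPolynomial.eval (fun _ => x)
        (∏ l, multiPderiv (R.filter fun k => σ k ≠ l).val (G l)) := by
  induction R using Finset.induction_on with
  | empty =>
    intro G _ _ _ _ hpos
    exact ⟨fun _ => ⟨0, hr⟩, by simpa using hpos⟩
  | insert k R hk ih =>
    intro G hS hA h2 h0 hpos
    obtain ⟨m, rfl⟩ : ∃ m, r = m + 1 := ⟨r - 1, by omega⟩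
    rw [Nat.add_sub_cancel] at hpos ih
    rw [Finset.insert_val_of_notMem hk] at h0 hpos
    simp only [multiPderiv_cons, ← multiPderiv_pderiv] at h0
    have hne : ∀ l, multiPderiv R.val (G l) ≠ 0 := fun l h => h0 l (by
      rw [multiPderiv_pderiv, h, map_zero])
    have hd0 : ∀ l, pderiv k (G l) ≠ 0 := fun l h => h0 l (by rw [h, multiPderiv_map_zero])
    let G' : Fin (m + 1) → Fin (m + 1) → MvPolynomial (Fin n) ℝ := fun j =>
      Function.update (fun l => pderiv k (G l)) j (G j)
    have hG' : ∀ (Q : MvPolynomial (Fin n) ℝ → Prop) (j), (∀ l, Q (G l)) →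
        (∀ l, Q (pderiv k (G l))) → ∀ l, Q (G' j l) := by
      intro Q j hQ1 hQ2 l
      by_cases h : l = j
      · subst h; simpa [G'] using hQ1 l
      · simpa [G', h] using hQ2 l
    have hSd : ∀ l, Stable (pderiv k (G l)) := fun l => stable_pderiv (hS l) (hd0 l)
    have hAd : ∀ l, Above (pderiv k (G l)) fun _ => B := fun l => (hA l).pderiv (hS l) (hd0 l)
    have h2d : ∀ i l, pderiv i (pderiv i (pderiv k (G l))) = 0 := fun i l => by
      rw [pderiv_comm i k, pderiv_comm i k, h2, map_zero]
    have h2' : ∀ j i l, pderiv i (pderiv i (G' j l)) = 0 := fun j i =>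
      hG' (fun q => pderiv i (pderiv i q) = 0) j (h2 i) (h2d i)
    have hne' : ∀ j l, multiPderiv R.val (G' j l) ≠ 0 := fun j =>
      hG' (fun q => multiPderiv R.val q ≠ 0) j hne h0
    have hle : m • R.val ≤ (m + 1) • R.val := nsmul_le_nsmul_left zero_le (Nat.le_succ m)
    have hprod : ∀ j, ∏ l, G' j l = G j * ∏ l ∈ Finset.univ.erase j, pderiv k (G l) := by
      intro j
      rw [← Finset.mul_prod_erase _ _ (Finset.mem_univ j)]
      congr 1
      · simp [G']
      · exact Finset.prod_congr rfl fun l hl => by simp [G', Finset.ne_of_mem_erase hl]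
    have hder : ∀ j, pderiv k (∏ l, G' j l) = ∏ l, pderiv k (G l) := by
      intro j
      rw [hprod, pderiv_mul, pderiv_prod_eq_zero _ fun l _ => h2 k l, mul_zero, add_zero,
        Finset.mul_prod_erase _ (fun l => pderiv k (G l)) (Finset.mem_univ j)]
    have hstable : ∀ j, Stable (multiPderiv (m • R.val) (∏ l, G' j l)) := fun j =>
      (Stable.prod _ _ fun l _ => hG' _ j hS hSd l).multiPderiv
        (multiPderiv_nsmul_prod_ne_zero (h2' j) (hne' j) hle)
    have habove : Above (multiPderiv (m • R.val) (∏ l, pderiv k (G l))) fun _ => B :=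
      (Above.prod fun l _ => hAd l).multiPderiv (Stable.prod _ _ fun l _ => hSd l)
        (multiPderiv_nsmul_prod_ne_zero h2d h0 hle)
    have hline : ∀ (p : MvPolynomial (Fin n) ℝ) (x : ℝ),
        (linePoly p 0 fun _ => 1).eval x = MvPolynomial.eval (fun _ => x) p := by
      intro p x; rw [eval_linePoly_real]; simp
    obtain ⟨j, hj⟩ := exists_pos_of_sum_pos
      (f := fun j => linePoly (multiPderiv (m • R.val) (∏ l, G' j l)) 0 fun _ => 1)
      (h := linePoly (multiPderiv (m • R.val) (∏ l, pderiv k (G l))) 0 fun _ => 1) (c := c) (B := B)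
      (fun j => by
        rw [← hder j, multiPderiv_pderiv]
        exact (hstable j).nevanlinna_linePoly k 0 fun _ => zero_le_one)
      (fun x hx => by rw [hline]; exact habove _ fun _ => hx)
      (fun x hx => by
        have h3 := hpos x hx
        have h4 := (pderiv_iterate_prod (h2 k) Finset.univ).2 m (by simp)
        rw [← Multiset.singleton_add, nsmul_add, Multiset.nsmul_singleton, add_comm,
          multiPderiv_add, multiPderiv_replicate, h4,
          ← map_natCast (MvPolynomial.C (σ := Fin n) (R := ℝ)), multiPderiv_C_mul, map_mul,
          multiPderiv_sum, map_sum] at h3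
        simp only [hline, hprod]
        exact pos_of_mul_pos_right h3 (by simp))
    simp only [hline] at hj
    obtain ⟨σ, hσ⟩ := ih (G' j) (hG' Stable j hS hSd)
      (hG' (fun q => Above q fun _ => B) j hA hAd) (h2' j) (hne' j) hj
    refine ⟨Function.update σ k j, fun x hx => ?_⟩
    have h5 := hσ x hx
    convert h5 using 3 with l
    have hfilter : R.filter (fun i => Function.update σ k j i ≠ l) = R.filter fun i => σ i ≠ l :=
      Finset.filter_congr fun i hi => by
        rw [Function.update_of_ne (ne_of_mem_of_not_mem hi hk)]
    by_cases hl : l = j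
    · subst hl
      rw [Finset.filter_insert, if_neg (by simp), hfilter]
      simp [G']
    · rw [Finset.filter_insert, if_pos (by simpa using Ne.symm hl), hfilter,
        Finset.insert_val_of_notMem (by simp [hk]), multiPderiv_cons, ← multiPderiv_pderiv]
      simp [G', hl]

end Products

section Barrier

variable {n : ℕ} {k : Fin n} {r : ℕ}

theorem SignBelow.of_multiPderiv {P : MvPolynomial (Fin n) ℝ} {a : Fin n → ℝ} (hP : Stable P)
    (h1 : (pderiv k)^[r + 1] P = 0) (K N : Multiset (Fin n))
    (h2 : multiPderiv (Multiset.replicate r k + (K + N)) P ≠ 0) (ha : Above (multiPderiv N P) a)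
    (hK : SignBelow (multiPderiv (K + N) P) a k r) : SignBelow (multiPderiv N P) a k r := by
  induction K using Multiset.induction_on with
  | empty => simpa using hK
  | cons j K ih =>
    have hle : Multiset.replicate r k + (K + N) ≤ Multiset.replicate r k + (j ::ₘ K + N) :=
      add_le_add_right (add_le_add_left (Multiset.le_cons_self K j) N) _
    have h2' := multiPderiv_ne_zero_of_le hle h2
    refine ih h2' ?_
    have h0 : multiPderiv (K + N) P ≠ 0 :=
      multiPderiv_ne_zero_of_le (Multiset.le_add_left _ _) h2'
    have hNP : multiPderiv N P ≠ 0 := multiPderiv_ne_zero_of_le (Multiset.le_add_left _ _) h0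
    rw [Multiset.cons_add, multiPderiv_cons] at hK
    refine hK.of_pderiv (hP.multiPderiv h0) ?_ ?_ ?_
    · rw [multiPderiv_add] at h0 ⊢
      exact ha.multiPderiv (hP.multiPderiv hNP) h0
    · rw [pderiv_iterate_eq_multiPderiv, ← multiPderiv_add, add_comm, multiPderiv_add,
        multiPderiv_replicate, h1, multiPderiv_map_zero]
    · rw [pderiv_iterate_eq_multiPderiv, ← multiPderiv_add]
      exact h2'

theorem barrier (hr : 2 ≤ r) {g : MvPolynomial (Fin n) ℝ} (hS : Stable g)
    (h2 : ∀ k, pderiv k (pderiv k g) = 0) (htop : multiPderiv Finset.univ.val g ≠ 0) {b φ : ℝ}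
    (hA : Above g fun _ => b)
    (hneg : ∀ (k : Fin n) (v : Fin n → ℝ), v k < 0 →
      MvPolynomial.eval v (multiPderiv (Finset.univ.erase k).val g) < 0)
    (hφ : ∀ k, r * MvPolynomial.eval (fun _ => b) (pderiv k g) ≤
      φ * MvPolynomial.eval (fun _ => b) g) (T : Finset (Fin n)) :
    Above (multiPderiv ((r - 1) • T.val) (∏ _l : Fin r, g))
      (fun i => if i ∈ T then b - ((r : ℝ) - 1) ^ 2 / (r * (φ - 1 / b)) else b) ∧
    ∀ k, k ∉ T →
      MvPolynomial.eval (fun i => if i ∈ T then b - ((r : ℝ) - 1) ^ 2 / (r * (φ - 1 / b)) else b)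
        (pderiv k (multiPderiv ((r - 1) • T.val) (∏ _l : Fin r, g))) ≤
      φ * MvPolynomial.eval
        (fun i => if i ∈ T then b - ((r : ℝ) - 1) ^ 2 / (r * (φ - 1 / b)) else b)
        (multiPderiv ((r - 1) • T.val) (∏ _l : Fin r, g)) := by
  set P : MvPolynomial (Fin n) ℝ := ∏ _l : Fin r, g with hP
  set δ := ((r : ℝ) - 1) ^ 2 / (r * (φ - 1 / b)) with hδ
  have hSP : Stable P := Stable.prod _ _ fun _ _ => hS
  have hPr : ∀ k, (pderiv k)^[r + 1] P = 0 := by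
    intro k
    have h := (pderiv_iterate_prod (G := fun _ : Fin r => g) (fun _ => h2 k) Finset.univ).1
    rw [Finset.card_univ, Fintype.card_fin] at h
    rw [Function.iterate_succ_apply', h, pderiv_mul, pderiv_prod_eq_zero _ fun _ _ => h2 k,
      ← map_natCast (MvPolynomial.C (σ := Fin n) (R := ℝ)), pderiv_C]
    simp
  have hne : ∀ M : Multiset (Fin n), M ≤ r • Finset.univ.val → multiPderiv M P ≠ 0 :=
    fun M hM => multiPderiv_nsmul_prod_ne_zero (fun k _ => h2 k) (fun _ => htop) hM
  induction T using Finset.induction_on with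
  | empty =>
    constructor
    · simpa [hP] using Above.prod (s := Finset.univ) (p := fun _ : Fin r => g) fun _ _ => hA
    · intro k _
      have hb := hA _ fun _ => le_rfl
      have hb' : 0 ≤ MvPolynomial.eval (fun _ => b) g ^ (r - 1) := (pow_pos hb _).le
      have h3 := mul_le_mul_of_nonneg_left (hφ k) hb'
      have h4 : MvPolynomial.eval (fun _ => b) g ^ r =
          MvPolynomial.eval (fun _ => b) g ^ (r - 1) * MvPolynomial.eval (fun _ => b) g := by
        rw [← pow_succ]; congr 1; omega
      simp only [Finset.empty_val, nsmul_zero, multiPderiv_zero, Finset.notMem_empty, if_false, hP,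
        Finset.prod_const, Finset.card_univ, Fintype.card_fin, pderiv_pow, map_mul, map_pow,
        map_natCast]
      rw [h4]
      calc _ = _ := by ring
        _ ≤ _ := h3
        _ = _ := by ring
  | insert k T hk ih =>
    obtain ⟨ihA, ihφ⟩ := ih
    set a : Fin n → ℝ := fun i => if i ∈ T then b - δ else b with ha
    have hak : a k = b := by simp [ha, hk]
    have ha' : (fun i => if i ∈ insert k T then b - δ else b) =
        Function.update a k (a k - ((r : ℝ) - 1) ^ 2 / (r * (φ - 1 / a k))) := by
      rw [hak]
      funext i
      by_cases h : i = k
      · subst h; simp [hδ]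
      · simp [h, ha]
    have hTle : (r - 1) • T.val ≤ r • (Finset.univ.erase k).val :=
      (nsmul_le_nsmul_left zero_le (Nat.sub_le r 1)).trans
        (nsmul_le_nsmul_right (Finset.val_le_iff.mpr fun i hi =>
          Finset.mem_erase.mpr ⟨ne_of_mem_of_not_mem hi hk, Finset.mem_univ i⟩) r)
    have hsplit : Multiset.replicate r k + r • (Finset.univ.erase k).val =
        r • (Finset.univ : Finset (Fin n)).val := by
      rw [← Multiset.nsmul_singleton, ← nsmul_add, Multiset.singleton_add,
        ← Finset.insert_val_of_notMem (Finset.notMem_erase k _),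
        Finset.insert_erase (Finset.mem_univ k)]
    have hlow : SignBelow (multiPderiv ((r - 1) • T.val) P) a k r := by
      obtain ⟨K, hK⟩ := Multiset.le_iff_exists_add.mp hTle
      rw [add_comm] at hK
      refine SignBelow.of_multiPderiv hSP (hPr k) K _ ?_ ihA ?_
      · rw [← hK, hsplit]; exact hne _ le_rfl
      · rw [← hK, multiPderiv_nsmul_prod fun k _ => h2 k]
        intro v _ hvk
        have h3 := neg_pos.mpr (hneg k v hvk)
        rw [map_mul, MvPolynomial.eval_C, map_prod, Finset.prod_const, Finset.card_univ,
          Fintype.card_fin, mul_left_comm, ← mul_pow, neg_one_mul]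
        exact mul_pos (pow_pos (by exact_mod_cast r.factorial_pos) _) (pow_pos h3 _)
    have h4 : (pderiv k)^[r] (multiPderiv ((r - 1) • T.val) P) ≠ 0 := by
      rw [pderiv_iterate_eq_multiPderiv, ← multiPderiv_add]
      exact hne _ (hsplit ▸ add_le_add_right hTle _)
    have h5 : (pderiv k)^[r + 1] (multiPderiv ((r - 1) • T.val) P) = 0 := by
      rw [pderiv_iterate_eq_multiPderiv, ← multiPderiv_add, add_comm, multiPderiv_add,
        multiPderiv_replicate, hPr, multiPderiv_map_zero]
    have h0 : multiPderiv ((r - 1) • T.val) P ≠ 0 := fun h => h4 (by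
      rw [h, pderiv_iterate_eq_multiPderiv, multiPderiv_map_zero])
    obtain ⟨hA', hφ'⟩ := barrier_step hr (hSP.multiPderiv h0) ihA h5 h4 hlow (ihφ k hk) ha'
    have h6 : multiPderiv ((r - 1) • (insert k T).val) P =
        (pderiv k)^[r - 1] (multiPderiv ((r - 1) • T.val) P) := by
      rw [Finset.insert_val_of_notMem hk, ← Multiset.singleton_add, nsmul_add,
        Multiset.nsmul_singleton, multiPderiv_add, multiPderiv_replicate]
    rw [h6]
    refine ⟨hA', fun j hj => ?_⟩
    have h7 := ihφ j fun h => hj (Finset.mem_insert_of_mem h)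
    have h8 := hφ' j
    have h9 := ihA a fun _ => le_rfl
    have h10 := hA' _ fun _ => le_rfl
    refine le_of_mul_le_mul_right (h8.trans ?_) h9
    calc _ ≤ _ := mul_le_mul_of_nonneg_right h7 h10.le
      _ = _ := by ring

end Barrier

section MultiAffine

variable {n : ℕ}

theorem MultiAffine.pderiv_pderiv {g : MvPolynomial (Fin n) ℝ} (hg : MultiAffine g) (k : Fin n) :
    pderiv k (pderiv k g) = 0 := by
  ext m
  rw [coeff_pderiv, coeff_pderiv, MvPolynomial.coeff_zero]
  have : MvPolynomial.coeff (m + Finsupp.single k 1 + Finsupp.single k 1) g = 0 := by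
    by_contra h
    have h1 := (MvPolynomial.degreeOf_le_iff.mp (hg k)) _ (MvPolynomial.mem_support_iff.mpr h)
    simp at h1
  rw [this]
  simp

theorem eq_C_of_pderiv_eq_zero {p : MvPolynomial (Fin n) ℝ} (h : ∀ k, pderiv k p = 0) :
    p = MvPolynomial.C (MvPolynomial.coeff 0 p) := by
  ext m
  rw [MvPolynomial.coeff_C]
  split_ifs with hm
  · rw [← hm]
  · obtain ⟨k, hk⟩ : ∃ k, m k ≠ 0 := by
      by_contra! hall
      exact hm (Finsupp.ext fun k => (hall k).symm)
    have h1 := coeff_pderiv (i := k) p (m - Finsupp.single k 1)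
    rw [h k, MvPolynomial.coeff_zero, tsub_add_cancel_of_le
      (Finsupp.single_le_iff.mpr (Nat.one_le_iff_ne_zero.mpr hk)), eq_comm, mul_eq_zero] at h1
    exact h1.resolve_right (by positivity)

theorem coeff_multiPderiv (B : Finset (Fin n)) (p : MvPolynomial (Fin n) ℝ) :
    ∀ m : Fin n →₀ ℕ, (∀ i ∈ B, m i = 0) →
      MvPolynomial.coeff m (multiPderiv B.val p) = MvPolynomial.coeff (m + expOf B) p := by
  induction B using Finset.induction_on with
  | empty => intro m _; simp [expOf]
  | insert k B hk ih =>
    intro m hm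
    rw [Finset.insert_val_of_notMem hk, multiPderiv_cons, coeff_pderiv, ih, expOf, expOf,
      Finset.sum_insert hk, hm k (Finset.mem_insert_self k B), add_assoc]
    · simp
    · intro i hi
      simp [hm i (Finset.mem_insert_of_mem hi), ne_of_mem_of_not_mem hi hk]

theorem pderiv_multiPderiv_of_mem {g : MvPolynomial (Fin n) ℝ}
    (hg : ∀ k, pderiv k (pderiv k g) = 0) {M : Multiset (Fin n)} {k : Fin n} (hk : k ∈ M) :
    pderiv k (multiPderiv M g) = 0 := by
  obtain ⟨N, rfl⟩ := Multiset.exists_cons_of_mem hk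
  rw [multiPderiv_cons, ← multiPderiv_pderiv, ← multiPderiv_pderiv, hg, multiPderiv_map_zero]

theorem multiPderiv_univ {g : MvPolynomial (Fin n) ℝ} (hg : ∀ k, pderiv k (pderiv k g) = 0) :
    multiPderiv Finset.univ.val g =
      MvPolynomial.C (MvPolynomial.coeff (expOf (Finset.univ : Finset (Fin n))) g) := by
  rw [eq_C_of_pderiv_eq_zero (p := multiPderiv Finset.univ.val g)
    fun k => pderiv_multiPderiv_of_mem hg (Finset.mem_univ k), coeff_multiPderiv _ _ _ (by simp),
    zero_add]

theorem multiPderiv_erase {g : MvPolynomial (Fin n) ℝ} (hg : ∀ k, pderiv k (pderiv k g) = 0)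
    (h1 : MvPolynomial.coeff (expOf (Finset.univ : Finset (Fin n))) g = 1) (k : Fin n) :
    multiPderiv (Finset.univ.erase k).val g =
      MvPolynomial.X k + MvPolynomial.C (MvPolynomial.coeff (expOf ({k} : Finset (Fin n))ᶜ) g) := by
  have htop := multiPderiv_univ hg
  rw [h1, ← Finset.insert_erase (Finset.mem_univ k),
    Finset.insert_val_of_notMem (Finset.notMem_erase k _), multiPderiv_cons] at htop
  have h2 := eq_C_of_pderiv_eq_zero
    (p := multiPderiv (Finset.univ.erase k).val g - MvPolynomial.X k) fun j => by
      by_cases hj : j = k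
      · subst hj; rw [map_sub, htop]; simp
      · rw [map_sub, pderiv_multiPderiv_of_mem hg
          (Finset.mem_erase.mpr ⟨hj, Finset.mem_univ j⟩), pderiv_X_of_ne (Ne.symm hj), sub_zero]
  rw [MvPolynomial.coeff_sub, coeff_multiPderiv _ _ _ (by simp), zero_add, MvPolynomial.coeff_zero_X,
    sub_zero, sub_eq_iff_eq_add'] at h2
  rw [h2, Finset.compl_singleton]

end MultiAffine

section Diagonal

variable {n : ℕ}

theorem linePoly_zero_one (p : MvPolynomial (Fin n) ℝ) : linePoly p 0 (fun _ => 1) = diagPoly p := by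
  simp [linePoly, diagPoly]

theorem eval_diagPoly (p : MvPolynomial (Fin n) ℝ) (x : ℝ) :
    (diagPoly p).eval x = MvPolynomial.eval (fun _ => x) p := by
  rw [← linePoly_zero_one, eval_linePoly_real]; simp

theorem Stable.nevanlinna_diagPoly {p : MvPolynomial (Fin n) ℝ} (hp : Stable p) (k : Fin n) :
    Nevanlinna (diagPoly p) (diagPoly (pderiv k p)) := by
  rw [← linePoly_zero_one, ← linePoly_zero_one]
  exact hp.nevanlinna_linePoly k 0 fun _ => zero_le_one

theorem Stable.aeval_diagPoly_ne_zero {p : MvPolynomial (Fin n) ℝ} (hp : Stable p) (z : ℂ)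
    (hz : 0 < z.im) : Polynomial.aeval z (diagPoly p) ≠ 0 := by
  rw [← linePoly_zero_one, aeval_linePoly]
  exact hp _ fun i => by simpa using hz

theorem diagPoly_X_mul (k : Fin n) (p : MvPolynomial (Fin n) ℝ) :
    diagPoly (MvPolynomial.X k * p) = Polynomial.X * diagPoly p := by
  simp [diagPoly]

theorem pderiv_X_mul_pderiv {p : MvPolynomial (Fin n) ℝ} (k j : Fin n)
    (hk : pderiv k (pderiv k p) = 0) :
    pderiv j (p - MvPolynomial.X k * pderiv k p) =
      if j = k then 0 else pderiv j p - MvPolynomial.X k * pderiv k (pderiv j p) := by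
  split_ifs with h
  · subst h
    rw [map_sub, pderiv_mul, hk]
    simp
  · rw [map_sub, pderiv_mul, pderiv_X_of_ne (Ne.symm h), zero_mul, zero_add, pderiv_comm j k]

theorem pderiv_pderiv_X_mul_pderiv {p : MvPolynomial (Fin n) ℝ}
    (hp : ∀ j, pderiv j (pderiv j p) = 0) (k j : Fin n) :
    pderiv j (pderiv j (p - MvPolynomial.X k * pderiv k p)) = 0 := by
  rw [pderiv_X_mul_pderiv k j (hp k)]
  split_ifs with h
  · exact map_zero _
  · rw [map_sub, pderiv_mul, pderiv_X_of_ne (Ne.symm h), pderiv_comm j k, hp j]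
    simp

theorem diagPoly_natDegree_le_and_coeff (T : Finset (Fin n)) :
    ∀ p : MvPolynomial (Fin n) ℝ, (∀ j, pderiv j (pderiv j p) = 0) →
    (∀ j, j ∉ T → pderiv j p = 0) → (diagPoly p).natDegree ≤ T.card ∧
      (diagPoly p).coeff T.card = MvPolynomial.coeff 0 (multiPderiv T.val p) := by
  induction T using Finset.induction_on with
  | empty =>
    intro p _ h
    have h1 := eq_C_of_pderiv_eq_zero fun j => h j (Finset.notMem_empty j)
    have h2 : diagPoly p = Polynomial.C (MvPolynomial.coeff 0 p) := by
      conv_lhs => rw [h1]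
      simp [diagPoly]
    rw [h2]
    simp
  | insert k T hk ih =>
    intro p h2 hT
    have h3 : ∀ j, j ∉ T → j ≠ k → pderiv j p = 0 := fun j hj hjk => hT j (by simp [hj, hjk])
    obtain ⟨hs1, hs2⟩ := ih (pderiv k p)
      (fun j => by rw [pderiv_comm j k, pderiv_comm j k, h2, map_zero]) fun j hj => by
        by_cases hjk : j = k
        · rw [hjk, h2]
        · rw [pderiv_comm, h3 j hj hjk, map_zero]
    obtain ⟨hq, -⟩ := ih (p - MvPolynomial.X k * pderiv k p)
      (pderiv_pderiv_X_mul_pderiv h2 k) fun j hj => by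
        rw [pderiv_X_mul_pderiv k j (h2 k)]
        split_ifs with hjk
        · rfl
        · rw [h3 j hj hjk]; simp
    have hdec : diagPoly p = diagPoly (p - MvPolynomial.X k * pderiv k p) +
        Polynomial.X * diagPoly (pderiv k p) := by
      rw [← diagPoly_X_mul, diagPoly, diagPoly, diagPoly, ← map_add, sub_add_cancel]
    rw [Finset.card_insert_of_notMem hk, Finset.insert_val_of_notMem hk, multiPderiv_cons,
      ← multiPderiv_pderiv, hdec]
    constructor
    · refine (Polynomial.natDegree_add_le _ _).trans (max_le (hq.trans (Nat.le_succ _)) ?_)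
      refine Polynomial.natDegree_mul_le.trans ?_
      rw [Polynomial.natDegree_X]
      omega
    · rw [Polynomial.coeff_add, Polynomial.coeff_X_mul, hs2,
        Polynomial.coeff_eq_zero_of_natDegree_lt (by omega), zero_add]

variable {g : MvPolynomial (Fin n) ℝ}

theorem diagPoly_multiPderiv_monic (h2 : ∀ k, pderiv k (pderiv k g) = 0)
    (h1 : multiPderiv Finset.univ.val g = 1) (B : Finset (Fin n)) :
    (diagPoly (multiPderiv B.val g)).Monic ∧
      (diagPoly (multiPderiv B.val g)).natDegree = Bᶜ.card := by
  obtain ⟨hle, hco⟩ := diagPoly_natDegree_le_and_coeff Bᶜ (multiPderiv B.val g)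
    (fun j => by rw [← multiPderiv_pderiv, ← multiPderiv_pderiv, h2, multiPderiv_map_zero])
    (fun j hj => pderiv_multiPderiv_of_mem h2 (by simpa using hj))
  have hadd : Bᶜ.val + B.val = (Finset.univ : Finset (Fin n)).val := by
    rw [← Finset.disjUnion_val _ _ (disjoint_compl_left), Finset.disjUnion_eq_union,
      Finset.union_comm, Finset.union_compl]
  rw [← multiPderiv_add, hadd, h1, MvPolynomial.coeff_zero_one] at hco
  have hdeg := le_antisymm hle (Polynomial.le_natDegree_of_ne_zero (by rw [hco]; exact one_ne_zero))
  exact ⟨by rw [Polynomial.Monic, Polynomial.leadingCoeff, hdeg, hco], hdeg⟩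

theorem Polynomial.Monic.exists_forall_eval_pos {f : Polynomial ℝ} (hf : f.Monic) :
    ∃ B, ∀ x, B ≤ x → 0 < f.eval x := by
  rcases eq_or_ne f.natDegree 0 with h | h
  · rw [Polynomial.eq_one_of_monic_natDegree_zero hf h]
    simp
  · have := f.tendsto_atTop_of_leadingCoeff_nonneg
      (Polynomial.natDegree_pos_iff_degree_pos.mp (Nat.pos_of_ne_zero h)) (by rw [hf]; simp)
    exact Filter.eventually_atTop.mp (this.eventually_gt_atTop 0)

theorem eval_multiPderiv_pos (hS : Stable g) (h2 : ∀ k, pderiv k (pderiv k g) = 0)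
    (h1 : multiPderiv Finset.univ.val g = 1)
    (hroots : ∀ x : ℝ, (diagPoly g).IsRoot x → x ≤ 1) (B : Finset (Fin n)) {x : ℝ} (hx : 1 < x) :
    0 < MvPolynomial.eval (fun _ => x) (multiPderiv B.val g) := by
  rw [← eval_diagPoly]
  induction B using Finset.induction_on generalizing x with
  | empty =>
    obtain ⟨M, hM⟩ := (diagPoly_multiPderiv_monic h2 h1 ∅).1.exists_forall_eval_pos
    simp only [Finset.empty_val, multiPderiv_zero] at hM ⊢
    by_contra! hle
    obtain ⟨y, hy, hy0⟩ : ∃ y ∈ Set.Icc x (max x M), (diagPoly g).eval y = 0 :=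
      intermediate_value_Icc (le_max_left _ _) (diagPoly g).continuous.continuousOn
        ⟨hle, (hM _ (le_max_right _ _)).le⟩
    exact absurd (hroots y hy0) (not_le.mpr (hx.trans_le hy.1))
  | insert k B hk ih =>
    obtain ⟨M, hM⟩ := (diagPoly_multiPderiv_monic h2 h1 (insert k B)).1.exists_forall_eval_pos
    rw [Finset.insert_val_of_notMem hk, multiPderiv_cons] at hM ⊢
    have hne : multiPderiv B.val g ≠ 0 := multiPderiv_ne_zero_of_le
      (Finset.val_le_iff.mpr (Finset.subset_univ B)) (by rw [h1]; exact one_ne_zero)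
    have hanti := ((hS.multiPderiv hne).nevanlinna_diagPoly k).antitoneOn (convex_Ioi 1)
      fun x hx => (ih hx).ne'
    have h3 := hanti hx (Set.mem_Ioi.mpr (hx.trans_le (le_max_left x M))) (le_max_left x M)
    have h4 := div_pos (hM _ (le_max_right x M)) (ih (hx.trans_le (le_max_left x M)))
    exact (div_pos_iff_of_pos_right (ih hx)).mp (h4.trans_le h3)

theorem eval_update_of_pderiv_pderiv {p : MvPolynomial (Fin n) ℝ} {k : Fin n}
    (h : pderiv k (pderiv k p) = 0) (v : Fin n → ℝ) (x : ℝ) :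
    MvPolynomial.eval (Function.update v k (v k + x)) p =
      MvPolynomial.eval v p + x * MvPolynomial.eval v (pderiv k p) := by
  have h1 : (linePoly p v (Pi.single k 1)).natDegree ≤ 1 := natDegree_linePoly_le v h
  have h2 : (linePoly p v (Pi.single k 1)).coeff 1 = MvPolynomial.eval v (pderiv k p) := by
    have h3 := Polynomial.coeff_derivative (linePoly p v (Pi.single k 1)) 0
    rw [derivative_linePoly_single, Polynomial.coeff_zero_eq_eval_zero, eval_linePoly_real] at h3
    simpa using h3.symm
  have h4 : (linePoly p v (Pi.single k 1)).coeff 0 = MvPolynomial.eval v p := by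
    rw [Polynomial.coeff_zero_eq_eval_zero, eval_linePoly_real]; simp
  rw [← add_single_mul_eq_update, ← eval_linePoly_real,
    Polynomial.eq_X_add_C_of_natDegree_le_one h1, h2, h4]
  simp
  ring

theorem above_of_roots_le_one (hS : Stable g) (h2 : ∀ k, pderiv k (pderiv k g) = 0)
    (h1 : multiPderiv Finset.univ.val g = 1)
    (hroots : ∀ x : ℝ, (diagPoly g).IsRoot x → x ≤ 1) {b : ℝ} (hb : 1 < b) :
    Above g fun _ => b := by
  intro u hu
  have key : ∀ T B : Finset (Fin n),
      0 < MvPolynomial.eval (T.piecewise u fun _ => b) (multiPderiv B.val g) := by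
    intro T
    induction T using Finset.induction_on with
    | empty => intro B; simpa using eval_multiPderiv_pos hS h2 h1 hroots B hb
    | insert k T hk ih =>
      intro B
      have h3 := eval_update_of_pderiv_pderiv (p := multiPderiv B.val g) (k := k)
        (by rw [← multiPderiv_pderiv, ← multiPderiv_pderiv, h2, multiPderiv_map_zero])
        (T.piecewise u fun _ => b) (u k - b)
      rw [Finset.piecewise_eq_of_notMem _ _ _ hk, add_sub_cancel, ← Finset.piecewise_insert] at h3
      rw [h3]
      refine add_pos_of_pos_of_nonneg (ih B) (mul_nonneg (sub_nonneg.mpr (hu k)) ?_)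
      by_cases hkB : k ∈ B
      · rw [pderiv_multiPderiv_of_mem h2 hkB]; simp
      · rw [← multiPderiv_cons, ← Finset.insert_val_of_notMem hkB]
        exact (ih _).le
  simpa using key Finset.univ ∅

theorem exists_weights (hS : Stable g) (h2 : ∀ k, pderiv k (pderiv k g) = 0)
    (h1 : multiPderiv Finset.univ.val g = 1)
    (hroots : ∀ x : ℝ, (diagPoly g).IsRoot x → x ∈ Set.Icc (0 : ℝ) 1) (k : Fin n) :
    ∃ l d : Fin n → ℝ, (∀ i, l i ∈ Set.Icc (0 : ℝ) 1) ∧ (∀ i, 0 ≤ d i) ∧ ∑ i, d i = 1 ∧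
      ∑ i, d i * l i = - MvPolynomial.coeff (expOf ({k} : Finset (Fin n))ᶜ) g ∧
      diagPoly g = ∏ i, (Polynomial.X - Polynomial.C (l i)) ∧
      diagPoly (pderiv k g) = ∑ i, Polynomial.C (d i) *
        ∏ j ∈ Finset.univ.erase i, (Polynomial.X - Polynomial.C (l j)) := by
  obtain ⟨m, rfl⟩ : ∃ m, n = m + 1 := ⟨n - 1, by have := k.pos; omega⟩
  obtain ⟨hmon, hdeg⟩ := diagPoly_multiPderiv_monic h2 h1 ∅
  simp only [Finset.empty_val, multiPderiv_zero, Finset.compl_empty, Finset.card_univ,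
    Fintype.card_fin] at hmon hdeg
  obtain ⟨hmonk, hdegk⟩ := diagPoly_multiPderiv_monic h2 h1 {k}
  have hk1 : multiPderiv ({k} : Finset (Fin (m + 1))).val g = pderiv k g := multiPderiv_cons k 0 g
  have hcard : (({k} : Finset (Fin (m + 1)))ᶜ).card = m := by
    rw [Finset.card_compl, Finset.card_singleton, Fintype.card_fin, Nat.add_sub_cancel]
  rw [hk1] at hmonk hdegk
  rw [hcard] at hdegk
  obtain ⟨l, hl⟩ := exists_prod_of_aeval_ne_zero (m + 1) _ hmon.ne_zero hdeg
    hS.aeval_diagPoly_ne_zero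
  rw [hmon, Polynomial.C_1, one_mul] at hl
  have hN := hS.nevanlinna_diagPoly k
  rw [hl] at hN
  obtain ⟨c, d, hd, hcd⟩ := Nevanlinna.partial_fractions l Finset.univ _
    (by rw [hdegk]; simp) hN
  have herase : ∀ i, (∏ j ∈ Finset.univ.erase i,
      (Polynomial.X - Polynomial.C (l j))).natDegree = m := fun i => by
    rw [Polynomial.natDegree_finsetProd_X_sub_C_eq_card,
      Finset.card_erase_of_mem (Finset.mem_univ i), Finset.card_univ, Fintype.card_fin,
      Nat.add_sub_cancel]
  have hcoeffm : ∀ i, (∏ j ∈ Finset.univ.erase i,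
      (Polynomial.X - Polynomial.C (l j))).coeff m = 1 := fun i => by
    have := (Polynomial.monic_prod_of_monic (Finset.univ.erase i)
      (fun j => Polynomial.X - Polynomial.C (l j))
      fun j _ => Polynomial.monic_X_sub_C (l j)).coeff_natDegree
    rwa [herase] at this
  have hcoeff : (diagPoly g).coeff (m + 1) = 1 := by
    have := hmon.coeff_natDegree
    rwa [hdeg] at this
  have hcoeffk : (diagPoly (pderiv k g)).coeff m = 1 := by
    have := hmonk.coeff_natDegree
    rwa [hdegk] at this
  have hc : c = 0 := by
    have h3 := congrArg (fun q : Polynomial ℝ => q.coeff (m + 1)) hcd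
    simp only [Polynomial.coeff_add, Polynomial.coeff_C_mul, Polynomial.finsetSum_coeff] at h3
    rw [Polynomial.coeff_eq_zero_of_natDegree_lt (by omega), Finset.sum_eq_zero fun i _ => by
      rw [Polynomial.coeff_eq_zero_of_natDegree_lt (by rw [herase]; omega), mul_zero], ← hl, hcoeff] at h3
    linarith
  rw [hc, Polynomial.C_0, zero_mul, zero_add] at hcd
  have hd1 : ∑ i, d i = 1 := by
    have h3 := congrArg (fun q : Polynomial ℝ => q.coeff m) hcd
    simp only [Polynomial.coeff_C_mul, Polynomial.finsetSum_coeff, hcoeffm, mul_one] at h3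
    rw [← h3, hcoeffk]
  refine ⟨l, d, fun i => hroots _ ?_, fun i => hd i (Finset.mem_univ i), hd1, ?_, hl, hcd⟩
  · rw [Polynomial.IsRoot.def, hl, Polynomial.eval_prod,
      Finset.prod_eq_zero (Finset.mem_univ i) (by simp)]
  · obtain ⟨-, hco⟩ := diagPoly_natDegree_le_and_coeff ({k}ᶜ : Finset (Fin (m + 1)))
      (g - MvPolynomial.X k * pderiv k g) (pderiv_pderiv_X_mul_pderiv h2 k) fun j hj => by
        rw [pderiv_X_mul_pderiv k j (h2 k), if_pos (by simpa using hj)]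
    have hkk : k ∉ (expOf ({k} : Finset (Fin (m + 1)))ᶜ).support := by
      simp only [expOf, Finsupp.mem_support_iff, Finsupp.finsetSum_apply, not_not]
      exact Finset.sum_eq_zero fun i hi => Finsupp.single_eq_of_ne
        (Ne.symm (by simpa using hi))
    rw [coeff_multiPderiv _ _ _ (by simp), zero_add, MvPolynomial.coeff_sub,
      MvPolynomial.coeff_X_mul', if_neg hkk, sub_zero, hcard] at hco
    have hdiff : diagPoly (g - MvPolynomial.X k * pderiv k g) =
        - ∑ i, Polynomial.C (d i * l i) *
          ∏ j ∈ Finset.univ.erase i, (Polynomial.X - Polynomial.C (l j)) := by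
      have h3 : diagPoly (g - MvPolynomial.X k * pderiv k g) =
          (∑ i, Polynomial.C (d i)) * diagPoly g - Polynomial.X * diagPoly (pderiv k g) := by
        rw [← map_sum, hd1, Polynomial.C_1, one_mul, ← diagPoly_X_mul, diagPoly, map_sub]
        rfl
      rw [h3, hcd, hl, Finset.sum_mul, Finset.mul_sum, ← Finset.sum_sub_distrib,
        ← Finset.sum_neg_distrib]
      refine Finset.sum_congr rfl fun i _ => ?_
      rw [← Finset.mul_prod_erase _ _ (Finset.mem_univ i), Polynomial.C_mul]
      ring
    rw [hdiff, Polynomial.coeff_neg, Polynomial.finsetSum_coeff] at hco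
    simp only [Polynomial.coeff_C_mul, hcoeffm, mul_one] at hco
    linarith

end Diagonal

section Main

variable {n : ℕ} {g : MvPolynomial (Fin n) ℝ}

theorem coeff_expOf_compl_singleton_nonpos (hS : Stable g) (h2 : ∀ k, pderiv k (pderiv k g) = 0)
    (h1 : multiPderiv Finset.univ.val g = 1)
    (hroots : ∀ x : ℝ, (diagPoly g).IsRoot x → x ∈ Set.Icc (0 : ℝ) 1) (k : Fin n) :
    MvPolynomial.coeff (expOf ({k} : Finset (Fin n))ᶜ) g ≤ 0 := by
  obtain ⟨l, d, hl, hd, -, hsum, -, -⟩ := exists_weights hS h2 h1 hroots k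
  rw [← neg_nonneg, ← hsum]
  exact Finset.sum_nonneg fun i _ => mul_nonneg (hd i) (hl i).1

theorem inv_sub_le {b l : ℝ} (hb : 1 < b) (h0 : 0 ≤ l) (h1 : l ≤ 1) :
    1 / (b - l) ≤ (1 - l) / b + l / (b - 1) := by
  have h2 : 0 < b - l := by linarith
  have h3 : 0 < b - 1 := by linarith
  have h4 : 0 < b := by linarith
  rw [div_add_div _ _ h4.ne' h3.ne', div_le_div_iff₀ h2 (mul_pos h4 h3)]
  nlinarith [mul_nonneg h0 (sub_nonneg.mpr h1)]

theorem eval_pderiv_le (hS : Stable g) (h2 : ∀ k, pderiv k (pderiv k g) = 0)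
    (h1 : multiPderiv Finset.univ.val g = 1)
    (hroots : ∀ x : ℝ, (diagPoly g).IsRoot x → x ∈ Set.Icc (0 : ℝ) 1) {b α : ℝ} (hb : 1 < b)
    (k : Fin n) (hα : - MvPolynomial.coeff (expOf ({k} : Finset (Fin n))ᶜ) g ≤ α) :
    MvPolynomial.eval (fun _ => b) (pderiv k g) ≤
      ((1 - α) / b + α / (b - 1)) * MvPolynomial.eval (fun _ => b) g := by
  obtain ⟨l, d, hl, hd, hd1, hsum, hg, hgk⟩ := exists_weights hS h2 h1 hroots k
  rw [← hsum] at hα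
  have hpos : ∀ i, 0 < b - l i := fun i => by linarith [(hl i).2]
  set P := ∏ i, (b - l i) with hP
  have hP0 : 0 < P := Finset.prod_pos fun i _ => hpos i
  have hle : ∀ i, d i * ∏ j ∈ Finset.univ.erase i, (b - l j) ≤
      (d i * (1 / b) + d i * l i * (1 / (b - 1) - 1 / b)) * P := fun i => by
    have h3 : ∏ j ∈ Finset.univ.erase i, (b - l j) = 1 / (b - l i) * P := by
      rw [hP, ← Finset.mul_prod_erase _ _ (Finset.mem_univ i), ← mul_assoc,
        one_div_mul_cancel (hpos i).ne', one_mul]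
    have h4 := mul_le_mul_of_nonneg_left (mul_le_mul_of_nonneg_right
      (inv_sub_le hb (hl i).1 (hl i).2) hP0.le) (hd i)
    rw [h3]
    refine h4.trans_eq ?_
    ring
  have hmono : 0 ≤ 1 / (b - 1) - 1 / b :=
    sub_nonneg.mpr (one_div_le_one_div_of_le (by linarith) (by linarith))
  rw [← eval_diagPoly, ← eval_diagPoly, hg, hgk]
  simp only [Polynomial.eval_finsetSum, Polynomial.eval_mul, Polynomial.eval_prod,
    Polynomial.eval_sub, Polynomial.eval_X, Polynomial.eval_C]
  rw [← hP]
  refine (Finset.sum_le_sum fun i _ => hle i).trans ?_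
  rw [← Finset.sum_mul, Finset.sum_add_distrib, ← Finset.sum_mul, ← Finset.sum_mul, hd1]
  refine mul_le_mul_of_nonneg_right ?_ hP0.le
  have := mul_le_mul_of_nonneg_right hα hmono
  calc _ ≤ 1 * (1 / b) + α * (1 / (b - 1) - 1 / b) := by linarith
    _ = _ := by ring

theorem exists_optimal_barrier {r α : ℝ} (hr : 2 ≤ r) (hα0 : 0 < α)
    (hα1 : α < (r - 1) ^ 2 / r ^ 2) :
    ∃ b, 1 < b ∧ b - (r - 1) ^ 2 / (r * (r * ((1 - α) / b + α / (b - 1)) - 1 / b)) =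
      (√(1 / r - α / (r - 1)) + √α) ^ 2 := by
  have hr0 : 0 < r := by linarith
  have hq0 : 0 < r - 1 := by linarith
  have h3 : α * r ^ 2 < (r - 1) ^ 2 := (lt_div_iff₀ (by positivity)).mp hα1
  have h4 : 0 < r - 1 - r * α := by nlinarith
  set s := √(α * r * (r - 1) * (r - 1 - r * α)) with hs
  have hs2 : s ^ 2 = α * r * (r - 1) * (r - 1 - r * α) := Real.sq_sqrt (by positivity)
  have hsr : r * α < s := by
    refine Real.lt_sqrt_of_sq_lt ?_
    nlinarith [mul_pos hr0 hα0]
  have hs0 : 0 < s := by positivity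
  have hbound : (√(1 / r - α / (r - 1)) + √α) ^ 2 =
      1 / r - α / (r - 1) + α + 2 * (s / (r * (r - 1))) := by
    have h5 : 0 ≤ 1 / r - α / (r - 1) := by
      rw [div_sub_div _ _ hr0.ne' hq0.ne']
      exact div_nonneg (by linarith) (by positivity)
    have h6 : √(1 / r - α / (r - 1)) * √α = s / (r * (r - 1)) := by
      rw [← Real.sqrt_mul h5, Real.sqrt_eq_iff_eq_sq (mul_nonneg h5 hα0.le) (by positivity),
        div_pow, hs2]
      field_simp
    rw [add_sq, Real.sq_sqrt h5, Real.sq_sqrt hα0.le, mul_assoc, h6]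
    ring
  have hsr0 : 0 < s - r * α := by linarith
  refine ⟨1 + (s - r * α) / (r - 1), by linarith [div_pos hsr0 hq0], ?_⟩
  rw [hbound]
  set t := (s - r * α) / (r - 1) with ht
  have ht0 : 0 < t := div_pos hsr0 hq0
  have hst : s = (r - 1) * t + r * α := by rw [ht]; field_simp; ring
  have h7 : r * ((1 - α) / (1 + t) + α / (1 + t - 1)) - 1 / (1 + t) = s / ((1 + t) * t) := by
    rw [hst, add_sub_cancel_left]
    field_simp
    ring
  rw [h7]
  have h8 : t = (s - r * α) / (r - 1) := ht
  clear_value t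
  subst h8
  field_simp
  linear_combination -hs2

end Main

theorem stmt1 (r : ℕ) (hr : 2 ≤ r) (α : ℝ) (hα0 : 0 < α)
    (hα1 : α ≤ ((r : ℝ) - 1) ^ 2 / (r : ℝ) ^ 2)
    (n : ℕ) (g : MvPolynomial (Fin n) ℝ)
    (hstable : RealStable g) (hma : MultiAffine g)
    (hroots : ∀ x : ℝ, (diagPoly g).IsRoot x → x ∈ Set.Icc (0 : ℝ) 1)
    (ha0 : MvPolynomial.coeff (expOf (Finset.univ : Finset (Fin n))) g = 1)
    (hai : ∀ i : Fin n, |MvPolynomial.coeff (expOf ({i} : Finset (Fin n))ᶜ) g| ≤ α) :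
    ∃ S : Fin r → Finset (Fin n),
      (∀ i j, i ≠ j → Disjoint (S i) (S j)) ∧ (∀ k, ∃ i, k ∈ S i) ∧
      ∀ i, ∀ x : ℝ, (diagPoly (pderivs (S i)ᶜ g)).IsRoot x →
        x ≤ (Real.sqrt (1 / (r : ℝ) - α / ((r : ℝ) - 1)) + Real.sqrt α) ^ 2 := by
  have hr2 : (2 : ℝ) ≤ r := by exact_mod_cast hr
  have hS : Stable g := hstable.stable
  have h2 : ∀ k, pderiv k (pderiv k g) = 0 := hma.pderiv_pderiv
  have h1 : multiPderiv Finset.univ.val g = 1 := by rw [multiPderiv_univ h2, ha0, MvPolynomial.C_1]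
  have hroots1 : ∀ x : ℝ, (diagPoly g).IsRoot x → x ≤ 1 := fun x hx => (hroots x hx).2
  rcases hα1.eq_or_lt with heq | hlt
  · refine ⟨fun i => if i = ⟨0, by omega⟩ then Finset.univ else ∅, fun i j hij => ?_,
      fun k => ⟨⟨0, by omega⟩, by simp⟩, fun i x hx => ?_⟩
    · dsimp only
      split_ifs with h3 h4
      · exact absurd (h3.trans h4.symm) hij
      all_goals simp
    · have hr0 : (0 : ℝ) < r := by linarith
      have hq0 : (0 : ℝ) < r - 1 := by linarith
      have h3 : 1 / (r : ℝ) - α / ((r : ℝ) - 1) = (1 / r) ^ 2 := by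
        rw [heq]; field_simp; ring
      have h4 : (Real.sqrt (1 / (r : ℝ) - α / ((r : ℝ) - 1)) + Real.sqrt α) ^ 2 = 1 := by
        rw [h3, heq, ← div_pow, Real.sqrt_sq (by positivity), Real.sqrt_sq (by positivity)]
        field_simp; ring
      rw [h4]
      rw [pderivs_eq_multiPderiv] at hx
      dsimp only at hx
      split_ifs at hx with h5
      · rw [Finset.compl_univ, Finset.empty_val, multiPderiv_zero] at hx
        exact hroots1 x hx
      · rw [Finset.compl_empty, h1] at hx
        simp [diagPoly] at hx
  · obtain ⟨b, hb, hbound⟩ := exists_optimal_barrier hr2 hα0 hlt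
    have hA := above_of_roots_le_one hS h2 h1 hroots1 hb
    have htop : multiPderiv Finset.univ.val g ≠ 0 := by rw [h1]; exact one_ne_zero
    have hF := (barrier hr hS h2 htop hA (φ := r * ((1 - α) / b + α / (b - 1)))
      (fun k v hv => by
        rw [multiPderiv_erase h2 ha0]
        have := coeff_expOf_compl_singleton_nonpos hS h2 h1 hroots k
        simp only [map_add, MvPolynomial.eval_X, MvPolynomial.eval_C]
        linarith)
      (fun k => by
        rw [mul_assoc]
        exact mul_le_mul_of_nonneg_left (eval_pderiv_le hS h2 h1 hroots hb k
          ((neg_le_abs _).trans (hai k))) (by linarith)) Finset.univ).1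
    simp only [Finset.mem_univ, if_true, hbound] at hF
    obtain ⟨σ, hσ⟩ := exists_assignment (B := b) (by omega) Finset.univ (fun _ : Fin r => g)
      (fun _ => hS) (fun _ => hA) (fun k _ => h2 k) (fun _ => htop)
      fun x hx => hF _ fun _ => hx.le
    refine ⟨fun i => Finset.univ.filter fun k => σ k = i, fun i j hij => ?_,
      fun k => ⟨σ k, by simp⟩, fun i x hx => ?_⟩
    · exact Finset.disjoint_filter.mpr fun k _ hi hj => hij (hi.symm.trans hj)
    · by_contra! hlt
      have h3 := (hσ x hlt).ne'
      rw [map_prod] at h3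
      refine Finset.prod_ne_zero_iff.mp h3 i (Finset.mem_univ i) ?_
      rwa [← eval_diagPoly, ← pderivs_eq_multiPderiv, ← Finset.compl_filter]
end

section
/- For every δ > 0 there exists an integer r (depending only on δ) such that: for every n and every strongly Rayleigh point process 𝔛 on [n], there is a partition of [n] into r (possibly empty) subsets S_1,…,S_r such that for every i with S_i nonempty, | H(𝔛 ∩ S_i)/|S_i| − (Σ_{j∈S_i} h(p_j))/|S_i| | < δ, where p_j = ℙ(j ∈ 𝔛). -/
open MvPolynomial Polynomial

/-- `μ` is the law of a point process on `[n]`, i.e. a probability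
distribution on subsets of `[n]`. -/
def IsPointProcess {n : ℕ} (μ : Finset (Fin n) → ℝ) : Prop :=
  (∀ A, 0 ≤ μ A) ∧ (∑ A : Finset (Fin n), μ A) = 1

/-- The probability generating polynomial `f_𝔛(z) = Σ_A ℙ(𝔛 = A) z^A`. -/
noncomputable def genPoly {n : ℕ} (μ : Finset (Fin n) → ℝ) : MvPolynomial (Fin n) ℝ :=
  ∑ A : Finset (Fin n), MvPolynomial.monomial (expOf A) (μ A)

/-- A point process is strongly Rayleigh if its probability generating
polynomial is real stable. -/
def StronglyRayleigh {n : ℕ} (μ : Finset (Fin n) → ℝ) : Prop :=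
  IsPointProcess μ ∧ RealStable (genPoly μ)

/-- `ℙ(A ⊆ 𝔛)`. -/
noncomputable def probSupset {n : ℕ} (μ : Finset (Fin n) → ℝ) (A : Finset (Fin n)) : ℝ :=
  ∑ B ∈ Finset.univ.filter (fun B : Finset (Fin n) => A ⊆ B), μ B

/-- The kernel polynomial `g_𝔛(z) = Σ_A (−1)^{|A|} ℙ(A ⊆ 𝔛) z^{A^c}`. -/
noncomputable def kernelPoly {n : ℕ} (μ : Finset (Fin n) → ℝ) : MvPolynomial (Fin n) ℝ :=
  ∑ A : Finset (Fin n),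
    MvPolynomial.monomial (expOf Aᶜ) ((-1 : ℝ) ^ A.card * probSupset μ A)

/-- Entropy (base 2) of a point process. By convention `0·log₂ 0 = 0`. -/
noncomputable def entropyPP {n : ℕ} (μ : Finset (Fin n) → ℝ) : ℝ :=
  -∑ A : Finset (Fin n), μ A * Real.logb 2 (μ A)

/-- Binary entropy `h(p) = −p log₂ p − (1−p) log₂ (1−p)` (with `h(0)=h(1)=0`). -/
noncomputable def binEnt (p : ℝ) : ℝ :=
  -(p * Real.logb 2 p) - (1 - p) * Real.logb 2 (1 - p)

/-- The law of the restriction `𝔛 ∩ S` of a point process to `S`. -/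
noncomputable def restrictLaw {n : ℕ} (μ : Finset (Fin n) → ℝ) (S : Finset (Fin n)) :
    Finset (Fin n) → ℝ :=
  fun B => ∑ A ∈ Finset.univ.filter (fun A : Finset (Fin n) => A ∩ S = B), μ A

/-- `p_j = ℙ(j ∈ 𝔛)`. -/
noncomputable def probMem {n : ℕ} (μ : Finset (Fin n) → ℝ) (j : Fin n) : ℝ :=
  ∑ A ∈ Finset.univ.filter (fun A : Finset (Fin n) => j ∈ A), μ A

theorem deriv_le_of_mapsTo_slitPlane {φ : ℂ → ℂ} (hd : DifferentiableOn ℂ φ Complex.slitPlane)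
    (hm : Set.MapsTo φ Complex.slitPlane Complex.slitPlane) {c c' : ℝ} (hc : 0 < c)
    (h1 : φ 1 = c) (h1' : HasDerivAt φ c' 1) : c' ≤ c := by
  set K : ℂ → ℂ := fun ζ => ((1 + ζ) / (1 - ζ)) ^ 2 with hK
  have hne : ∀ ζ ∈ Metric.ball (0 : ℂ) 1, (1 - ζ) ≠ 0 := by
    intro ζ hζ h0
    have : ζ = 1 := by linear_combination -h0
    simp [this] at hζ
  have hKs : Set.MapsTo K (Metric.ball 0 1) Complex.slitPlane := by
    intro ζ hζ
    have h0 := hne ζ hζ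
    have hpos : 0 < ((1 + ζ) / (1 - ζ)).re := by
      rw [Complex.div_re, ← add_div]
      apply div_pos _ (Complex.normSq_pos.2 h0)
      have : ‖ζ‖ < 1 := by simpa using hζ
      have h2 : Complex.normSq ζ < 1 := by
        rw [Complex.normSq_eq_norm_sq]
        nlinarith [norm_nonneg ζ]
      rw [Complex.normSq_apply] at h2
      simp
      nlinarith
    rw [Complex.mem_slitPlane_iff]
    by_cases him : ((1 + ζ) / (1 - ζ)).im = 0
    · left
      simp only [hK, sq, Complex.mul_re, him]
      nlinarith
    · right
      simp only [hK, sq, Complex.mul_im]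
      intro h
      apply him
      have : ((1 + ζ) / (1 - ζ)).re * ((1 + ζ) / (1 - ζ)).im = 0 := by linarith
      rcases mul_eq_zero.1 this with h | h
      · linarith
      · exact h
  have hKd : DifferentiableOn ℂ K (Metric.ball 0 1) := by
    intro ζ hζ
    exact ((((differentiableAt_const _).add differentiableAt_id).div
      ((differentiableAt_const _).sub differentiableAt_id) (hne ζ hζ)).pow 2).differentiableWithinAt
  set F : ℂ → ℂ := fun ζ => (φ (K ζ)) ^ (1 / 2 : ℂ) with hF
  have hFd : DifferentiableOn ℂ F (Metric.ball 0 1) :=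
    (hd.comp hKd hKs).cpow_const (fun ζ hζ => hm (hKs hζ))
  have hFre : ∀ ζ ∈ Metric.ball (0 : ℂ) 1, 0 < (F ζ).re := by
    intro ζ hζ
    have hs := hm (hKs hζ)
    have hs0 := Complex.slitPlane_ne_zero hs
    rw [hF]
    simp only [Complex.cpow_def_of_ne_zero hs0]
    rw [Complex.exp_re]
    apply mul_pos (Real.exp_pos _)
    apply Real.cos_pos_of_mem_Ioo
    have e : (Complex.log (φ (K ζ)) * (1 / 2)).im = Complex.arg (φ (K ζ)) / 2 := by
      rw [show (1 / 2 : ℂ) = ((1 / 2 : ℝ) : ℂ) by norm_num, Complex.im_mul_ofReal, Complex.log_im]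
      ring
    rw [e]
    have h3 := (Complex.mem_slitPlane_iff_arg.1 hs).1
    have h4 := Complex.neg_pi_lt_arg (φ (K ζ))
    have h5 := Complex.arg_le_pi (φ (K ζ))
    constructor
    · linarith
    · have := lt_of_le_of_ne h5 h3
      linarith
  have hK0 : K 0 = 1 := by simp [hK]
  set s : ℝ := Real.sqrt c with hs
  have hs0 : 0 < s := Real.sqrt_pos.2 hc
  have hss : s * s = c := Real.mul_self_sqrt hc.le
  have hF0 : F 0 = s := by
    simp only [hF, hK0, h1]
    rw [show (1 / 2 : ℂ) = ((1 / 2 : ℝ) : ℂ) by norm_num, ← Complex.ofReal_cpow hc.le, hs,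
      Real.sqrt_eq_rpow]
  have hK' : HasDerivAt K 4 0 := by
    have h2 := ((((hasDerivAt_id (0 : ℂ)).const_add 1).div ((hasDerivAt_id (0 : ℂ)).const_sub 1)
      (by simp)).pow 2)
    refine h2.congr_deriv ?_
    norm_num
  have hF' : HasDerivAt F (2 * c' / s) 0 := by
    have h2 : HasDerivAt (fun ζ => φ (K ζ)) (c' * 4) 0 :=
      HasDerivAt.comp (h₂ := φ) 0 (by rw [hK0]; exact h1') hK'
    have h3 := h2.cpow_const (c := (1 / 2 : ℂ)) (by rw [hK0, h1]; simp [hc])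
    refine h3.congr_deriv ?_
    rw [hK0, h1, Complex.cpow_sub _ _ (by exact_mod_cast hc.ne'), Complex.cpow_one]
    have h4 : (c : ℂ) ^ (1 / 2 : ℂ) = s := by
      simpa [hF, hK0, h1] using hF0
    rw [h4, ← hss]
    have : (s : ℂ) ≠ 0 := by exact_mod_cast hs0.ne'
    push_cast
    field_simp
    norm_num
    ring
  set G : ℂ → ℂ := fun ζ => (F ζ - s) / (F ζ + s) with hG
  have hden : ∀ ζ ∈ Metric.ball (0 : ℂ) 1, F ζ + s ≠ 0 := by
    intro ζ hζ h0
    have := hFre ζ hζ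
    have h3 := congrArg Complex.re h0
    simp at h3
    linarith
  have hGd : DifferentiableOn ℂ G (Metric.ball 0 1) :=
    (hFd.sub_const _).div (hFd.add_const _) hden
  have hG0 : G 0 = 0 := by simp [hG, hF0]
  have hGm : Set.MapsTo G (Metric.ball 0 1) (Metric.ball (G 0) 1) := by
    intro ζ hζ
    rw [hG0, mem_ball_zero_iff, hG]
    simp only [norm_div]
    rw [div_lt_one (norm_pos_iff.2 (hden ζ hζ))]
    apply lt_of_pow_lt_pow_left₀ 2 (norm_nonneg _)
    rw [← Complex.normSq_eq_norm_sq, ← Complex.normSq_eq_norm_sq, Complex.normSq_apply,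
      Complex.normSq_apply]
    have := hFre ζ hζ
    simp
    nlinarith [mul_pos this hs0]
  have hG' : HasDerivAt G (c' / c) 0 := by
    have h2 := (hF'.sub_const (s : ℂ)).div (hF'.add_const (s : ℂ)) (hden 0 (by simp))
    refine h2.congr_deriv ?_
    rw [hF0, ← hss]
    have : (s : ℂ) ≠ 0 := by exact_mod_cast hs0.ne'
    push_cast
    field_simp
    ring
  have hle := Complex.norm_deriv_le_div_of_mapsTo_ball hGd
      (hGm.mono_right Metric.ball_subset_closedBall) one_pos
  rw [hG'.deriv, ← Complex.ofReal_div, Complex.norm_real, div_one, Real.norm_eq_abs] at hle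
  have := (le_abs_self _).trans hle
  rwa [div_le_one hc] at this

theorem im_mul_conj_nonneg {a b : ℂ} (h : ∀ s : ℂ, 0 < s.im → a + s * b ≠ 0) :
    0 ≤ (a * (starRingEnd ℂ) b).im := by
  by_contra! hlt
  have hb : b ≠ 0 := by
    rintro rfl
    simp at hlt
  have hn : 0 < Complex.normSq b := Complex.normSq_pos.2 hb
  refine h (-(a / b)) ?_ (by field_simp; ring)
  have e : a / b = a * (starRingEnd ℂ) b / (Complex.normSq b : ℝ) := by
    rw [Complex.normSq_eq_conj_mul_self]
    have : (starRingEnd ℂ) b ≠ 0 := by simpa using hb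
    field_simp
  rw [e, Complex.neg_im, Complex.div_ofReal_im]
  have := div_neg_of_neg_of_pos hlt hn
  linarith

theorem wronskian_le_mul {g h : ℂ → ℂ} (hg : Differentiable ℂ g) (hh : Differentiable ℂ h)
    (gc : ∀ z, g ((starRingEnd ℂ) z) = (starRingEnd ℂ) (g z))
    (hc : ∀ z, h ((starRingEnd ℂ) z) = (starRingEnd ℂ) (h z))
    (gpos : ∀ x : ℝ, 0 < x → ∃ y : ℝ, 0 < y ∧ g x = y)
    (hpos : ∀ x : ℝ, 0 < x → ∃ y : ℝ, 0 < y ∧ h x = y)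
    (hst : ∀ t s : ℂ, 0 < t.im → 0 < s.im → g t + s * h t ≠ 0) {a b a' b' : ℝ}
    (ga : g 1 = a) (hb : h 1 = b) (ga' : HasDerivAt g a' 1) (hb' : HasDerivAt h b' 1) :
    a' * b - a * b' ≤ a * b := by
  have a0 : 0 < a := by
    obtain ⟨y, hy, e⟩ := gpos 1 one_pos
    rw [Complex.ofReal_one, ga] at e
    rwa [Complex.ofReal_inj.1 e]
  have b0 : 0 < b := by
    obtain ⟨y, hy, e⟩ := hpos 1 one_pos
    rw [Complex.ofReal_one, hb] at e
    rwa [Complex.ofReal_inj.1 e]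
  set U : Set ℂ := {z | 0 < z.im} with hU
  have hUo : IsOpen U := isOpen_lt continuous_const Complex.continuous_im
  have hUc : IsPreconnected U := (convex_halfSpace_im_gt 0).isPreconnected
  have hP : ∀ t ∈ U, 0 ≤ (g t * (starRingEnd ℂ) (h t)).im := fun t ht =>
    im_mul_conj_nonneg fun s hs => hst t s ht hs
  have hden : ∀ t ∈ U, g t + Complex.I * h t ≠ 0 := fun t ht => hst t _ ht (by simp)
  have hn1 : ∀ t, ‖g t - Complex.I * h t‖ ^ 2 =
      ‖g t + Complex.I * h t‖ ^ 2 - 4 * (g t * (starRingEnd ℂ) (h t)).im := by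
    intro t
    rw [← Complex.normSq_eq_norm_sq, ← Complex.normSq_eq_norm_sq, Complex.normSq_apply,
      Complex.normSq_apply]
    simp
    ring
  by_cases hex : ∃ t ∈ U, (g t * (starRingEnd ℂ) (h t)).im = 0
  · obtain ⟨t₀, ht₀, h0⟩ := hex
    set M : ℂ → ℂ := fun t => (g t - Complex.I * h t) / (g t + Complex.I * h t) with hM
    have hMd : DifferentiableOn ℂ M U :=
      (hg.sub (hh.const_mul _)).differentiableOn.div
        (hg.add (hh.const_mul _)).differentiableOn hden
    have hM0 : ‖M t₀‖ = 1 := by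
      rw [hM]
      simp only [norm_div]
      rw [div_eq_one_iff_eq (norm_ne_zero_iff.2 (hden t₀ ht₀))]
      rw [← sq_eq_sq₀ (norm_nonneg _) (norm_nonneg _), hn1, h0]
      ring
    have hmax : IsMaxOn (norm ∘ M) U t₀ := by
      intro t ht
      simp only [Function.comp, Set.mem_ofPred_eq, hM0]
      rw [hM]
      simp only [norm_div]
      rw [div_le_one (norm_pos_iff.2 (hden t ht))]
      rw [← sq_le_sq₀ (norm_nonneg _) (norm_nonneg _), hn1]
      linarith [hP t ht]
    have hMc := Complex.eqOn_of_isPreconnected_of_isMaxOn_norm hUc hUo hMd ht₀ hmax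
    set c := M t₀
    have hEq : ∀ t, (1 - c) * g t = Complex.I * (1 + c) * h t := by
      have h1 : AnalyticOnNhd ℂ (fun t => (1 - c) * g t) Set.univ :=
        (hg.const_mul _).differentiableOn.analyticOnNhd isOpen_univ
      have h2 : AnalyticOnNhd ℂ (fun t => Complex.I * (1 + c) * h t) Set.univ :=
        (hh.const_mul _).differentiableOn.analyticOnNhd isOpen_univ
      have h3 : (fun t => (1 - c) * g t) =ᶠ[nhds t₀] (fun t => Complex.I * (1 + c) * h t) := by
        filter_upwards [hUo.mem_nhds ht₀] with t ht
        have h4 := hMc ht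
        simp only [hM, Function.const_apply] at h4
        rw [div_eq_iff (hden t ht)] at h4
        linear_combination h4
      intro t
      exact congrFun (h1.eq_of_eventuallyEq h2 h3) t
    have hE1 := hEq 1
    have hE' : (1 - c) * (a' : ℂ) = Complex.I * (1 + c) * b' := by
      have h1 := ga'.const_mul (1 - c)
      have h2 := hb'.const_mul (Complex.I * (1 + c))
      rw [funext hEq] at h1
      exact h1.unique h2
    rw [ga, hb] at hE1
    have hz : (a' : ℂ) * b - a * b' = 0 := by
      by_cases hc1 : 1 - c = 0
      · exfalso
        have h2 : (1 + c) * (b : ℂ) = 0 := by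
          rw [hc1] at hE1
          have := mul_eq_zero.1 (show Complex.I * ((1 + c) * (b : ℂ)) = 0 by
            linear_combination -hE1)
          exact this.resolve_left Complex.I_ne_zero
        have hb00 : (b : ℂ) ≠ 0 := by exact_mod_cast b0.ne'
        have h3 := (mul_eq_zero.1 h2).resolve_right hb00
        have : (2 : ℂ) = 0 := by linear_combination hc1 + h3
        norm_num at this
      · apply mul_left_cancel₀ hc1
        linear_combination b * hE' - b' * hE1
    have hz' : a' * b - a * b' = 0 := by exact_mod_cast hz
    rw [hz']
    positivity
  · push Not at hex
    have hPp : ∀ t ∈ U, 0 < (g t * (starRingEnd ℂ) (h t)).im := fun t ht =>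
      lt_of_le_of_ne (hP t ht) (hex t ht).symm
    have him : ∀ t, (g t / h t).im = (g t * (starRingEnd ℂ) (h t)).im / Complex.normSq (h t) := by
      intro t
      rw [Complex.div_im]
      simp
      ring
    have hhU : ∀ t ∈ U, h t ≠ 0 := by
      intro t ht h0
      have := hPp t ht
      simp [h0] at this
    have hcU : ∀ t : ℂ, t.im < 0 → (starRingEnd ℂ) t ∈ U := by
      intro t ht
      simpa [hU] using ht
    have key : ∀ t ∈ Complex.slitPlane, h t ≠ 0 ∧ g t / h t ∈ Complex.slitPlane := by
      intro t ht
      rcases lt_trichotomy t.im 0 with hlt | heq | hgt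
      · have h1 := hhU _ (hcU t hlt)
        have h2 := hPp _ (hcU t hlt)
        rw [hc] at h1
        rw [gc, hc, ← map_mul, Complex.conj_im] at h2
        have h3 : h t ≠ 0 := by simpa using h1
        refine ⟨h3, Complex.mem_slitPlane_iff.2 (Or.inr ?_)⟩
        rw [him]
        exact (div_neg_of_neg_of_pos (by linarith) (Complex.normSq_pos.2 h3)).ne
      · have h1 : 0 < t.re := by
          rcases Complex.mem_slitPlane_iff.1 ht with h | h
          · exact h
          · exact absurd heq h
        have h2 : t = (t.re : ℂ) := Complex.ext (by simp) (by simp [heq])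
        obtain ⟨y, hy, e⟩ := gpos _ h1
        obtain ⟨y', hy', e'⟩ := hpos _ h1
        rw [h2, e, e']
        refine ⟨by exact_mod_cast hy'.ne', ?_⟩
        rw [← Complex.ofReal_div]
        exact Complex.ofReal_mem_slitPlane.2 (div_pos hy hy')
      · refine ⟨hhU t hgt, Complex.mem_slitPlane_iff.2 (Or.inr ?_)⟩
        rw [him]
        exact (div_pos (hPp t hgt) (Complex.normSq_pos.2 (hhU t hgt))).ne'
    have hfin := deriv_le_of_mapsTo_slitPlane (φ := fun t => g t / h t) (c := a / b)
      (c' := (a' * b - a * b') / b ^ 2)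
      (hg.differentiableOn.div hh.differentiableOn fun t ht => (key t ht).1)
      (fun t ht => (key t ht).2) (div_pos a0 b0) (by simp [ga, hb])
      (by
        have := ga'.div hb' (by rw [hb]; exact_mod_cast b0.ne')
        refine this.congr_deriv ?_
        rw [ga, hb]
        push_cast
        ring)
    rw [div_le_div_iff₀ (by positivity) b0] at hfin
    nlinarith

section Covariance

variable {n : ℕ}

/-- The integral of `φ` against the weight `w` on finite sets. -/
def mass (w φ : Finset (Fin n) → ℝ) : ℝ := ∑ A, w A * φ A

/-- The unnormalized covariance of `φ` and `ψ` under the weight `w`. -/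
def ucov (w φ ψ : Finset (Fin n) → ℝ) : ℝ :=
  mass w 1 * mass w (φ * ψ) - mass w φ * mass w ψ

/-- The indicator of the sets containing `e`. -/
def memInd (e : Fin n) : Finset (Fin n) → ℝ := fun A => if e ∈ A then 1 else 0

/-- The part of the weight `w` living on the sets that contain `e`. -/
def including (w : Finset (Fin n) → ℝ) (e : Fin n) : Finset (Fin n) → ℝ :=
  fun A => if e ∈ A then w A else 0

/-- The part of the weight `w` living on the sets that avoid `e`. -/
def avoiding (w : Finset (Fin n) → ℝ) (e : Fin n) : Finset (Fin n) → ℝ :=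
  fun A => if e ∈ A then 0 else w A

theorem avoiding_nonneg {w : Finset (Fin n) → ℝ} (hw : ∀ A, 0 ≤ w A) (e : Fin n)
    (A : Finset (Fin n)) : 0 ≤ avoiding w e A := by
  unfold avoiding
  split_ifs
  exacts [le_rfl, hw A]

theorem including_nonneg {w : Finset (Fin n) → ℝ} (hw : ∀ A, 0 ≤ w A) (e : Fin n)
    (A : Finset (Fin n)) : 0 ≤ including w e A := by
  unfold including
  split_ifs
  exacts [hw A, le_rfl]

theorem mass_split (w φ : Finset (Fin n) → ℝ) (e : Fin n) :
    mass w φ = mass (avoiding w e) φ + mass (including w e) φ := by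
  unfold mass avoiding including
  rw [← Finset.sum_add_distrib]
  refine Finset.sum_congr rfl fun A _ => ?_
  split_ifs <;> simp

theorem mass_memInd_mul (w φ : Finset (Fin n) → ℝ) (e : Fin n) :
    mass w (memInd e * φ) = mass (including w e) φ := by
  unfold mass including memInd
  refine Finset.sum_congr rfl fun A _ => ?_
  simp only [Pi.mul_apply]
  split_ifs <;> simp

theorem mass_memInd (w : Finset (Fin n) → ℝ) (e : Fin n) :
    mass w (memInd e) = mass (including w e) 1 := by
  rw [← mass_memInd_mul, mul_one]

theorem mass_add (w φ ψ : Finset (Fin n) → ℝ) : mass w (φ + ψ) = mass w φ + mass w ψ := by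
  simp [mass, mul_add, Finset.sum_add_distrib]

theorem mass_sub (w φ ψ : Finset (Fin n) → ℝ) : mass w (φ - ψ) = mass w φ - mass w ψ := by
  simp [mass, mul_sub, Finset.sum_sub_distrib]

theorem mass_smul (w φ : Finset (Fin n) → ℝ) (c : ℝ) : mass w (c • φ) = c * mass w φ := by
  simp only [mass, Finset.mul_sum, Pi.smul_apply, smul_eq_mul]
  exact Finset.sum_congr rfl fun A _ => by ring

theorem mass_sum {κ : Type*} (w : Finset (Fin n) → ℝ) (T : Finset κ) (φ : κ → Finset (Fin n) → ℝ) :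
    mass w (∑ j ∈ T, φ j) = ∑ j ∈ T, mass w (φ j) := by
  simp only [mass, Finset.sum_apply, Finset.mul_sum]
  rw [Finset.sum_comm]

theorem mass_nonneg {w φ : Finset (Fin n) → ℝ} (hw : ∀ A, 0 ≤ w A) (hφ : ∀ A, 0 ≤ φ A) :
    0 ≤ mass w φ := Finset.sum_nonneg fun A _ => mul_nonneg (hw A) (hφ A)

theorem ucov_comm (w φ ψ : Finset (Fin n) → ℝ) : ucov w φ ψ = ucov w ψ φ := by
  unfold ucov
  rw [mul_comm φ ψ]
  ring

theorem ucov_sum_right {κ : Type*} (w φ : Finset (Fin n) → ℝ)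
    (T : Finset κ) (ψ : κ → Finset (Fin n) → ℝ) :
    ucov w φ (∑ j ∈ T, ψ j) = ∑ j ∈ T, ucov w φ (ψ j) := by
  unfold ucov
  rw [Finset.mul_sum, mass_sum, mass_sum, Finset.mul_sum, Finset.mul_sum, Finset.sum_sub_distrib]

theorem ucov_memInd (w ψ : Finset (Fin n) → ℝ) (e : Fin n) :
    ucov w (memInd e) ψ = mass (avoiding w e) 1 * mass (including w e) ψ -
      mass (including w e) 1 * mass (avoiding w e) ψ := by
  unfold ucov
  rw [mass_memInd_mul, mass_memInd, mass_split w 1 e, mass_split w ψ e]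
  ring

theorem ucov_memInd_self (w : Finset (Fin n) → ℝ) (e : Fin n) :
    ucov w (memInd e) (memInd e) = mass (avoiding w e) 1 * mass (including w e) 1 := by
  have h1 : mass (including w e) (memInd e) = mass (including w e) 1 := by
    unfold mass including memInd
    exact Finset.sum_congr rfl fun A _ => by split_ifs <;> simp
  have h2 : mass (avoiding w e) (memInd e) = 0 := by
    unfold mass avoiding memInd
    exact Finset.sum_eq_zero fun A _ => by split_ifs <;> simp
  rw [ucov_memInd, h1, h2]
  ring

theorem ucov_memInd_eq_sum (w ψ : Finset (Fin n) → ℝ) (e : Fin n) :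
    ucov w (memInd e) ψ = ∑ A, ∑ B, including w e A * avoiding w e B * (ψ A - ψ B) := by
  rw [ucov_memInd]
  unfold mass
  rw [Finset.sum_mul_sum, Finset.sum_mul_sum, Finset.sum_comm, ← Finset.sum_sub_distrib]
  refine Finset.sum_congr rfl fun A _ => ?_
  rw [← Finset.sum_sub_distrib]
  refine Finset.sum_congr rfl fun B _ => ?_
  simp
  ring

/-- The law of total covariance with respect to the event `e ∈ A`. -/
theorem ucov_eq_total (w φ ψ : Finset (Fin n) → ℝ) (e : Fin n) (h0 : mass (avoiding w e) 1 ≠ 0)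
    (h1 : mass (including w e) 1 ≠ 0) :
    ucov w φ ψ = mass w 1 / mass (avoiding w e) 1 * ucov (avoiding w e) φ ψ +
      mass w 1 / mass (including w e) 1 * ucov (including w e) φ ψ +
      ucov w (memInd e) φ * ucov w (memInd e) ψ /
        (mass (avoiding w e) 1 * mass (including w e) 1) := by
  rw [ucov_memInd, ucov_memInd]
  unfold ucov
  rw [mass_split w 1 e, mass_split w φ e, mass_split w ψ e, mass_split w (φ * ψ) e]
  field_simp
  ring

/-- Closed conditions on a weight: distinct coordinates are negatively correlated, and each
coordinate is positively correlated with the size. -/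
def RayleighAt (w : Finset (Fin n) → ℝ) : Prop :=
  (∀ i j, i ≠ j → ucov w (memInd i) (memInd j) ≤ 0) ∧
    ∀ i, 0 ≤ ∑ j, ucov w (memInd i) (memInd j)

/-- A nonnegative weight all of whose tilts satisfy `RayleighAt`. -/
def IsRayleigh (w : Finset (Fin n) → ℝ) : Prop :=
  (∀ A, 0 ≤ w A) ∧ ∀ x : Fin n → ℝ, (∀ i, 0 < x i) → RayleighAt fun A => w A * ∏ i ∈ A, x i

theorem IsRayleigh.rayleighAt {w : Finset (Fin n) → ℝ} (hw : IsRayleigh w) : RayleighAt w := by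
  simpa using hw.2 (fun _ => 1) (fun _ => one_pos)

theorem continuous_ucov (φ ψ : Finset (Fin n) → ℝ) : Continuous fun w => ucov w φ ψ := by
  unfold ucov mass
  fun_prop

theorem isClosed_rayleighAt : IsClosed {w : Finset (Fin n) → ℝ | RayleighAt w} := by
  have : {w : Finset (Fin n) → ℝ | RayleighAt w} =
      (⋂ i, ⋂ j, ⋂ (_ : i ≠ j), {w | ucov w (memInd i) (memInd j) ≤ 0}) ∩
        ⋂ i, {w | 0 ≤ ∑ j, ucov w (memInd i) (memInd j)} := by
    ext w
    simp [RayleighAt]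
  rw [this]
  refine IsClosed.inter (isClosed_iInter fun i => isClosed_iInter fun j => isClosed_iInter fun _ =>
    isClosed_le (continuous_ucov _ _) continuous_const) (isClosed_iInter fun i =>
    isClosed_le continuous_const (continuous_finsetSum _ fun j _ => continuous_ucov _ _))

theorem ucov_smul (c : ℝ) (w φ ψ : Finset (Fin n) → ℝ) : ucov (c • w) φ ψ = c ^ 2 * ucov w φ ψ := by
  have h : ∀ φ : Finset (Fin n) → ℝ, mass (c • w) φ = c * mass w φ := by
    intro φ
    simp only [mass, Finset.mul_sum, Pi.smul_apply, smul_eq_mul]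
    exact Finset.sum_congr rfl fun A _ => by ring
  unfold ucov
  rw [h, h, h, h]
  ring

theorem RayleighAt.smul {w : Finset (Fin n) → ℝ} (hw : RayleighAt w)
    (c : ℝ) : RayleighAt (c • w) := by
  refine ⟨fun i j hij => ?_, fun i => ?_⟩
  · rw [ucov_smul]
    exact mul_nonpos_of_nonneg_of_nonpos (sq_nonneg c) (hw.1 i j hij)
  · simp_rw [ucov_smul, ← Finset.mul_sum]
    exact mul_nonneg (sq_nonneg c) (hw.2 i)

theorem prod_update_mul (x : Fin n → ℝ) (e : Fin n) (c : ℝ) (A : Finset (Fin n)) :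
    ∏ i ∈ A, Function.update x e (c * x e) i = (if e ∈ A then c else 1) * ∏ i ∈ A, x i := by
  have h : ∀ i, Function.update x e (c * x e) i = (if i = e then c else 1) * x i := by
    intro i
    by_cases hi : i = e
    · subst hi; simp
    · simp [hi]
  simp_rw [h]
  rw [Finset.prod_mul_distrib, Finset.prod_ite_eq' A e (fun _ => c)]

theorem tendsto_inv_add_one :
    Filter.Tendsto (fun m : ℕ => ((m : ℝ) + 1)⁻¹) Filter.atTop (nhds 0) := by
  simpa using tendsto_one_div_add_atTop_nhds_zero_nat (𝕜 := ℝ)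

theorem IsRayleigh.avoiding {w : Finset (Fin n) → ℝ} (hw : IsRayleigh w) (e : Fin n) :
    IsRayleigh (avoiding w e) := by
  refine ⟨fun A => ?_, fun x hx => ?_⟩
  · unfold _root_.avoiding
    split_ifs
    exacts [le_rfl, hw.1 A]
  · show _ ∈ {w : Finset (Fin n) → ℝ | RayleighAt w}
    refine isClosed_rayleighAt.mem_of_tendsto (b := Filter.atTop)
      (f := fun m : ℕ => fun A => w A * ∏ i ∈ A, Function.update x e (((m : ℝ) + 1)⁻¹ * x e) i) ?_
      (Filter.Eventually.of_forall fun m => hw.2 _ fun i => ?_)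
    · rw [tendsto_pi_nhds]
      intro A
      simp_rw [prod_update_mul]
      unfold _root_.avoiding
      split_ifs with h
      · have := (tendsto_inv_add_one.mul_const (∏ i ∈ A, x i)).const_mul (w A)
        simpa using this
      · simp
    · by_cases hi : i = e
      · subst hi
        have := hx i
        simp
        positivity
      · simpa [hi] using hx i

theorem IsRayleigh.including {w : Finset (Fin n) → ℝ} (hw : IsRayleigh w) (e : Fin n) :
    IsRayleigh (including w e) := by
  refine ⟨fun A => ?_, fun x hx => ?_⟩
  · unfold _root_.including
    split_ifs
    exacts [hw.1 A, le_rfl]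
  · show _ ∈ {w : Finset (Fin n) → ℝ | RayleighAt w}
    refine isClosed_rayleighAt.mem_of_tendsto (b := Filter.atTop)
      (f := fun m : ℕ => ((m : ℝ) + 1)⁻¹ •
        fun A => w A * ∏ i ∈ A, Function.update x e (((m : ℝ) + 1) * x e) i) ?_
      (Filter.Eventually.of_forall fun m => (hw.2 _ fun i => ?_).smul _)
    · rw [tendsto_pi_nhds]
      intro A
      simp only [Pi.smul_apply, smul_eq_mul]
      simp_rw [prod_update_mul]
      unfold _root_.including
      split_ifs with h
      · refine tendsto_const_nhds.congr fun m => ?_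
        have : (m : ℝ) + 1 ≠ 0 := by positivity
        field_simp
      · have := tendsto_inv_add_one.mul_const (w A * (1 * ∏ i ∈ A, x i))
        simpa using this
    · by_cases hi : i = e
      · subst hi
        have := hx i
        simp
        positivity
      · simpa [hi] using hx i

/-- The set of finite sets charged by `w`. -/
noncomputable def wsupp (w : Finset (Fin n) → ℝ) : Finset (Finset (Fin n)) :=
  Finset.univ.filter fun A => w A ≠ 0

theorem exists_of_mass_pos {w : Finset (Fin n) → ℝ} (h : 0 < mass w 1) : ∃ A, w A ≠ 0 := by
  by_contra! h0
  simp [mass, h0] at h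

theorem card_wsupp_avoiding_lt {w : Finset (Fin n) → ℝ} {e : Fin n}
    (h : 0 < mass (including w e) 1) :
    (wsupp (avoiding w e)).card < (wsupp w).card := by
  obtain ⟨A, hA⟩ := exists_of_mass_pos h
  apply Finset.card_lt_card
  rw [Finset.ssubset_iff_of_subset]
  · refine ⟨A, ?_, ?_⟩ <;> simp only [wsupp, including, avoiding] at * <;> aesop
  · intro B
    simp only [wsupp, avoiding]
    aesop

theorem card_wsupp_including_lt {w : Finset (Fin n) → ℝ} {e : Fin n}
    (h : 0 < mass (avoiding w e) 1) :
    (wsupp (including w e)).card < (wsupp w).card := by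
  obtain ⟨A, hA⟩ := exists_of_mass_pos h
  apply Finset.card_lt_card
  rw [Finset.ssubset_iff_of_subset]
  · refine ⟨A, ?_, ?_⟩ <;> simp only [wsupp, including, avoiding] at * <;> aesop
  · intro B
    simp only [wsupp, including]
    aesop

/-- Both `e ∈ A` and `e ∉ A` have positive weight. -/
def Nondeg (w : Finset (Fin n) → ℝ) (e : Fin n) : Prop :=
  0 < mass (avoiding w e) 1 ∧ 0 < mass (including w e) 1

theorem eq_zero_of_mass_eq_zero {w : Finset (Fin n) → ℝ} (hw : ∀ A, 0 ≤ w A) (h : mass w 1 ≤ 0)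
    (A : Finset (Fin n)) : w A = 0 := by
  have h0 : mass w 1 = 0 := le_antisymm h (mass_nonneg hw fun _ => zero_le_one)
  unfold mass at h0
  simp only [Pi.one_apply, mul_one] at h0
  rw [Finset.sum_eq_zero_iff_of_nonneg (fun A _ => hw A)] at h0
  exact h0 A (Finset.mem_univ A)

theorem mem_iff_mem_of_not_nondeg {w : Finset (Fin n) → ℝ} (hw : IsRayleigh w) {e : Fin n}
    (h : ¬ Nondeg w e) {A B : Finset (Fin n)} (hA : w A ≠ 0) (hB : w B ≠ 0) : e ∈ A ↔ e ∈ B := by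
  rw [Nondeg, not_and_or, not_lt, not_lt] at h
  rcases h with h | h
  · have h1 := eq_zero_of_mass_eq_zero (hw.avoiding e).1 h
    have h2 : ∀ C, w C ≠ 0 → e ∈ C := by
      intro C hC
      by_contra h3
      have := h1 C
      simp [avoiding, h3] at this
      exact hC this
    simp [h2 A hA, h2 B hB]
  · have h1 := eq_zero_of_mass_eq_zero (hw.including e).1 h
    have h2 : ∀ C, w C ≠ 0 → e ∉ C := by
      intro C hC h3
      have := h1 C
      simp [including, h3] at this
      exact hC this
    simp [h2 A hA, h2 B hB]

theorem ucov_memInd_of_not_nondeg {w : Finset (Fin n) → ℝ} (hw : IsRayleigh w) {e : Fin n}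
    (h : ¬ Nondeg w e) (ψ : Finset (Fin n) → ℝ) : ucov w (memInd e) ψ = 0 := by
  rw [ucov_memInd_eq_sum]
  refine Finset.sum_eq_zero fun A _ => Finset.sum_eq_zero fun B _ => ?_
  by_cases hA : w A = 0
  · simp [including, hA]
  by_cases hB : w B = 0
  · simp [avoiding, hB]
  have := mem_iff_mem_of_not_nondeg hw h hA hB
  simp only [including, avoiding]
  by_cases h1 : e ∈ A
  · simp [this.1 h1]
  · simp [h1]

theorem sum_ucov_memInd_nonneg {w : Finset (Fin n) → ℝ} (hw : RayleighAt w)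
    {T : Finset (Fin n)} {e : Fin n}
    (he : e ∈ T) : 0 ≤ ∑ j ∈ T, ucov w (memInd e) (memInd j) := by
  have h := hw.2 e
  rw [← Finset.sum_add_sum_compl T] at h
  have h2 : ∑ j ∈ Tᶜ, ucov w (memInd e) (memInd j) ≤ 0 :=
    Finset.sum_nonpos fun j hj => hw.1 e j (by rintro rfl; simp [he] at hj)
  linarith

theorem sum_ucov_memInd_le {w : Finset (Fin n) → ℝ} (hw : RayleighAt w)
    {T : Finset (Fin n)} {e : Fin n}
    (he : e ∈ T) : ∑ j ∈ T, ucov w (memInd e) (memInd j) ≤ ucov w (memInd e) (memInd e) := by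
  rw [← Finset.add_sum_erase T _ he]
  have h2 : ∑ j ∈ T.erase e, ucov w (memInd e) (memInd j) ≤ 0 :=
    Finset.sum_nonpos fun j hj => hw.1 e j (Finset.ne_of_mem_erase hj).symm
  linarith

/-- The size of `A ∩ T` is positively correlated with increasing functions of `A ∩ T`. -/
theorem sum_ucov_memInd_monotone_nonneg {ψ : Finset (Fin n) → ℝ} (hψ : Monotone ψ)
    {T : Finset (Fin n)}
    (hT : ∀ A, ψ (A ∩ T) = ψ A) :
    ∀ (m : ℕ) (w : Finset (Fin n) → ℝ), (wsupp w).card = m → IsRayleigh w →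
      0 ≤ ∑ e ∈ T, ucov w (memInd e) ψ := by
  intro m
  induction m using Nat.strong_induction_on with
  | _ m ih =>
  intro w hm hw
  by_contra! hneg
  have hR := hw.rayleighAt
  have hcomm : ∀ v : Finset (Fin n) → ℝ, ucov v (∑ e ∈ T, memInd e) ψ =
      ∑ e ∈ T, ucov v (memInd e) ψ := by
    intro v
    rw [ucov_comm, ucov_sum_right]
    exact Finset.sum_congr rfl fun e _ => ucov_comm _ _ _
  have key : ∀ e ∈ T, Nondeg w e →
      ucov w (memInd e) ψ < 0 ∧ ucov w (memInd e) ψ ≤ ∑ f ∈ T, ucov w (memInd f) ψ := by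
    intro e he hnd
    have i0 := ih _ (hm ▸ card_wsupp_avoiding_lt hnd.2) (avoiding w e) rfl (hw.avoiding e)
    have i1 := ih _ (hm ▸ card_wsupp_including_lt hnd.1) (including w e) rfl (hw.including e)
    have ht := ucov_eq_total w (∑ e ∈ T, memInd e) ψ e hnd.1.ne' hnd.2.ne'
    rw [hcomm, hcomm, hcomm, ucov_sum_right] at ht
    have hZ : 0 ≤ mass w 1 := mass_nonneg hw.1 fun _ => zero_le_one
    have p0 := mul_nonneg (div_nonneg hZ hnd.1.le) i0
    have p1 := mul_nonneg (div_nonneg hZ hnd.2.le) i1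
    have a0 := sum_ucov_memInd_nonneg hR he
    have a1 := sum_ucov_memInd_le hR he
    rw [ucov_memInd_self] at a1
    have hpos := mul_pos hnd.1 hnd.2
    rw [mul_div_right_comm] at ht
    have b0 := div_nonneg a0 hpos.le
    have b1 := (div_le_one hpos).2 a1
    set q := (∑ j ∈ T, ucov w (memInd e) (memInd j)) /
      (mass (avoiding w e) 1 * mass (including w e) 1)
    have hc : ucov w (memInd e) ψ < 0 := by
      by_contra! hc
      have := mul_nonneg b0 hc
      linarith
    refine ⟨hc, ?_⟩
    nlinarith
  obtain ⟨e, he, hlt⟩ := Finset.exists_lt_of_sum_lt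
    (show ∑ e ∈ T, ucov w (memInd e) ψ < ∑ e ∈ T, (0 : ℝ) by simpa using hneg)
  have hnd : Nondeg w e := by
    by_contra h
    rw [ucov_memInd_of_not_nondeg hw h] at hlt
    exact lt_irrefl _ hlt
  have honly : ∀ f ∈ T, f ≠ e → ¬ Nondeg w f := by
    intro f hf hfe hndf
    have h1 := (key e he hnd).2
    rw [← Finset.add_sum_erase T _ he] at h1
    have h2 : ∑ x ∈ T.erase e, ucov w (memInd x) ψ ≤ ucov w (memInd f) ψ := by
      rw [← Finset.add_sum_erase (T.erase e) _ (Finset.mem_erase.2 ⟨hfe, hf⟩)]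
      have : ∑ x ∈ (T.erase e).erase f, ucov w (memInd x) ψ ≤ 0 := by
        refine Finset.sum_nonpos fun x hx => ?_
        by_cases hx' : Nondeg w x
        · exact (key x (Finset.mem_of_mem_erase (Finset.mem_of_mem_erase hx)) hx').1.le
        · exact (ucov_memInd_of_not_nondeg hw hx' ψ).le
      linarith
    have h3 := (key f hf hndf).1
    linarith
  refine absurd hlt (not_lt.2 ?_)
  rw [ucov_memInd_eq_sum]
  refine Finset.sum_nonneg fun A _ => Finset.sum_nonneg fun B _ => ?_
  by_cases hA : w A = 0
  · simp [including, hA]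
  by_cases hB : w B = 0
  · simp [avoiding, hB]
  by_cases hBe : e ∈ B
  · simp [avoiding, hBe]
  refine mul_nonneg (mul_nonneg ((hw.including e).1 A) ((hw.avoiding e).1 B)) (sub_nonneg.2 ?_)
  rw [← hT A, ← hT B]
  refine hψ fun f hf => ?_
  rw [Finset.mem_inter] at hf ⊢
  exact ⟨(mem_iff_mem_of_not_nondeg hw (honly f hf.2 (by rintro rfl; exact hBe hf.1)) hA hB).2 hf.1,
    hf.2⟩

/-- Negative association of a coordinate and an increasing function of the others. -/
theorem ucov_memInd_monotone_nonpos {ψ : Finset (Fin n) → ℝ} (hψ : Monotone ψ)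
    {T : Finset (Fin n)} (hT : ∀ A, ψ (A ∩ T) = ψ A) {k : Fin n} (hk : k ∉ T) :
    ∀ (m : ℕ) (w : Finset (Fin n) → ℝ), (wsupp w).card = m → IsRayleigh w →
      ucov w (memInd k) ψ ≤ 0 := by
  intro m
  induction m using Nat.strong_induction_on with
  | _ m ih =>
  intro w hm hw
  by_cases hex : ∃ e ∈ T, Nondeg w e
  · have : ∃ e ∈ T, Nondeg w e ∧ 0 ≤ ucov w (memInd e) ψ := by
      by_contra! hneg
      obtain ⟨e, he, hnd⟩ := hex
      refine absurd (sum_ucov_memInd_monotone_nonneg hψ hT _ w rfl hw) (not_le.2 ?_)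
      refine Finset.sum_neg' (fun f hf => ?_) ⟨e, he, hneg e he hnd⟩
      by_cases hf' : Nondeg w f
      · exact (hneg f hf hf').le
      · exact (ucov_memInd_of_not_nondeg hw hf' ψ).le
    obtain ⟨e, he, hnd, hpos⟩ := this
    have i0 := ih _ (hm ▸ card_wsupp_avoiding_lt hnd.2) (avoiding w e) rfl (hw.avoiding e)
    have i1 := ih _ (hm ▸ card_wsupp_including_lt hnd.1) (including w e) rfl (hw.including e)
    rw [ucov_eq_total w (memInd k) ψ e hnd.1.ne' hnd.2.ne']
    have hZ : 0 ≤ mass w 1 := mass_nonneg hw.1 fun _ => zero_le_one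
    have p0 := mul_nonpos_of_nonneg_of_nonpos (div_nonneg hZ hnd.1.le) i0
    have p1 := mul_nonpos_of_nonneg_of_nonpos (div_nonneg hZ hnd.2.le) i1
    have p2 : ucov w (memInd e) (memInd k) ≤ 0 :=
      hw.rayleighAt.1 e k (by rintro rfl; exact hk he)
    have p3 := div_nonpos_of_nonpos_of_nonneg (mul_nonpos_of_nonpos_of_nonneg p2 hpos)
      (mul_pos hnd.1 hnd.2).le
    linarith
  · push Not at hex
    refine le_of_eq ?_
    rw [ucov_memInd_eq_sum]
    refine Finset.sum_eq_zero fun A _ => Finset.sum_eq_zero fun B _ => ?_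
    by_cases hA : w A = 0
    · simp [including, hA]
    by_cases hB : w B = 0
    · simp [avoiding, hB]
    have : A ∩ T = B ∩ T := by
      ext f
      simp only [Finset.mem_inter]
      exact and_congr_left fun hf => mem_iff_mem_of_not_nondeg hw (hex f hf) hA hB
    rw [← hT A, ← hT B, this]
    simp

end Covariance

section Stability

variable {n : ℕ}

/-- The value at `z` of the complex generating polynomial of the weight `w`. -/
noncomputable def genEval (w : Finset (Fin n) → ℝ) (z : Fin n → ℂ) : ℂ := ∑ A, w A * ∏ i ∈ A, z i

/-- The generating polynomial of `w` does not vanish on the open upper half-planes. -/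
def StableWeight (w : Finset (Fin n) → ℝ) : Prop :=
  ∀ z : Fin n → ℂ, (∀ i, 0 < (z i).im) → genEval w z ≠ 0

theorem StableWeight.tilt {w : Finset (Fin n) → ℝ} (hw : StableWeight w) {x : Fin n → ℝ}
    (hx : ∀ i, 0 < x i) : StableWeight fun A => w A * ∏ i ∈ A, x i := by
  intro z hz
  have h := hw (fun i => x i * z i) fun i => by simpa using mul_pos (hx i) (hz i)
  convert h using 1
  unfold genEval
  refine Finset.sum_congr rfl fun A _ => ?_
  rw [Finset.prod_mul_distrib]
  push_cast
  ring

theorem genEval_update (w : Finset (Fin n) → ℝ) (z : Fin n → ℂ) (e : Fin n) (he : z e = 1)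
    (b : ℂ) : genEval w (Function.update z e b) =
      genEval (avoiding w e) z + b * genEval (including w e) z := by
  unfold genEval
  rw [Finset.mul_sum, ← Finset.sum_add_distrib]
  refine Finset.sum_congr rfl fun A _ => ?_
  unfold avoiding including
  have h : ∏ i ∈ A, Function.update z e b i = (if e ∈ A then b else 1) * ∏ i ∈ A, z i := by
    have h : ∀ i, Function.update z e b i = (if i = e then b else 1) * z i := by
      intro i
      by_cases hi : i = e
      · subst hi; simp [he]
      · simp [hi]
    simp_rw [h]
    rw [Finset.prod_mul_distrib, Finset.prod_ite_eq' A e (fun _ => b)]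
  rw [h]
  split_ifs <;> push_cast <;> ring

theorem genEval_one (w : Finset (Fin n) → ℝ) : genEval w 1 = (mass w 1 : ℝ) := by
  simp [genEval, mass]

theorem StableWeight.ucov_memInd_nonpos {w : Finset (Fin n) → ℝ} (hw : StableWeight w)
    (hw0 : ∀ A, 0 ≤ w A) {i j : Fin n} (hij : i ≠ j) : ucov w (memInd i) (memInd j) ≤ 0 := by
  by_contra! hlt
  set Z00 := mass (avoiding (avoiding w j) i) 1
  set Z01 := mass (avoiding (including w j) i) 1
  set Z10 := mass (including (avoiding w j) i) 1
  set Z11 := mass (including (including w j) i) 1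
  have e1 : ucov w (memInd i) (memInd j) = Z00 * Z11 - Z10 * Z01 := by
    rw [ucov_comm, ucov_memInd, mass_memInd, mass_memInd, mass_split (avoiding w j) 1 i,
      mass_split (including w j) 1 i]
    ring
  have p10 : 0 ≤ Z10 := mass_nonneg (including_nonneg (avoiding_nonneg hw0 j) i)
      fun _ => zero_le_one
  have p01 : 0 ≤ Z01 := mass_nonneg (avoiding_nonneg (including_nonneg hw0 j) i)
      fun _ => zero_le_one
  have p11 : 0 ≤ Z11 := mass_nonneg (including_nonneg (including_nonneg hw0 j) i)
      fun _ => zero_le_one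
  have hZ11 : Z11 ≠ 0 := by
    intro h
    rw [e1, h] at hlt
    nlinarith [mul_nonneg p10 p01]
  set v : ℝ → Fin n → ℂ := fun ε l => if l = j then 1 else if l = i then Complex.I else
    1 + ε * Complex.I with hv
  have vj : ∀ ε, v ε j = 1 := fun ε => by simp [hv]
  have v0 : v 0 = Function.update (1 : Fin n → ℂ) i Complex.I := by
    funext l
    by_cases hl : l = i
    · subst hl; simp [hv, hij]
    · simp [hv, hl]
  have hα0 : genEval (avoiding w j) (v 0) = Z00 + Complex.I * Z10 := by
    rw [v0, genEval_update _ _ _ rfl, genEval_one, genEval_one]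
  have hβ0 : genEval (including w j) (v 0) = Z01 + Complex.I * Z11 := by
    rw [v0, genEval_update _ _ _ rfl, genEval_one, genEval_one]
  have hcont : ∀ u : Finset (Fin n) → ℝ, Continuous fun ε => genEval u (v ε) := by
    intro u
    unfold genEval
    refine continuous_finsetSum _ fun A _ => continuous_const.mul
      (continuous_finsetProd _ fun l _ => ?_)
    simp only [hv]
    split_ifs <;> fun_prop
  have hβne : genEval (including w j) (v 0) ≠ 0 := by
    rw [hβ0]
    intro h
    have := congrArg Complex.im h
    simp at this
    exact hZ11 this
  set b : ℝ → ℂ := fun ε => -(genEval (avoiding w j) (v ε) / genEval (including w j) (v ε)) with hb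
  have hbc : ContinuousAt b 0 :=
    ((hcont _).continuousAt.div (hcont _).continuousAt hβne).neg
  have hb0 : 0 < (b 0).im := by
    simp only [hb, hα0, hβ0]
    rw [Complex.neg_im, Complex.div_im, ← sub_div, ← neg_div]
    refine div_pos ?_ (Complex.normSq_pos.2 (hβ0 ▸ hβne))
    simp
    rw [e1] at hlt
    linarith
  have ev1 : ∀ᶠ ε in nhds (0 : ℝ), 0 < (b ε).im :=
    (Complex.continuous_im.continuousAt.comp hbc).eventually (lt_mem_nhds hb0)
  have ev2 : ∀ᶠ ε in nhds (0 : ℝ), genEval (including w j) (v ε) ≠ 0 :=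
    (hcont _).continuousAt.eventually_ne hβne
  obtain ⟨ε, ⟨h1, h2⟩, h3⟩ := (((ev1.and ev2).filter_mono nhdsWithin_le_nhds).and
    (self_mem_nhdsWithin : Set.Ioi (0 : ℝ) ∈ nhdsWithin 0 (Set.Ioi 0))).exists
  refine hw (Function.update (v ε) j (b ε)) (fun l => ?_) ?_
  · by_cases hl : l = j
    · subst hl; simpa using h1
    · by_cases hl' : l = i
      · subst hl'; simp [hv, hl]
      · simpa [hv, hl, hl'] using h3
  · rw [genEval_update _ _ _ (vj ε)]
    simp only [hb]
    field_simp
    ring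

theorem hasDerivAt_sum_mul_pow (w : Finset (Fin n) → ℝ) (e : Fin n) :
    HasDerivAt (fun t : ℂ => ∑ A, (w A : ℂ) * t ^ (A.erase e).card)
      (mass w fun A => ((A.erase e).card : ℝ) : ℝ) 1 := by
  have h : ∀ A ∈ (Finset.univ : Finset (Finset (Fin n))),
      HasDerivAt (fun t : ℂ => (w A : ℂ) * t ^ (A.erase e).card)
        ((w A : ℂ) * ((A.erase e).card : ℂ)) 1 := by
    intro A _
    have := (hasDerivAt_pow (A.erase e).card (1 : ℂ)).const_mul (w A : ℂ)
    simpa using this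
  refine (HasDerivAt.fun_sum h).congr_deriv ?_
  simp [mass]

theorem sum_memInd_eq (e : Fin n) :
    ∑ j, memInd j = memInd e + fun A => ((A.erase e).card : ℝ) := by
  funext A
  simp only [Finset.sum_apply, memInd, Pi.add_apply, Finset.sum_boole]
  simp only [Finset.filter_univ_mem]
  by_cases h : e ∈ A
  · have := Finset.card_erase_add_one h
    rw [if_pos h, ← this]
    push_cast
    ring
  · simp [h]

theorem StableWeight.sum_ucov_memInd_nonneg {w : Finset (Fin n) → ℝ} (hw : StableWeight w)
    (hw0 : ∀ A, 0 ≤ w A) (e : Fin n) : 0 ≤ ∑ j, ucov w (memInd e) (memInd j) := by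
  rw [← ucov_sum_right, sum_memInd_eq e]
  set N : Finset (Fin n) → ℝ := fun A => ((A.erase e).card : ℝ) with hN
  have hadd : ucov w (memInd e) (memInd e + N) =
      ucov w (memInd e) (memInd e) + ucov w (memInd e) N := by
    unfold ucov
    rw [mul_add, mass_add, mass_add]
    ring
  rw [hadd, ucov_memInd_self, ucov_memInd]
  have a0 := avoiding_nonneg hw0 e
  have a1 := including_nonneg hw0 e
  have N0 : ∀ A, 0 ≤ N A := fun A => Nat.cast_nonneg _
  have m0 : 0 ≤ mass (avoiding w e) 1 := mass_nonneg a0 fun _ => zero_le_one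
  have m1 : 0 ≤ mass (including w e) 1 := mass_nonneg a1 fun _ => zero_le_one
  have mN1 : 0 ≤ mass (including w e) N := mass_nonneg a1 N0
  rcases m0.eq_or_lt with h | p0
  · have hz := eq_zero_of_mass_eq_zero a0 h.ge
    have : mass (avoiding w e) N = 0 := by simp [mass, hz]
    rw [this, ← h]
    simp
  rcases m1.eq_or_lt with h | p1
  · rw [← h]
    have := mul_nonneg m0 mN1
    linarith
  have hconj : ∀ (u : Finset (Fin n) → ℝ) (z : ℂ),
      ∑ A, (u A : ℂ) * ((starRingEnd ℂ) z) ^ (A.erase e).card =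
        (starRingEnd ℂ) (∑ A, (u A : ℂ) * z ^ (A.erase e).card) := by
    intro u z
    simp [map_sum]
  have hposr : ∀ u : Finset (Fin n) → ℝ, (∀ A, 0 ≤ u A) → 0 < mass u 1 →
      ∀ x : ℝ, 0 < x → ∃ y : ℝ, 0 < y ∧ ∑ A, (u A : ℂ) * (x : ℂ) ^ (A.erase e).card = y := by
    intro u hu hm x hx
    refine ⟨∑ A, u A * x ^ (A.erase e).card, ?_, by push_cast; rfl⟩
    obtain ⟨A, hA⟩ := exists_of_mass_pos hm
    exact Finset.sum_pos' (fun B _ => mul_nonneg (hu B) (pow_pos hx _).le)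
      ⟨A, Finset.mem_univ A, mul_pos (lt_of_le_of_ne (hu A) hA.symm) (pow_pos hx _)⟩
  have hgen : ∀ (u : Finset (Fin n) → ℝ) (t : ℂ), genEval u (Function.update (fun _ => t) e 1) =
      ∑ A, (u A : ℂ) * t ^ (A.erase e).card := by
    intro u t
    unfold genEval
    refine Finset.sum_congr rfl fun A _ => ?_
    congr 1
    rw [← Finset.prod_const]
    by_cases hA : e ∈ A
    · rw [← Finset.mul_prod_erase A _ hA, Function.update_self, one_mul]
      exact Finset.prod_congr rfl fun i hi =>
        Function.update_of_ne (Finset.ne_of_mem_erase hi) _ _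
    · rw [Finset.erase_eq_of_notMem hA]
      exact Finset.prod_congr rfl fun i hi =>
        Function.update_of_ne (by rintro rfl; exact hA hi) _ _
  have hdiff : ∀ u : Finset (Fin n) → ℝ,
      Differentiable ℂ fun t : ℂ => ∑ A, (u A : ℂ) * t ^ (A.erase e).card := by
    intro u
    fun_prop
  have hval : ∀ u : Finset (Fin n) → ℝ,
      ∑ A, (u A : ℂ) * (1 : ℂ) ^ (A.erase e).card = (mass u 1 : ℝ) := by
    intro u
    simp [mass]
  have := wronskian_le_mul (hdiff (avoiding w e)) (hdiff (including w e)) (hconj _) (hconj _)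
    (hposr _ a0 p0) (hposr _ a1 p1) (fun t s ht hs => by
      rw [← hgen, ← hgen, ← genEval_update _ _ _ (Function.update_self ..)]
      refine hw _ fun l => ?_
      by_cases hl : l = e
      · subst hl; simpa using hs
      · simpa [hl] using ht) (hval _) (hval _)
    (hasDerivAt_sum_mul_pow _ e) (hasDerivAt_sum_mul_pow _ e)
  change mass (avoiding w e) N * _ - _ * mass (including w e) N ≤ _ at this
  linarith

theorem StableWeight.isRayleigh {w : Finset (Fin n) → ℝ} (hw : StableWeight w)
    (hw0 : ∀ A, 0 ≤ w A) : IsRayleigh w :=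
  ⟨hw0, fun _ hx =>
    have h0 := fun A => mul_nonneg (hw0 A) (Finset.prod_nonneg fun i _ => (hx i).le)
    ⟨fun _ _ hij => (hw.tilt hx).ucov_memInd_nonpos h0 hij,
      fun i => (hw.tilt hx).sum_ucov_memInd_nonneg h0 i⟩⟩

end Stability

section EntropyIncrement

variable {n : ℕ}

theorem eval_map_genPoly (μ : Finset (Fin n) → ℝ) (z : Fin n → ℂ) :
    MvPolynomial.eval z (MvPolynomial.map (algebraMap ℝ ℂ) (genPoly μ)) = genEval μ z := by
  unfold genPoly genEval
  rw [map_sum, map_sum]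
  refine Finset.sum_congr rfl fun A _ => ?_
  rw [MvPolynomial.map_monomial, MvPolynomial.eval_monomial]
  congr 1
  unfold expOf
  rw [← Finsupp.prod_finsetSum_index (fun _ => pow_zero _) (fun _ _ _ => pow_add _ _ _)]
  simp

theorem StronglyRayleigh.isRayleigh {μ : Finset (Fin n) → ℝ} (h : StronglyRayleigh μ) :
    IsRayleigh μ :=
  StableWeight.isRayleigh (fun z hz => eval_map_genPoly μ z ▸ h.2 z hz) h.1.1

theorem sum_mul_restrictLaw (w : Finset (Fin n) → ℝ) (T : Finset (Fin n))
    (s : Finset (Fin n) → ℝ) : ∑ B, s B * restrictLaw w T B = mass w fun A => s (A ∩ T) := by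
  unfold restrictLaw mass
  refine Eq.trans ?_ (Finset.sum_fiberwise Finset.univ (fun A => A ∩ T) fun A => w A * s (A ∩ T))
  refine Finset.sum_congr rfl fun B _ => ?_
  rw [Finset.mul_sum]
  refine Finset.sum_congr rfl fun A hA => ?_
  rw [(Finset.mem_filter.1 hA).2, mul_comm]

theorem sum_restrictLaw (w : Finset (Fin n) → ℝ) (T : Finset (Fin n)) :
    ∑ B, restrictLaw w T B = mass w 1 :=
  (Finset.sum_congr rfl fun _ _ => (one_mul _).symm).trans (sum_mul_restrictLaw w T 1)

theorem restrictLaw_eq_add (w : Finset (Fin n) → ℝ) (T B : Finset (Fin n)) (k : Fin n) :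
    restrictLaw w T B = restrictLaw (avoiding w k) T B + restrictLaw (including w k) T B := by
  unfold restrictLaw avoiding including
  rw [← Finset.sum_add_distrib]
  refine Finset.sum_congr rfl fun A _ => ?_
  split_ifs <;> simp

theorem restrictLaw_nonneg {w : Finset (Fin n) → ℝ} (hw : ∀ A, 0 ≤ w A) (T B : Finset (Fin n)) :
    0 ≤ restrictLaw w T B :=
  Finset.sum_nonneg fun A _ => hw A

theorem mass_including_one (w : Finset (Fin n) → ℝ) (e : Fin n) :
    mass (including w e) 1 = probMem w e := by
  simp [mass, including, probMem, Finset.sum_filter]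

/-- For a negatively associated law, the restriction to `T` is nearly independent of `k ∈ 𝔛` when
the covariances with the elements of `T` are small. -/
theorem sum_abs_restrictLaw_le {w : Finset (Fin n) → ℝ} (hw : IsRayleigh w) (h1 : mass w 1 = 1)
    {T : Finset (Fin n)} {k : Fin n} (hk : k ∉ T) :
    ∑ B, |restrictLaw w T B * probMem w k - restrictLaw (including w k) T B| ≤
      2 * ∑ j ∈ T, -ucov w (memInd k) (memInd j) := by
  set g : Finset (Fin n) → ℝ :=
    fun B => restrictLaw w T B * probMem w k - restrictLaw (including w k) T B
  set s : Finset (Fin n) → ℝ := fun B => if 0 ≤ g B then 1 else -1 with hs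
  have hsb : ∀ B, -1 ≤ s B ∧ s B ≤ 1 := fun B => by
    simp only [hs]; split_ifs <;> norm_num
  have hsg : ∀ B, |g B| = s B * g B := fun B => by
    simp only [hs]
    split_ifs with h
    · rw [abs_of_nonneg h, one_mul]
    · rw [abs_of_neg (not_le.1 h)]; ring
  have hN : ∀ A : Finset (Fin n), (∑ j ∈ T, memInd j) A = ((A ∩ T).card : ℝ) := by
    intro A
    simp only [Finset.sum_apply, memInd, Finset.sum_boole]
    rw [Finset.filter_mem_eq_inter, Finset.inter_comm]
  set ψ : Finset (Fin n) → ℝ := fun A => 2 * ((A ∩ T).card : ℝ) - s (A ∩ T) with hψ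
  have hmono : Monotone ψ := by
    intro A A' hA
    have hsub : A ∩ T ⊆ A' ∩ T := Finset.inter_subset_inter_right hA
    rcases hsub.eq_or_ssubset with h | h
    · simp only [hψ, h, le_refl]
    · have hc : ((A ∩ T).card : ℝ) + 1 ≤ ((A' ∩ T).card : ℝ) := by
        exact_mod_cast Finset.card_lt_card h
      simp only [hψ]
      linarith [(hsb (A ∩ T)).1, (hsb (A' ∩ T)).2]
  have hneg := ucov_memInd_monotone_nonpos hmono (T := T)
    (fun A => by simp only [hψ, Finset.inter_assoc, Finset.inter_self]) hk _ w rfl hw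
  have hsum : ucov w (memInd k) ψ = 2 * ∑ j ∈ T, ucov w (memInd k) (memInd j) -
      ucov w (memInd k) (fun A => s (A ∩ T)) := by
    have : ψ = (2 : ℝ) • (∑ j ∈ T, memInd j) - fun A => s (A ∩ T) := by
      funext A
      simp only [Pi.sub_apply, Pi.smul_apply, hN, smul_eq_mul, hψ]
    rw [← ucov_sum_right, this]
    unfold ucov
    rw [mul_sub, mul_smul_comm, mass_sub, mass_sub, mass_smul, mass_smul]
    ring
  have hval : ∑ B, |g B| = -ucov w (memInd k) (fun A => s (A ∩ T)) := by
    unfold ucov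
    rw [h1, one_mul, mass_memInd_mul, mass_memInd, mass_including_one, ← sum_mul_restrictLaw,
      ← sum_mul_restrictLaw, Finset.mul_sum, ← Finset.sum_sub_distrib, ← Finset.sum_neg_distrib]
    refine Finset.sum_congr rfl fun B _ => ?_
    rw [hsg]
    ring
  rw [hval, Finset.sum_neg_distrib]
  linarith

theorem continuous_binEnt : Continuous binEnt := by
  have h : Continuous fun x : ℝ => x * Real.logb 2 x := by
    simpa only [Real.logb, mul_div_assoc] using Real.continuous_mul_log.div_const (Real.log 2)
  exact h.neg.sub (h.comp (continuous_const.sub continuous_id))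

theorem exists_abs_binEnt_sub_le {ε : ℝ} (hε : 0 < ε) :
    ∃ c : ℝ, 0 ≤ c ∧ ∀ p ∈ Set.Icc (0 : ℝ) 1, ∀ q ∈ Set.Icc (0 : ℝ) 1,
      |binEnt p - binEnt q| ≤ ε + c * |p - q| := by
  obtain ⟨M, hM⟩ := (isCompact_Icc (a := (0 : ℝ)) (b := 1)).exists_bound_of_continuousOn
    continuous_binEnt.continuousOn
  have huc := isCompact_Icc.uniformContinuousOn_of_continuous
    (continuous_binEnt.continuousOn (s := Set.Icc (0 : ℝ) 1))
  obtain ⟨d, hd, H⟩ := Metric.uniformContinuousOn_iff.1 huc ε hε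
  have hM0 : 0 ≤ M := (norm_nonneg _).trans (hM 0 (by simp))
  refine ⟨2 * M / d, by positivity, fun p hp q hq => ?_⟩
  rcases lt_or_ge |p - q| d with h | h
  · have := H p hp q hq h
    rw [Real.dist_eq] at this
    have : 0 ≤ 2 * M / d * |p - q| := by positivity
    linarith
  · have hbound : |binEnt p - binEnt q| ≤ 2 * M := by
      have := abs_sub (binEnt p) (binEnt q)
      have hp' := hM p hp
      have hq' := hM q hq
      rw [Real.norm_eq_abs] at hp' hq'
      linarith
    have : 2 * M ≤ 2 * M / d * |p - q| := by
      rw [div_mul_eq_mul_div, le_div_iff₀ hd]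
      gcongr
    linarith

/-- The chain rule for the entropy of a split of the mass `a` into `b` and `a - b`. -/
theorem mul_binEnt_div {a b : ℝ} (hb : 0 ≤ b) (hba : b ≤ a) :
    a * binEnt (b / a) = a * Real.logb 2 a - b * Real.logb 2 b -
      (a - b) * Real.logb 2 (a - b) := by
  rcases (hb.trans hba).eq_or_lt with rfl | ha
  · obtain rfl : b = 0 := le_antisymm hba hb
    simp
  have h : ∀ x : ℝ, x / a * Real.logb 2 (x / a) * a =
      x * Real.logb 2 x - x * Real.logb 2 a := by
    intro x
    rcases eq_or_ne x 0 with rfl | hx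
    · simp
    · rw [Real.logb_div hx ha.ne']
      field_simp
  have hsub : 1 - b / a = (a - b) / a := by field_simp
  unfold binEnt
  rw [hsub]
  linear_combination -(h b) - h (a - b)

theorem restrictLaw_of_not_subset (w : Finset (Fin n) → ℝ) {T B : Finset (Fin n)} (h : ¬ B ⊆ T) :
    restrictLaw w T B = 0 := by
  refine Finset.sum_eq_zero fun A hA => ?_
  exact absurd ((Finset.mem_filter.1 hA).2 ▸ Finset.inter_subset_right) h

theorem entropyPP_restrictLaw (w : Finset (Fin n) → ℝ) (T : Finset (Fin n)) :
    entropyPP (restrictLaw w T) =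
      -∑ B ∈ T.powerset, restrictLaw w T B * Real.logb 2 (restrictLaw w T B) := by
  unfold entropyPP
  congr 1
  refine (Finset.sum_subset (Finset.subset_univ _) fun B _ hB => ?_).symm
  rw [restrictLaw_of_not_subset w (by simpa using hB), zero_mul]

theorem restrictLaw_insert_of_notMem (w : Finset (Fin n) → ℝ) {T B : Finset (Fin n)} {k : Fin n}
    (hB : k ∉ B) : restrictLaw w (insert k T) B = restrictLaw (avoiding w k) T B := by
  unfold restrictLaw avoiding
  rw [Finset.sum_filter, Finset.sum_filter]
  refine Finset.sum_congr rfl fun A _ => ?_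
  by_cases hA : k ∈ A
  · have : A ∩ insert k T ≠ B := by
      rintro rfl
      exact hB (by simp [hA])
    rw [if_neg this]
    simp [hA]
  · simp [hA, Finset.inter_insert_of_notMem hA]

theorem restrictLaw_insert_insert (w : Finset (Fin n) → ℝ) {T B : Finset (Fin n)} {k : Fin n}
    (hT : k ∉ T) (hB : k ∉ B) :
    restrictLaw w (insert k T) (insert k B) = restrictLaw (including w k) T B := by
  unfold restrictLaw including
  rw [Finset.sum_filter, Finset.sum_filter]
  refine Finset.sum_congr rfl fun A _ => ?_
  by_cases hA : k ∈ A
  · have hAT : k ∉ A ∩ T := by simp [hT]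
    have : insert k (A ∩ T) = insert k B ↔ A ∩ T = B := by
      refine ⟨fun h => ?_, fun h => by rw [h]⟩
      rw [← Finset.erase_insert hAT, h, Finset.erase_insert hB]
    simp [hA, Finset.inter_insert_of_mem hA, this]
  · have : A ∩ insert k T ≠ insert k B := by
      intro h
      have : k ∈ A ∩ insert k T := h ▸ Finset.mem_insert_self k B
      exact hA (Finset.mem_inter.1 this).1
    rw [if_neg this]
    simp [hA]

theorem entropyPP_restrictLaw_insert {w : Finset (Fin n) → ℝ} (hw : ∀ A, 0 ≤ w A)
    {T : Finset (Fin n)} {k : Fin n} (hk : k ∉ T) :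
    entropyPP (restrictLaw w (insert k T)) = entropyPP (restrictLaw w T) +
      ∑ B, restrictLaw w T B * binEnt (restrictLaw (including w k) T B / restrictLaw w T B) := by
  have hsub : ∑ B, restrictLaw w T B * binEnt (restrictLaw (including w k) T B / restrictLaw w T B)
      = ∑ B ∈ T.powerset,
        restrictLaw w T B * binEnt (restrictLaw (including w k) T B / restrictLaw w T B) := by
    refine (Finset.sum_subset (Finset.subset_univ _) fun B _ hB => ?_).symm
    rw [restrictLaw_of_not_subset w (by simpa using hB), zero_mul]
  rw [hsub, entropyPP_restrictLaw, entropyPP_restrictLaw, Finset.sum_powerset_insert hk,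
    ← Finset.sum_add_distrib, ← Finset.sum_neg_distrib, ← Finset.sum_neg_distrib,
    ← Finset.sum_add_distrib]
  refine Finset.sum_congr rfl fun B hB => ?_
  have hkB : k ∉ B := fun h => hk (Finset.mem_powerset.1 hB h)
  have h0 := restrictLaw_nonneg (avoiding_nonneg hw k) T B
  have h1 := restrictLaw_nonneg (including_nonneg hw k) T B
  have hadd := restrictLaw_eq_add w T B k
  rw [restrictLaw_insert_of_notMem w hkB, restrictLaw_insert_insert w hk hkB,
    mul_binEnt_div h1 (by linarith), show restrictLaw w T B - restrictLaw (including w k) T B =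
      restrictLaw (avoiding w k) T B by linarith]
  ring

theorem abs_entropyPP_insert_sub_le {w : Finset (Fin n) → ℝ} (hw : IsRayleigh w)
    (h1 : mass w 1 = 1) {T : Finset (Fin n)} {k : Fin n} (hk : k ∉ T) {ε c : ℝ} (hc : 0 ≤ c)
    (H : ∀ p ∈ Set.Icc (0 : ℝ) 1, ∀ q ∈ Set.Icc (0 : ℝ) 1,
      |binEnt p - binEnt q| ≤ ε + c * |p - q|) :
    |entropyPP (restrictLaw w (insert k T)) - entropyPP (restrictLaw w T) -
      binEnt (probMem w k)| ≤ ε + 2 * c * ∑ j ∈ T, -ucov w (memInd k) (memInd j) := by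
  have hp : probMem w k ∈ Set.Icc (0 : ℝ) 1 := by
    rw [← mass_including_one]
    have h0 := mass_nonneg (avoiding_nonneg hw.1 k) (φ := 1) fun _ => zero_le_one
    have := mass_split w 1 k
    exact ⟨mass_nonneg (including_nonneg hw.1 k) fun _ => zero_le_one, by linarith⟩
  have hR : ∑ B, restrictLaw w T B = 1 := (sum_restrictLaw w T).trans h1
  have hpt : ∀ B, |restrictLaw w T B *
      binEnt (restrictLaw (including w k) T B / restrictLaw w T B) -
        restrictLaw w T B * binEnt (probMem w k)| ≤ restrictLaw w T B * ε +
        c * |restrictLaw w T B * probMem w k - restrictLaw (including w k) T B| := by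
    intro B
    have hb := restrictLaw_nonneg (including_nonneg hw.1 k) T B
    have hba : restrictLaw (including w k) T B ≤ restrictLaw w T B := by
      linarith [restrictLaw_nonneg (avoiding_nonneg hw.1 k) T B, restrictLaw_eq_add w T B k]
    generalize restrictLaw (including w k) T B = b at *
    generalize restrictLaw w T B = a at *
    rcases (hb.trans hba).eq_or_lt with rfl | ha
    · simp only [zero_mul, sub_self, abs_zero, zero_add]
      positivity
    have := H (b / a) ⟨by positivity, (div_le_one ha).2 hba⟩ _ hp
    rw [← mul_sub, abs_mul, abs_of_pos ha]
    have hdist : a * |b / a - probMem w k| = |a * probMem w k - b| := by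
      rw [← abs_of_pos ha, ← abs_mul, abs_of_pos ha, abs_sub_comm]
      congr 1
      field_simp
    calc a * |binEnt (b / a) - binEnt (probMem w k)| ≤ a * (ε + c * |b / a - probMem w k|) := by
          gcongr
      _ = a * ε + c * (a * |b / a - probMem w k|) := by ring
      _ = _ := by rw [hdist]
  have hsplit : entropyPP (restrictLaw w (insert k T)) - entropyPP (restrictLaw w T) -
      binEnt (probMem w k) = ∑ B, (restrictLaw w T B *
      binEnt (restrictLaw (including w k) T B / restrictLaw w T B) -
        restrictLaw w T B * binEnt (probMem w k)) := by
    rw [entropyPP_restrictLaw_insert hw.1 hk, Finset.sum_sub_distrib, ← Finset.sum_mul, hR]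
    ring
  rw [hsplit]
  refine (Finset.abs_sum_le_sum_abs _ _).trans ((Finset.sum_le_sum fun B _ => hpt B).trans ?_)
  rw [Finset.sum_add_distrib, ← Finset.sum_mul, ← Finset.mul_sum, hR]
  have := mul_le_mul_of_nonneg_left (sum_abs_restrictLaw_le hw h1 hk) hc
  linarith

end EntropyIncrement

section Partition

variable {n : ℕ}

/-- The greedy colouring: the weight from each vertex to the earlier vertices of its own colour is
at most the average over the colours. -/
theorem exists_coloring (r : ℕ) [NeZero r] (a : Fin n → Fin n → ℝ) :
    ∃ c : Fin n → Fin r, ∀ k, r * ∑ j with j < k ∧ c j = c k, a k j ≤ ∑ j with j < k, a k j := by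
  suffices h : ∀ m : ℕ, ∃ c : Fin n → Fin r, ∀ k : Fin n, (k : ℕ) < m →
      r * ∑ j with j < k ∧ c j = c k, a k j ≤ ∑ j with j < k, a k j by
    obtain ⟨c, hc⟩ := h n
    exact ⟨c, fun k => hc k k.2⟩
  intro m
  induction m with
  | zero => exact ⟨fun _ => 0, fun k hk => absurd hk (Nat.not_lt_zero _)⟩
  | succ m ih =>
    obtain ⟨c, hc⟩ := ih
    by_cases hm : m < n
    swap
    · exact ⟨c, fun k _ => hc k (by omega)⟩
    set k₀ : Fin n := ⟨m, hm⟩ with hk₀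
    have hsum : ∑ i : Fin r, ∑ j with j < k₀ ∧ c j = i, a k₀ j = ∑ j with j < k₀, a k₀ j := by
      rw [← Finset.sum_fiberwise (Finset.univ.filter fun j => j < k₀) c]
      simp_rw [Finset.filter_filter]
    obtain ⟨i, -, hi⟩ : ∃ i ∈ (Finset.univ : Finset (Fin r)),
        r * ∑ j with j < k₀ ∧ c j = i, a k₀ j ≤ ∑ j with j < k₀, a k₀ j := by
      refine Finset.exists_le_of_sum_le Finset.univ_nonempty ?_
      rw [← Finset.mul_sum, hsum]
      simp
    have hlt : ∀ k : Fin n, (k : ℕ) < m → Function.update c k₀ i k = c k := fun k hk =>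
      Function.update_of_ne (fun h => by simp [h, hk₀] at hk) _ _
    have hfilter : ∀ (k : Fin n) (l : Fin r), (k : ℕ) ≤ m →
        (Finset.univ.filter fun j => j < k ∧ Function.update c k₀ i j = l) =
          Finset.univ.filter fun j => j < k ∧ c j = l := fun k l hk =>
      Finset.filter_congr fun j _ => and_congr_right fun hj => by
        rw [hlt j (lt_of_lt_of_le hj hk)]
    refine ⟨Function.update c k₀ i, fun k hk => ?_⟩
    rw [hfilter k _ (by omega)]
    rcases Nat.lt_succ_iff_lt_or_eq.1 hk with hk | hk
    · rw [hlt k hk]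
      exact hc k hk
    · obtain rfl : k = k₀ := Fin.ext hk
      rwa [Function.update_self]

theorem sum_neg_ucov_memInd_le_one {w : Finset (Fin n) → ℝ} (hw : IsRayleigh w)
    (h1 : mass w 1 = 1) {T : Finset (Fin n)} {k : Fin n} (hk : k ∉ T) :
    ∑ j ∈ T, -ucov w (memInd k) (memInd j) ≤ 1 := by
  have h := sum_ucov_memInd_nonneg hw.rayleighAt (Finset.mem_insert_self k T)
  rw [Finset.sum_insert hk, ucov_memInd_self] at h
  have h0 := mass_nonneg (avoiding_nonneg hw.1 k) (φ := 1) fun _ => zero_le_one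
  have h0' := mass_nonneg (including_nonneg hw.1 k) (φ := 1) fun _ => zero_le_one
  have := mass_split w 1 k
  rw [Finset.sum_neg_distrib]
  nlinarith

theorem entropyPP_restrictLaw_empty {w : Finset (Fin n) → ℝ} (h1 : mass w 1 = 1) :
    entropyPP (restrictLaw w ∅) = 0 := by
  rw [entropyPP_restrictLaw]
  have : restrictLaw w ∅ ∅ = 1 := by
    simpa [restrictLaw, mass] using h1
  simp [this]

theorem abs_entropyPP_sub_sum_le {w : Finset (Fin n) → ℝ} (hw : IsRayleigh w)
    (h1 : mass w 1 = 1) {ε c η : ℝ} (hc : 0 ≤ c)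
    (H : ∀ p ∈ Set.Icc (0 : ℝ) 1, ∀ q ∈ Set.Icc (0 : ℝ) 1,
      |binEnt p - binEnt q| ≤ ε + c * |p - q|) {S : Finset (Fin n)}
    (hS : ∀ k ∈ S, ∑ j ∈ S with j < k, -ucov w (memInd k) (memInd j) ≤ η) :
    |entropyPP (restrictLaw w S) - ∑ j ∈ S, binEnt (probMem w j)| ≤
      S.card * (ε + 2 * c * η) := by
  induction S using Finset.induction_on_max with
  | empty => simp [entropyPP_restrictLaw_empty h1]
  | insert k T hT ih =>
    have hk : k ∉ T := fun h => lt_irrefl k (hT k h)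
    have hfilter : ((insert k T).filter fun j => j < k) = T := by
      ext j
      simp only [Finset.mem_filter, Finset.mem_insert]
      constructor
      · rintro ⟨rfl | h, hj⟩
        exacts [absurd hj (lt_irrefl _), h]
      · exact fun h => ⟨Or.inr h, hT j h⟩
    have hT' := ih fun l hl => by
      have := hS l (Finset.mem_insert_of_mem hl)
      rwa [Finset.filter_insert, if_neg (not_lt.2 (hT l hl).le)] at this
    have hstep := abs_entropyPP_insert_sub_le hw h1 hk hc H
    have hk' := hS k (Finset.mem_insert_self k T)
    rw [hfilter] at hk'
    have := mul_le_mul_of_nonneg_left hk' (mul_nonneg zero_le_two hc)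
    rw [Finset.sum_insert hk, Finset.card_insert_of_notMem hk]
    push_cast
    rw [abs_le] at *
    constructor <;> linarith [hT'.1, hT'.2, hstep.1, hstep.2]

end Partition

theorem stmt2 :
    ∀ δ : ℝ, 0 < δ → ∃ r : ℕ,
      ∀ (n : ℕ) (μ : Finset (Fin n) → ℝ), StronglyRayleigh μ →
        ∃ S : Fin r → Finset (Fin n),
          (∀ i j, i ≠ j → Disjoint (S i) (S j)) ∧ (∀ k, ∃ i, k ∈ S i) ∧
          ∀ i, S i ≠ ∅ →
            |entropyPP (restrictLaw μ (S i)) / ((S i).card : ℝ) -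
              (∑ j ∈ S i, binEnt (probMem μ j)) / ((S i).card : ℝ)| < δ := by
  intro δ hδ
  obtain ⟨c, hc, H⟩ := exists_abs_binEnt_sub_le (half_pos hδ)
  obtain ⟨r, hr⟩ := exists_nat_gt (4 * c / δ)
  have hr0 : (0 : ℝ) < r := lt_of_le_of_lt (by positivity) hr
  have : NeZero r := ⟨by rintro rfl; simp at hr0⟩
  refine ⟨r, fun n μ hμ => ?_⟩
  have hw := hμ.isRayleigh
  have h1 : mass μ 1 = 1 := by simpa [mass] using hμ.1.2
  obtain ⟨col, hcol⟩ := exists_coloring r fun k j => -ucov μ (memInd k) (memInd j)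
  refine ⟨fun i => Finset.univ.filter fun k => col k = i, fun i j hij => ?_,
      fun k => ⟨col k, by simp⟩,
    fun i hi => ?_⟩
  · rw [Finset.disjoint_left]
    intro k hk hk'
    simp only [Finset.mem_filter, Finset.mem_univ, true_and] at hk hk'
    exact hij (hk.symm.trans hk')
  set S := Finset.univ.filter fun k => col k = i
  have hcard : (0 : ℝ) < S.card := by
    exact_mod_cast Finset.card_pos.2 (Finset.nonempty_iff_ne_empty.2 hi)
  have hS : ∀ k ∈ S, ∑ j ∈ S with j < k, -ucov μ (memInd k) (memInd j) ≤ 1 / r := by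
    intro k hk
    have hki : col k = i := by simpa [S] using hk
    have hle := (hcol k).trans (sum_neg_ucov_memInd_le_one hw h1 (by simp))
    rw [le_div_iff₀ hr0, mul_comm]
    convert hle using 3
    ext j
    simp [S, hki, and_comm]
  have hb := abs_entropyPP_sub_sum_le hw h1 hc H hS
  rw [← sub_div, abs_div, abs_of_pos hcard, div_lt_iff₀ hcard]
  refine hb.trans_lt ?_
  rw [mul_comm]
  refine mul_lt_mul_of_pos_right ?_ hcard
  have : 2 * c * (1 / r) < δ / 2 := by
    rw [div_lt_iff₀ hδ] at hr
    rw [mul_one_div, div_lt_iff₀ hr0]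
    linarith
  linarith
end
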